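/- Let G be a (P2∪P4, bull)-free simple graph. Then G is perfectly divisible if and only if G does not contain the Grötzsch graph F1 as an induced subgraph. -/

import Mathlib

open SimpleGraph

/-- `H` is (isomorphic to) an induced subgraph of `G`. -/
def ContainsInduced {α β : Type*} (H : SimpleGraph α) (G : SimpleGraph β) : Prop :=
  ∃ f : α ↪ β, ∀ a b : α, G.Adj (f a) (f b) ↔ H.Adj a b

/-- The disjoint union `P2 ∪ P4`. -/
def P2UnionP4 : SimpleGraph (Fin 6) :=
  SimpleGraph.fromEdgeSet {s(0,1), s(2,3), s(3,4), s(4,5)}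

/-- The bull: a triangle with two disjoint pendant edges. -/
def BullGraph : SimpleGraph (Fin 5) :=
  SimpleGraph.fromEdgeSet {s(0,1), s(0,2), s(1,2), s(0,3), s(1,4)}

/-- The triangle `C3`. -/
def TriangleGraph : SimpleGraph (Fin 3) := ⊤

/-- The paw: a triangle with a pendant edge. -/
def PawGraph : SimpleGraph (Fin 4) :=
  SimpleGraph.fromEdgeSet {s(0,1), s(0,2), s(1,2), s(0,3)}

/-- The diamond: `K4` minus an edge. -/
def DiamondGraph : SimpleGraph (Fin 4) :=
  SimpleGraph.fromEdgeSet {s(0,1), s(0,2), s(0,3), s(1,2), s(1,3)}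

/-- The 5-cycle. -/
def Cycle5 : SimpleGraph (Fin 5) :=
  SimpleGraph.fromEdgeSet {s(0,1), s(1,2), s(2,3), s(3,4), s(0,4)}

/-- The 7-cycle. -/
def Cycle7 : SimpleGraph (Fin 7) :=
  SimpleGraph.fromEdgeSet {s(0,1), s(1,2), s(2,3), s(3,4), s(4,5), s(5,6), s(0,6)}

/-- The Grötzsch graph `F1`: vertex `0` is `v`, vertices `1,…,5` are `w1,…,w5`,
vertices `6,…,10` are `v1,…,v5`; `v` is adjacent exactly to the `wᵢ`, the `vᵢ` form a
5-cycle, and `wᵢ` is adjacent exactly to `v`, `vᵢ` and `vᵢ₊₂` (indices mod 5). -/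
def GrotzschGraph : SimpleGraph (Fin 11) :=
  SimpleGraph.fromEdgeSet
    {s(0,1), s(0,2), s(0,3), s(0,4), s(0,5),
     s(6,7), s(7,8), s(8,9), s(9,10), s(6,10),
     s(1,6), s(1,8), s(2,7), s(2,9), s(3,8), s(3,10), s(4,9), s(4,6), s(5,10), s(5,7)}

/-- The Clebsch graph `F2`: vertices are the elements of `(ℤ/2)⁴`, two vertices adjacent
iff their difference is one of `e1, e2, e3, e4, e1+e2+e3+e4`. -/
def ClebschGraph : SimpleGraph (Fin 4 → ZMod 2) :=
  SimpleGraph.fromRel (fun x y =>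
    x - y ∈ ({Pi.single 0 1, Pi.single 1 1, Pi.single 2 1, Pi.single 3 1, 1} :
      Set (Fin 4 → ZMod 2)))

/-- A graph is perfect if every induced subgraph has chromatic number equal to clique number. -/
def SimpleGraph.IsPerfect {V : Type*} (G : SimpleGraph V) : Prop :=
  ∀ S : Set V, (G.induce S).chromaticNumber = ((G.induce S).cliqueNum : ℕ∞)

/-- A graph is perfectly divisible if each nonempty induced subgraph `H` has a partition
`(A, B)` of its vertex set such that `H[A]` is perfect and `ω(H[B]) < ω(H)`. -/
def SimpleGraph.PerfectlyDivisible {V : Type*} (G : SimpleGraph V) : Prop :=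
  ∀ S : Set V, S.Nonempty → ∃ A B : Set V, A ∪ B = S ∧ A ∩ B = ∅ ∧
    (G.induce A).IsPerfect ∧ (G.induce B).cliqueNum < (G.induce S).cliqueNum

/-- `X` is connected with respect to `r`: every predicate that is not constant on `X` changes along
an `r`-edge inside `X`. -/
def RelConn {V : Type*} (r : V → V → Prop) (X : Set V) : Prop :=
  ∀ p : V → Prop, (∃ a ∈ X, p a) → (∃ b ∈ X, ¬ p b) → ∃ a ∈ X, ∃ b ∈ X, p a ∧ ¬ p b ∧ r a b

section Connectivity

variable {V : Type*} {r : V → V → Prop} {X R : Set V}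

theorem relConn_singleton (x : V) : RelConn r {x} := by
  rintro p ⟨a, rfl, ha⟩ ⟨b, rfl, hb⟩
  exact absurd ha hb

theorem RelConn.insert (hX : RelConn r X) (hr : ∀ a b, r a b → r b a) {a y : V} (ha : a ∈ X)
    (hay : r a y) : RelConn r (insert y X) := by
  intro p h1 h2
  by_cases h3 : ∃ a ∈ X, p a
  · by_cases h4 : ∃ b ∈ X, ¬ p b
    · obtain ⟨a, ha, b, hb, h⟩ := hX p h3 h4
      exact ⟨a, Or.inr ha, b, Or.inr hb, h⟩
    · push Not at h4
      obtain ⟨b, rfl | hb, hpb⟩ := h2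
      · exact ⟨a, Or.inr ha, b, Or.inl rfl, h4 a ha, hpb, hay⟩
      · exact absurd (h4 b hb) hpb
  · push Not at h3
    obtain ⟨b, rfl | hb, hpb⟩ := h1
    · exact ⟨b, Or.inl rfl, a, Or.inr ha, hpb, h3 a ha, hr _ _ hay⟩
    · exact absurd hpb (h3 b hb)

theorem exists_maximal_superset [Finite V] (p : Set V → Prop) {X₀ : Set V} (h : p X₀) :
    ∃ X, X₀ ⊆ X ∧ p X ∧ ∀ y ∉ X, ¬ p (insert y X) := by
  obtain ⟨X, hX, hmax⟩ := (Set.toFinite {X | X₀ ⊆ X ∧ p X}).exists_maximal ⟨X₀, subset_rfl, h⟩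
  refine ⟨X, hX.1, hX.2, fun y hy hp => hy ?_⟩
  exact hmax ⟨hX.1.trans (Set.subset_insert _ _), hp⟩ (Set.subset_insert _ _) (Set.mem_insert _ _)

theorem exists_component [Finite V] (hr : ∀ a b, r a b → r b a) {X₀ : Set V} (h0 : X₀ ⊆ R)
    (hc : RelConn r X₀) :
    ∃ K, X₀ ⊆ K ∧ K ⊆ R ∧ RelConn r K ∧ ∀ y ∈ R, y ∉ K → ∀ k ∈ K, ¬ r k y := by
  obtain ⟨K, h1, ⟨h2, h3⟩, h4⟩ :=
    exists_maximal_superset (fun X => X ⊆ R ∧ RelConn r X) ⟨h0, hc⟩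
  exact ⟨K, h1, h2, h3, fun y hy hyK k hk hky =>
    h4 y hyK ⟨Set.insert_subset hy h2, h3.insert hr hk hky⟩⟩

theorem RelConn.subset_of_closed {K L : Set V} (hK : RelConn r K)
    (hL : ∀ y ∈ K, y ∉ L → ∀ k ∈ L, ¬ r k y) {x : V} (hx : x ∈ K) (hxL : x ∈ L) : K ⊆ L := by
  by_contra h
  obtain ⟨y, hy, hyL⟩ := Set.not_subset.1 h
  obtain ⟨a, -, b, hb, haL, hbL, hab⟩ := hK (· ∈ L) ⟨x, hx, hxL⟩ ⟨y, hy, hyL⟩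
  exact hL b hb hbL a haL hab

/-- A `P4`-free graph with at least two vertices is disconnected or has disconnected complement. -/
theorem not_relConn_and_compl (G : SimpleGraph V) : ∀ (n : ℕ) (R : Finset V), R.card = n →
    2 ≤ n →
    (∀ a ∈ R, ∀ b ∈ R, ∀ c ∈ R, ∀ d ∈ R, G.Adj a b → G.Adj b c → G.Adj c d → ¬ G.Adj a c →
      ¬ G.Adj b d → ¬ G.Adj a d → False) →
    RelConn G.Adj (R : Set V) → RelConn Gᶜ.Adj (R : Set V) → False := by
  classical
  intro n
  induction n generalizing G with
  | zero => intro _ _ h; omega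
  | succ n ih =>
    intro R hR hn hP hc hcc
    obtain ⟨x, hx⟩ : R.Nonempty := Finset.card_pos.1 (by omega)
    have key : ∀ (H : SimpleGraph V),
        (∀ a ∈ R, ∀ b ∈ R, ∀ c ∈ R, ∀ d ∈ R, H.Adj a b → H.Adj b c → H.Adj c d → ¬ H.Adj a c →
          ¬ H.Adj b d → ¬ H.Adj a d → False) →
        RelConn H.Adj (R : Set V) → RelConn Hᶜ.Adj (R : Set V) →
        RelConn H.Adj ((R.erase x : Finset V) : Set V) := by
      intro H hP hc hcc p ⟨a, ha, hpa⟩ ⟨b, hb, hpb⟩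
      by_contra hno
      push Not at hno
      simp only [Finset.coe_erase, Set.mem_sdiff, Finset.mem_coe, Set.mem_singleton_iff]
        at ha hb hno
      have main : ∀ q : V → Prop, (∀ u ∈ R, u ≠ x → ∀ v ∈ R, v ≠ x → q u → ¬ q v → ¬ H.Adj u v) →
          (∃ u ∈ R, u ≠ x ∧ q u ∧ ¬ H.Adj x u) → (∃ v ∈ R, v ≠ x ∧ ¬ q v) → False := by
        rintro q hq ⟨u, huR, hux, hqu, hu⟩ ⟨v, hvR, hvx, hqv⟩
        obtain ⟨y, hy, a, ha, ⟨hyx, hqy, hxy⟩, h2, h3⟩ := hc (fun u => u ≠ x ∧ q u ∧ ¬ H.Adj x u)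
          ⟨u, huR, hux, hqu, hu⟩ ⟨v, hvR, fun h => hqv h.2.1⟩
        have hax : a ≠ x := by rintro rfl; exact hxy h3.symm
        have hqa : q a := by
          by_contra h; exact hq y hy hyx a ha hax hqy h h3
        have hxa : H.Adj x a := by
          by_contra h; exact h2 ⟨hax, hqa, h⟩
        obtain ⟨w, hw, b, hb, ⟨hwx, hqw⟩, h5, h6⟩ := hc (fun u => u ≠ x ∧ ¬ q u)
          ⟨v, hvR, hvx, hqv⟩ ⟨x, hx, fun h => h.1 rfl⟩
        have hbx : b = x := by
          by_contra h
          have : q b := by by_contra h'; exact h5 ⟨h, h'⟩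
          exact hq b hb h w hw hwx this hqw h6.symm
        have h7 : H.Adj w x := hbx ▸ h6
        exact hP w hw x hx a ha y hy h7 hxa h3.symm
          (fun h => hq a ha hax w hw hwx hqa hqw h.symm) hxy
          (fun h => hq y hy hyx w hw hwx hqy hqw h.symm)
      obtain ⟨x', hx', y, hy, hxx, hyx, hxy⟩ := hcc (fun u => u = x) ⟨x, hx, rfl⟩ ⟨a, ha.1, ha.2⟩
      subst hxx
      rw [SimpleGraph.compl_adj] at hxy
      by_cases hpy : p y
      · exact main p (fun u hu hux v hv hvx => hno u ⟨hu, hux⟩ v ⟨hv, hvx⟩)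
          ⟨y, hy, hyx, hpy, hxy.2⟩ ⟨b, hb.1, hb.2, hpb⟩
      · exact main (fun u => ¬ p u)
          (fun u hu hux v hv hvx h1 h2 h3 =>
            hno v ⟨hv, hvx⟩ u ⟨hu, hux⟩ (not_not.1 h2) h1 h3.symm)
          ⟨y, hy, hyx, hpy, hxy.2⟩ ⟨a, ha.1, ha.2, not_not.2 hpa⟩
    have hPc : ∀ a ∈ R, ∀ b ∈ R, ∀ c ∈ R, ∀ d ∈ R, Gᶜ.Adj a b → Gᶜ.Adj b c → Gᶜ.Adj c d →
        ¬ Gᶜ.Adj a c → ¬ Gᶜ.Adj b d → ¬ Gᶜ.Adj a d → False := by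
      intro a ha b hb c hc d hd h1 h2 h3 h4 h5 h6
      simp only [SimpleGraph.compl_adj, not_and, not_not] at *
      have hac : a ≠ c := by rintro rfl; exact h3.2 (h6 h3.1)
      have hbd : b ≠ d := by rintro rfl; exact h1.2 (h6 h1.1)
      have had : a ≠ d := by rintro rfl; exact h3.2 (h4 hac).symm
      exact hP b hb d hd a ha c hc (h5 hbd) (h6 had).symm (h4 hac) (fun h => h1.2 h.symm)
        (fun h => h3.2 h.symm) h2.2
    have h1 := key G hP hc hcc
    have h2 := key Gᶜ hPc hcc (by rwa [compl_compl])
    rcases Nat.lt_or_ge n 2 with h | h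
    · have h2 : R.card = 2 := by omega
      obtain ⟨a, b, hab, rfl⟩ := Finset.card_eq_two.1 h2
      obtain ⟨a', ha', b', hb', e1, e2, e3⟩ := hc (fun u => u = a) ⟨a, by simp, rfl⟩
        ⟨b, by simp, fun h => hab h.symm⟩
      obtain ⟨a'', ha'', b'', hb'', e4, e5, e6⟩ := hcc (fun u => u = a) ⟨a, by simp, rfl⟩
        ⟨b, by simp, fun h => hab h.symm⟩
      subst e1 e4
      simp only [Finset.coe_insert, Finset.coe_singleton, Set.mem_insert_iff,
        Set.mem_singleton_iff] at hb' hb''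
      obtain rfl := hb'.resolve_left e2
      obtain rfl := hb''.resolve_left e5
      exact e6.2 e3
    · exact ih G (R.erase x) (by rw [Finset.card_erase_of_mem hx]; omega) h
        (fun a ha b hb c hc d hd => hP a (Finset.mem_of_mem_erase ha) b (Finset.mem_of_mem_erase hb)
          c (Finset.mem_of_mem_erase hc) d (Finset.mem_of_mem_erase hd)) h1 h2

end Connectivity

section PerfectSets

variable {V : Type*} {G : SimpleGraph V} {A D I T X : Set V} {k n : ℕ}

/-- The subgraph induced on `T` has a proper colouring with `k` colours. -/
def ColorableOn (G : SimpleGraph V) (T : Set V) (k : ℕ) : Prop :=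
  ∃ f : V → ℕ, (∀ x ∈ T, f x < k) ∧ ∀ x ∈ T, ∀ y ∈ T, G.Adj x y → f x ≠ f y

/-- The subgraph induced on `T` can be coloured with as many colours as some clique in `T` has
vertices. -/
def CliqueColorable (G : SimpleGraph V) (T : Set V) : Prop :=
  ∃ K : Finset V, (K : Set V) ⊆ T ∧ G.IsClique K ∧ ColorableOn G T K.card

/-- The subgraph induced on `A` is perfect. -/
def PerfectOn (G : SimpleGraph V) (A : Set V) : Prop :=
  ∀ T ⊆ A, CliqueColorable G T

/-- The subgraph induced on `D` is minimally imperfect. -/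
def MinImperfect (G : SimpleGraph V) (D : Set V) : Prop :=
  ¬ CliqueColorable G D ∧ ∀ T ⊆ D, T ≠ D → CliqueColorable G T

/-- No vertex of `D` outside `X` is mixed on `X`. -/
def HomogeneousIn (G : SimpleGraph V) (X D : Set V) : Prop :=
  ∀ y ∈ D, y ∉ X → (∀ x ∈ X, G.Adj y x) ∨ ∀ x ∈ X, ¬ G.Adj y x

/-- No two vertices of `I` are adjacent. -/
def StableIn (G : SimpleGraph V) (I : Set V) : Prop :=
  ∀ x ∈ I, ∀ y ∈ I, ¬ G.Adj x y

theorem PerfectOn.mono (h : PerfectOn G A) (hT : T ⊆ A) : PerfectOn G T :=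
  fun S hS => h S (hS.trans hT)

theorem injOn_of_isClique {f : V → ℕ} (hf : ∀ x ∈ T, ∀ y ∈ T, G.Adj x y → f x ≠ f y)
    {L : Finset V} (hLT : (L : Set V) ⊆ T) (hL : G.IsClique L) : Set.InjOn f L := by
  intro x hx y hy hxy
  by_contra hne
  exact hf x (hLT hx) y (hLT hy) (hL hx hy hne) hxy

theorem ColorableOn.mono (h : ColorableOn G T k) (hA : A ⊆ T) (hk : k ≤ n) :
    ColorableOn G A n := by
  obtain ⟨f, hf, hp⟩ := h
  exact ⟨f, fun x hx => (hf x (hA hx)).trans_le hk, fun x hx y hy => hp x (hA hx) y (hA hy)⟩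

theorem ColorableOn.union_stable (h : ColorableOn G (T \ I) k) (hI : StableIn G I) :
    ColorableOn G T (k + 1) := by
  classical
  obtain ⟨f, hf, hp⟩ := h
  refine ⟨fun x => if x ∈ I then k else f x, fun x hx => ?_, fun x hx y hy hxy => ?_⟩
  · by_cases h : x ∈ I
    · simp [h]
    · simpa [h] using (hf x ⟨hx, h⟩).trans (Nat.lt_succ_self k)
  · by_cases h : x ∈ I <;> by_cases h' : y ∈ I
    · exact absurd hxy (hI x h y h')
    · simpa [h, h'] using (hf y ⟨hy, h'⟩).ne'
    · simpa [h, h'] using (hf x ⟨hx, h⟩).ne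
    · simpa [h, h'] using hp x ⟨hx, h⟩ y ⟨hy, h'⟩ hxy

theorem ColorableOn.of_stable (h : StableIn G T) : ColorableOn G T 1 :=
  ⟨fun _ => 0, fun _ _ => Nat.one_pos, fun x hx y hy hxy => absurd hxy (h x hx y hy)⟩

theorem exists_color_eq {f : V → ℕ} (hf : ∀ x ∈ T, f x < k)
    (hp : ∀ x ∈ T, ∀ y ∈ T, G.Adj x y → f x ≠ f y) {L : Finset V} (hLT : (L : Set V) ⊆ T)
    (hL : G.IsClique L) (hk : k ≤ L.card) {i : ℕ} (hi : i < k) : ∃ x ∈ L, f x = i := by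
  classical
  have h1 : L.image f = Finset.range k := by
    apply Finset.eq_of_subset_of_card_le
    · intro j hj
      obtain ⟨x, hx, rfl⟩ := Finset.mem_image.1 hj
      simpa using hf x (hLT hx)
    · rw [Finset.card_image_of_injOn (injOn_of_isClique hp hLT hL)]
      simpa using hk
  have h2 : i ∈ L.image f := by rw [h1]; simpa using hi
  simpa using h2

theorem CliqueColorable.of_map {W : Type*} {H : SimpleGraph W} {σ : V → W}
    (hadj : ∀ x ∈ D, ∀ y ∈ D, (H.Adj (σ x) (σ y) ↔ G.Adj x y))
    (h : CliqueColorable H (σ '' D)) : CliqueColorable G D := by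
  classical
  obtain ⟨K, hK, hcl, f, hf, hp⟩ := h
  rcases isEmpty_or_nonempty V with hV | hV
  · exact ⟨∅, by simp, by simp, fun _ => 0, fun x => hV.elim x, fun x => hV.elim x⟩
  choose! τ hτ hτσ using fun y (hy : y ∈ K) => hK hy
  have hinj : Set.InjOn τ K := fun x hx y hy hxy => by
    rw [← hτσ x hx, ← hτσ y hy, hxy]
  refine ⟨K.image τ, ?_, ?_, f ∘ σ, ?_, ?_⟩
  · intro x hx
    obtain ⟨y, hy, rfl⟩ := Finset.mem_image.1 (Finset.mem_coe.1 hx)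
    exact hτ y hy
  · intro a ha b hb hxy
    obtain ⟨x, hx, rfl⟩ := Finset.mem_image.1 (Finset.mem_coe.1 ha)
    obtain ⟨y, hy, rfl⟩ := Finset.mem_image.1 (Finset.mem_coe.1 hb)
    rw [← hadj _ (hτ x hx) _ (hτ y hy), hτσ x hx, hτσ y hy]
    exact hcl hx hy fun h => hxy (by rw [h])
  · intro x hx
    rw [Finset.card_image_of_injOn hinj]
    exact hf _ ⟨x, hx, rfl⟩
  · intro x hx y hy hxy
    exact hp _ ⟨x, hx, rfl⟩ _ ⟨y, hy, rfl⟩ ((hadj x hx y hy).2 hxy)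

theorem exists_minImperfect [Finite V] (h : ¬ PerfectOn G A) : ∃ D ⊆ A, MinImperfect G D := by
  unfold PerfectOn at h
  push Not at h
  obtain ⟨T, hT, hTc⟩ := h
  obtain ⟨D, hD, hmin⟩ :=
    (Set.toFinite {D : Set V | D ⊆ A ∧ ¬ CliqueColorable G D}).exists_minimal ⟨T, hT, hTc⟩
  refine ⟨D, hD.1, hD.2, fun S hS hne => ?_⟩
  by_contra hSc
  exact hne (hS.antisymm (hmin ⟨hS.trans hD.1, hSc⟩ hS))

theorem perfectOn_of_forall_minImperfect [Finite V] (h : ∀ D ⊆ A, ¬ MinImperfect G D) :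
    PerfectOn G A := by
  by_contra hA
  obtain ⟨D, hD, hm⟩ := exists_minImperfect hA
  exact h D hD hm

theorem MinImperfect.not_subset (hD : MinImperfect G D) (hA : PerfectOn G A) : ¬ D ⊆ A :=
  fun h => hD.1 (hA D h)

theorem MinImperfect.colorableOn (hD : MinImperfect G D) (hT : T ⊆ D) (hne : T ≠ D) :
    ∃ K : Finset V, (K : Set V) ⊆ D ∧ G.IsClique K ∧ ColorableOn G T K.card := by
  obtain ⟨K, hK, h⟩ := hD.2 T hT hne
  exact ⟨K, hK.trans hT, h⟩

/-- No stable set meets all maximum cliques of a minimally imperfect graph. -/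
theorem MinImperfect.exists_clique (hD : MinImperfect G D) (hID : (D ∩ I).Nonempty)
    (hI : StableIn G I) : ∃ K : Finset V, (K : Set V) ⊆ D \ I ∧ G.IsClique K ∧
      ∀ L : Finset V, (L : Set V) ⊆ D → G.IsClique L → L.card ≤ K.card := by
  obtain ⟨x, hxD, hxI⟩ := hID
  obtain ⟨K, hK, hcl, hcol⟩ := hD.2 (D \ I) Set.sdiff_subset
    (fun h => (h.ge hxD).2 hxI)
  refine ⟨K, hK, hcl, fun L hL hLc => ?_⟩
  by_contra hlt
  exact hD.1 ⟨L, hL, hLc, (hcol.union_stable hI).mono subset_rfl (by omega)⟩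

theorem MinImperfect.not_dominated (hD : MinImperfect G D) {x y : V} (hx : x ∈ D) (hy : y ∈ D)
    (hxy : x ≠ y) (hN : ∀ z ∈ D, G.Adj x z → G.Adj y z) : False := by
  classical
  obtain ⟨K, hK, hcl, f, hf, hp⟩ := hD.colorableOn (T := D \ {x}) Set.sdiff_subset
    (fun h => (h.ge hx).2 rfl)
  have hy' : y ∈ D \ {x} := ⟨hy, fun h => hxy h.symm⟩
  have key : ∀ z ∈ D, z ≠ x → G.Adj x z → f y ≠ f z := fun z hz hzx h =>
    hp y hy' z ⟨hz, hzx⟩ (hN z hz h)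
  refine hD.1 ⟨K, hK, hcl, Function.update f x (f y), fun z hz => ?_, fun a ha b hb hab => ?_⟩
  · by_cases h : z = x
    · subst h; simpa using hf y hy'
    · simpa [h] using hf z ⟨hz, h⟩
  · by_cases h : a = x <;> by_cases h' : b = x
    · subst h; subst h'; exact absurd hab (G.loopless.irrefl _)
    · subst h; simpa [h'] using key b hb h' hab
    · subst h'; simpa [h] using (key a ha h hab.symm).symm
    · simpa [h, h'] using hp a ⟨ha, h⟩ b ⟨hb, h'⟩ hab

theorem MinImperfect.relConn (hD : MinImperfect G D) : RelConn G.Adj D := by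
  classical
  rintro p ⟨a, ha, hpa⟩ ⟨b, hb, hpb⟩
  by_contra hno
  push Not at hno
  obtain ⟨K, hK, hKc, f, hf, hfp⟩ := hD.colorableOn (T := {x ∈ D | p x}) (Set.sep_subset _ _)
    (fun h => hpb (h.ge hb).2)
  obtain ⟨L, hL, hLc, g, hg, hgp⟩ := hD.colorableOn (T := {x ∈ D | ¬ p x}) (Set.sep_subset _ _)
    (fun h => (h.ge ha).2 hpa)
  have hcol : ColorableOn G D (max K.card L.card) := by
    refine ⟨fun x => if p x then f x else g x, fun x hx => ?_, fun x hx y hy hxy => ?_⟩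
    · by_cases h : p x
      · simpa [h] using Or.inl (hf x ⟨hx, h⟩)
      · simpa [h] using Or.inr (hg x ⟨hx, h⟩)
    · by_cases h : p x <;> by_cases h' : p y
      · simpa [h, h'] using hfp x ⟨hx, h⟩ y ⟨hy, h'⟩ hxy
      · exact absurd hxy (hno x hx y hy h h')
      · exact absurd hxy.symm (hno y hy x hx h' h)
      · simpa [h, h'] using hgp x ⟨hx, h⟩ y ⟨hy, h'⟩ hxy
  rcases le_total K.card L.card with h | h
  · exact hD.1 ⟨L, hL, hLc, by rwa [max_eq_right h] at hcol⟩
  · exact hD.1 ⟨K, hK, hKc, by rwa [max_eq_left h] at hcol⟩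

theorem MinImperfect.not_homogeneous (hD : MinImperfect G D) (hX : X ⊆ D)
    (hh : HomogeneousIn G X D) {a b : V} (ha : a ∈ X) (hb : b ∈ X) (hab : a ≠ b)
    (hDX : ¬ D ⊆ X) : False := by
  classical
  by_cases hcl : G.IsClique X
  · obtain ⟨L, hL, hLc, f, hf, hp⟩ := hD.2 (D \ {a}) Set.sdiff_subset
      (fun h => (h.ge (hX ha)).2 rfl)
    have haI : StableIn G {a} := by
      rintro x rfl y rfl; exact G.loopless.irrefl _
    have hmax : ∀ M : Finset V, (M : Set V) ⊆ D → G.IsClique M → M.card ≤ L.card := by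
      intro M hM hMc
      by_contra hlt
      exact hD.1 ⟨M, hM, hMc, (ColorableOn.union_stable ⟨f, hf, hp⟩ haI).mono subset_rfl
        (by omega)⟩
    have hadj : ∀ z ∈ D, G.Adj z b → z ≠ a → G.Adj z a := by
      intro z hz hzb hza
      by_cases hzX : z ∈ X
      · exact hcl hzX ha hza
      · rcases hh z hz hzX with h | h
        · exact h a ha
        · exact absurd hzb (h b hb)
    have hadj' : ∀ z ∈ D, G.Adj z a → z ≠ b → G.Adj z b := by
      intro z hz hza hzb
      by_cases hzX : z ∈ X
      · exact hcl hzX hb hzb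
      · rcases hh z hz hzX with h | h
        · exact h b hb
        · exact absurd hza (h a ha)
    have hb' : b ∈ D \ {a} := ⟨hX hb, fun h => hab h.symm⟩
    set J : Set V := insert a {z | z ∈ D ∧ z ≠ a ∧ z ≠ b ∧ f z = f b} with hJ
    have hJs : StableIn G J := by
      have h1 : ∀ z, z ∈ D ∧ z ≠ a ∧ z ≠ b ∧ f z = f b → ¬ G.Adj z a := by
        rintro z ⟨h1, h2, h3, h4⟩ h5
        exact hp z ⟨h1, h2⟩ b hb' (hadj' z h1 h5 h3) h4
      rintro x (rfl | hx) y (rfl | hy) hxy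
      · exact G.loopless.irrefl _ hxy
      · exact h1 y hy hxy.symm
      · exact h1 x hx hxy
      · exact hp x ⟨hx.1, hx.2.1⟩ y ⟨hy.1, hy.2.1⟩ hxy (hx.2.2.2.trans hy.2.2.2.symm)
    obtain ⟨K, hK, hKc, hKmax⟩ := hD.exists_clique ⟨a, hX ha, Or.inl rfl⟩ hJs
    have hKa : a ∉ K := fun h => (hK h).2 (Or.inl rfl)
    have hKD : (K : Set V) ⊆ D \ {a} := fun z hz => ⟨(hK hz).1, fun h => hKa (h ▸ hz)⟩
    obtain ⟨z, hz, hzb⟩ := exists_color_eq hf hp hKD hKc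
      (hKmax L (hL.trans Set.sdiff_subset) hLc) (hf b hb')
    have hzb' : z = b := by
      by_contra h
      exact (hK hz).2 (Or.inr ⟨(hK hz).1, (hKD hz).2, h, hzb⟩)
    subst hzb'
    have hins : G.IsClique ((insert a K : Finset V) : Set V) := by
      rw [Finset.coe_insert, isClique_insert]
      refine ⟨hKc, fun w hw haw => ?_⟩
      by_cases hwb : w = z
      · exact hwb ▸ hcl ha hb hab
      · exact (hadj w (hK hw).1 (hKc hw hz hwb) haw.symm).symm
    have := hKmax (insert a K) (by
      rw [Finset.coe_insert]; exact Set.insert_subset (hX ha) (hK.trans Set.sdiff_subset)) hins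
    rw [Finset.card_insert_of_notMem hKa] at this
    omega
  · obtain ⟨u, hu, w, hw, huw, huw'⟩ : ∃ u ∈ X, ∃ w ∈ X, u ≠ w ∧ ¬ G.Adj u w := by
      unfold IsClique Set.Pairwise at hcl
      push Not at hcl
      exact hcl
    obtain ⟨K, hK, hKc, g, hg, hgp⟩ := hD.2 X hX (fun h => hDX h.symm.subset)
    obtain ⟨L, hL, hLc, f, hf, hp⟩ := hD.colorableOn (T := (D \ X) ∪ K)
      (Set.union_subset Set.sdiff_subset (hK.trans hX)) (by
        intro h
        have h1 : ∀ z ∈ X, z ∈ K := fun z hz => by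
          have : z ∈ (D \ X) ∪ (K : Set V) := h.ge (hX hz)
          exact this.resolve_left fun h => h.2 hz
        exact huw' (hKc (h1 u hu) (h1 w hw) huw))
    have hex : ∀ x ∈ X, ∃ z ∈ K, g z = g x := fun x hx =>
      exists_color_eq hg hgp hK hKc le_rfl (hg x hx)
    choose! σ hσ hσg using hex
    refine hD.1 ⟨L, hL, hLc, fun x => if x ∈ X then f (σ x) else f x, fun x hx => ?_,
      fun x hx y hy hxy => ?_⟩
    · by_cases h : x ∈ X
      · simpa [h] using hf _ (Or.inr (hσ x h))
      · simpa [h] using hf _ (Or.inl ⟨hx, h⟩)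
    · have key : ∀ x ∈ X, ∀ y ∈ D, y ∉ X → G.Adj x y → f (σ x) ≠ f y := by
        intro x hx y hy hyX hxy
        refine hp _ (Or.inr (hσ x hx)) y (Or.inl ⟨hy, hyX⟩) ?_
        rcases hh y hy hyX with h | h
        · exact (h _ (hK (hσ x hx))).symm
        · exact absurd hxy.symm (h x hx)
      by_cases h : x ∈ X <;> by_cases h' : y ∈ X
      · have h1 : σ x ≠ σ y := fun e => hgp x h y h' hxy (by rw [← hσg x h, ← hσg y h', e])
        simpa [h, h'] using hp _ (Or.inr (hσ x h)) _ (Or.inr (hσ y h'))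
          (hKc (hσ x h) (hσ y h') h1)
      · simpa [h, h'] using key x h y hy h' hxy
      · simpa [h, h'] using (key y h' x hx h hxy.symm).symm
      · simpa [h, h'] using hp x (Or.inl ⟨hx, h⟩) y (Or.inl ⟨hy, h'⟩) hxy

theorem cliqueColorable_singleton (x : V) : CliqueColorable G {x} := by
  refine ⟨{x}, by simp, by simp, fun _ => 0, fun _ _ => by simp, ?_⟩
  rintro a rfl b rfl h
  exact absurd h (G.loopless.irrefl _)

theorem perfectOn_insert_of_anticomplete [Finite V] {v : V} (hA : PerfectOn G A)
    (hv : ∀ a ∈ A, ¬ G.Adj v a) : PerfectOn G (insert v A) := by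
  refine perfectOn_of_forall_minImperfect fun D hD hm => ?_
  by_cases hvD : v ∈ D
  · by_cases h : ∃ y ∈ D, v ≠ y
    · obtain ⟨y, hy, hvy⟩ := h
      refine hm.not_dominated hvD hy hvy fun z hz hvz => ?_
      rcases hD hz with rfl | h
      · exact absurd hvz (G.loopless.irrefl _)
      · exact absurd hvz (hv z h)
    · push Not at h
      have : D = {v} := Set.eq_singleton_iff_unique_mem.2 ⟨hvD, fun y hy => (h y hy).symm⟩
      exact hm.1 (this ▸ cliqueColorable_singleton v)
  · exact hm.not_subset hA fun z hz => (hD hz).resolve_left fun h => hvD (h ▸ hz)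

theorem ColorableOn.perfectOn_two (h : ColorableOn G A 2) : PerfectOn G A := by
  intro T hT
  by_cases he : ∃ x ∈ T, ∃ y ∈ T, G.Adj x y
  · classical
    obtain ⟨x, hx, y, hy, hxy⟩ := he
    refine ⟨{x, y}, ?_, ?_, h.mono hT (by rw [Finset.card_pair hxy.ne])⟩
    · intro z hz
      simp only [Finset.coe_insert, Finset.coe_singleton, Set.mem_insert_iff,
        Set.mem_singleton_iff] at hz
      rcases hz with rfl | rfl <;> assumption
    · simpa [isClique_insert] using fun _ => hxy
  · push Not at he
    by_cases hne : T.Nonempty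
    · obtain ⟨x, hx⟩ := hne
      exact ⟨{x}, by simpa using hx, by simp, fun _ => 0, fun _ _ => by simp,
        fun a ha b hb hab => absurd hab (he a ha b hb)⟩
    · rw [Set.not_nonempty_iff_eq_empty] at hne
      subst hne
      exact ⟨∅, by simp, by simp, fun _ => 0, by simp, by simp⟩

/-- Substituting a perfect graph for a vertex of a perfect graph gives a perfect graph. -/
theorem PerfectOn.substitute [Finite V] {A' A₁ : Set V} {x₀ : V} (hA' : PerfectOn G A')
    (h₁ : PerfectOn G A₁) (hx₀ : x₀ ∈ A') (hx₁ : x₀ ∈ X) (hA₁ : A₁ ⊆ X)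
    (hX : HomogeneousIn G X A') (hAX : ∀ z ∈ A', z ∈ X → z = x₀) :
    PerfectOn G ((A' \ {x₀}) ∪ A₁) := by
  classical
  refine perfectOn_of_forall_minImperfect fun D hD hm => ?_
  have hout : ∀ z ∈ D, z ∉ A₁ → z ∈ A' ∧ z ∉ X := fun z hz hzA => by
    rcases hD hz with h | h
    · exact ⟨h.1, fun hzX => h.2 (hAX z h.1 hzX)⟩
    · exact absurd h hzA
  by_cases h2 : ∃ a ∈ D ∩ A₁, ∃ b ∈ D ∩ A₁, a ≠ b
  · obtain ⟨a, ha, b, hb, hab⟩ := h2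
    refine hm.not_homogeneous (X := D ∩ A₁) Set.inter_subset_left (fun y hy hyX => ?_) ha hb hab
      fun h => hm.not_subset h₁ fun z hz => (h hz).2
    obtain ⟨h3, h4⟩ := hout y hy fun h => hyX ⟨hy, h⟩
    exact (hX y h3 h4).imp (fun h x hx => h x (hA₁ hx.2)) fun h x hx => h x (hA₁ hx.2)
  · push Not at h2
    by_cases h3 : ∃ a, a ∈ D ∩ A₁
    · obtain ⟨a, ha⟩ := h3
      refine hm.1 (CliqueColorable.of_map (H := G) (σ := Function.update id a x₀) ?_
        (hA' _ ?_))
      · have key : ∀ y ∈ D, y ≠ a → (G.Adj x₀ y ↔ G.Adj a y) := by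
          intro y hy hya
          obtain ⟨h3, h4⟩ := hout y hy fun h => hya (h2 y ⟨hy, h⟩ a ha)
          rcases hX y h3 h4 with h | h
          · exact iff_of_true (h x₀ hx₁).symm (h a (hA₁ ha.2)).symm
          · exact iff_of_false (fun e => h x₀ hx₁ e.symm) (fun e => h a (hA₁ ha.2) e.symm)
        intro x hx y hy
        by_cases e : x = a <;> by_cases e' : y = a
        · subst e; subst e'; simp
        · subst e; simpa [e'] using key y hy e'
        · subst e'
          simp only [Function.update_self, Function.update_of_ne e, id]
          rw [G.adj_comm, key x hx e, G.adj_comm]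
        · simp [e, e']
      · rintro _ ⟨z, hz, rfl⟩
        by_cases e : z = a
        · subst e; simpa using hx₀
        · simpa [e] using (hout z hz fun h => e (h2 z ⟨hz, h⟩ a ha)).1
    · exact hm.not_subset hA' fun z hz => (hout z hz fun h => h3 ⟨z, hz, h⟩).1

end PerfectSets

section WeightedDivisibility

variable {V : Type*} {G : SimpleGraph V} {S X : Set V}

theorem PerfectOn.isPerfect [Finite V] {A : Set V} (h : PerfectOn G A) :
    (G.induce A).IsPerfect := by
  classical
  intro S
  set H := (G.induce A).induce S with hH
  obtain ⟨K, hK, hKc, f, hf, hp⟩ := h ((fun x : S => ((x : A) : V)) '' Set.univ) (by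
    rintro _ ⟨x, -, rfl⟩; exact x.1.2)
  choose τ _ hτ using fun y : K => hK y.2
  have hinj : Function.Injective τ := fun x y hxy => by
    apply Subtype.ext; rw [← hτ x, ← hτ y, hxy]
  have hclq : H.IsClique ((K.attach.image τ : Finset S) : Set S) := by
    intro a ha b hb hab
    obtain ⟨x, -, rfl⟩ := Finset.mem_image.1 (Finset.mem_coe.1 ha)
    obtain ⟨y, -, rfl⟩ := Finset.mem_image.1 (Finset.mem_coe.1 hb)
    change G.Adj ((τ x : A) : V) ((τ y : A) : V)
    have h1 := hτ x
    have h2 := hτ y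
    simp only at h1 h2
    rw [h1, h2]
    exact hKc x.2 y.2 fun e => hab (by rw [Subtype.ext e])
  have hcard : (K.attach.image τ).card = K.card := by
    rw [Finset.card_image_of_injective _ hinj, Finset.card_attach]
  have h1 : K.card ≤ H.cliqueNum := hcard ▸ hclq.card_le_cliqueNum
  have h2 : H.chromaticNumber ≤ (K.card : ℕ∞) := by
    refine Colorable.chromaticNumber_le ?_
    refine ⟨Coloring.mk (fun x => ⟨f ((x : A) : V), hf _ ⟨x, trivial, rfl⟩⟩) ?_⟩
    intro x y hxy e
    exact hp _ ⟨x, trivial, rfl⟩ _ ⟨y, trivial, rfl⟩ hxy (Fin.mk.inj e)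
  refine le_antisymm (h2.trans (by exact_mod_cast h1)) ?_
  exact cliqueNum_le_chromaticNumber

/-- Weighted perfect divisibility of the subgraph induced on `S`. -/
def WeightedDivisible (G : SimpleGraph V) (S : Set V) : Prop :=
  ∀ w : V → ℕ, (∀ x, 0 < w x) → ∃ A ⊆ S, PerfectOn G A ∧
    ∀ K : Finset V, (K : Set V) ⊆ S \ A → G.IsClique K →
      ∃ M : Finset V, (M : Set V) ⊆ S ∧ G.IsClique M ∧ ∑ x ∈ K, w x < ∑ x ∈ M, w x

theorem perfectlyDivisible_of_weightedDivisible [Finite V]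
    (h : ∀ S : Set V, S.Nonempty → WeightedDivisible G S) : G.PerfectlyDivisible := by
  classical
  intro S hS
  obtain ⟨A, hAS, hA, hM⟩ := h S hS (fun _ => 1) (fun _ => Nat.one_pos)
  refine ⟨A, S \ A, Set.union_sdiff_cancel hAS, Set.inter_sdiff_self _ _, hA.isPerfect, ?_⟩
  obtain ⟨K, hK⟩ := (G.induce (S \ A)).exists_isNClique_cliqueNum
  obtain ⟨M, hMS, hMc, hlt⟩ := hM (K.map ⟨Subtype.val, Subtype.val_injective⟩)
    (by intro x hx; obtain ⟨y, -, rfl⟩ := Finset.mem_map.1 (Finset.mem_coe.1 hx); exact y.2)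
    (by
      intro a ha b hb hxy
      obtain ⟨x, hx, rfl⟩ := Finset.mem_map.1 (Finset.mem_coe.1 ha)
      obtain ⟨y, hy, rfl⟩ := Finset.mem_map.1 (Finset.mem_coe.1 hb)
      exact hK.isClique hx hy fun e => hxy (by rw [e]))
  have hM' : (G.induce S).IsClique ((M.subtype (· ∈ S) : Finset S) : Set S) := by
    intro x hx y hy hxy
    exact hMc (Finset.mem_subtype.1 hx) (Finset.mem_subtype.1 hy) fun e => hxy (Subtype.ext e)
  have h1 := hM'.card_le_cliqueNum
  have h2 : (M.subtype (· ∈ S)).card = M.card := by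
    rw [Finset.card_subtype, Finset.filter_true_of_mem fun x hx => hMS hx]
  simp only [Finset.sum_const, smul_eq_mul, mul_one, Finset.card_map, hK.card_eq] at hlt
  omega

theorem WeightedDivisible.of_homogeneous [Finite V] (hXS : X ⊆ S) (hX : HomogeneousIn G X S)
    (hXd : WeightedDivisible G X) (hne : X.Nonempty)
    (hS : ∀ x₀ ∈ X, WeightedDivisible G (insert x₀ (S \ X))) : WeightedDivisible G S := by
  classical
  intro w hw
  obtain ⟨A₁, hA₁, hP₁, hM₁⟩ := hXd w hw
  obtain ⟨Q, ⟨hQX, hQ⟩, hQmax⟩ := Set.exists_max_image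
    {Q : Finset V | (Q : Set V) ⊆ X ∧ G.IsClique Q} (fun Q => ∑ x ∈ Q, w x) (Set.toFinite _)
    ⟨∅, by simp, by simp⟩
  replace hQmax : ∀ M : Finset V, (M : Set V) ⊆ X → G.IsClique M →
      ∑ x ∈ M, w x ≤ ∑ x ∈ Q, w x := fun M h1 h2 => hQmax M ⟨h1, h2⟩
  obtain ⟨x₁, hx₁⟩ := hne
  have hQpos : 0 < ∑ x ∈ Q, w x := by
    have := hQmax {x₁} (by simpa using hx₁) (by simp)
    simp only [Finset.sum_singleton] at this
    exact (hw x₁).trans_le this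
  have hA₁ne : A₁.Nonempty := by
    by_contra h
    rw [Set.not_nonempty_iff_eq_empty] at h
    subst h
    obtain ⟨M, h1, h2, h3⟩ := hM₁ Q (by simpa using hQX) hQ
    have := hQmax M h1 h2
    omega
  obtain ⟨x₀, hx₀⟩ := hA₁ne
  have hx₀X := hA₁ hx₀
  set w' := Function.update w x₀ (∑ x ∈ Q, w x) with hw'
  have hsum : ∀ K : Finset V, x₀ ∉ K → ∑ x ∈ K, w' x = ∑ x ∈ K, w x := fun K hK =>
    Finset.sum_congr rfl fun x hx => by
      rw [hw', Function.update_of_ne]; rintro rfl; exact hK hx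
  have hsum' : ∀ K : Finset V, x₀ ∉ K →
      ∑ x ∈ insert x₀ K, w' x = ∑ x ∈ Q, w x + ∑ x ∈ K, w x := fun K hK => by
    rw [Finset.sum_insert hK, hsum K hK, hw', Function.update_self]
  obtain ⟨A', hA', hP', hM'⟩ := hS x₀ hx₀X w' (fun x => by
    by_cases h : x = x₀
    · subst h; simpa [hw'] using hQpos
    · simpa [hw', h] using hw x)
  have hA'X : ∀ z ∈ A', z ∈ X → z = x₀ := fun z hz hzX =>
    (hA' hz).resolve_right fun h => h.2 hzX
  -- cliques of the contracted graph expand to cliques of `S` of the same weight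
  have expand : ∀ M : Finset V, (M : Set V) ⊆ insert x₀ (S \ X) → G.IsClique M →
      ∃ M' : Finset V, (M' : Set V) ⊆ S ∧ G.IsClique M' ∧ ∑ x ∈ M, w' x = ∑ x ∈ M', w x := by
    intro M hM hMc
    by_cases hx : x₀ ∈ M
    · have hMe : ∀ z ∈ M.erase x₀, z ∈ S ∧ z ∉ X := fun z hz =>
        (hM (Finset.mem_of_mem_erase hz)).resolve_left (Finset.ne_of_mem_erase hz)
      refine ⟨Q ∪ M.erase x₀, ?_, ?_, ?_⟩
      · rw [Finset.coe_union]
        exact Set.union_subset (hQX.trans hXS) fun z hz => (hMe z hz).1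
      · have key : ∀ a ∈ Q, ∀ b ∈ M.erase x₀, G.Adj b a := fun a ha b hb => by
          rcases hX b (hMe b hb).1 (hMe b hb).2 with h | h
          · exact h a (hQX ha)
          · exact absurd (hMc (Finset.mem_of_mem_erase hb) hx (Finset.ne_of_mem_erase hb))
              (h x₀ hx₀X)
        intro a ha b hb hab
        rcases Finset.mem_union.1 (Finset.mem_coe.1 ha) with ha | ha <;>
          rcases Finset.mem_union.1 (Finset.mem_coe.1 hb) with hb | hb
        · exact hQ ha hb hab
        · exact (key a ha b hb).symm
        · exact key b hb a ha
        · exact hMc (Finset.mem_of_mem_erase ha) (Finset.mem_of_mem_erase hb) hab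
      · rw [Finset.sum_union, ← hsum' _ (Finset.notMem_erase x₀ M), Finset.insert_erase hx]
        exact Finset.disjoint_left.2 fun z hz hz' => (hMe z hz').2 (hQX hz)
    · refine ⟨M, fun z hz => ?_, hMc, hsum M hx⟩
      exact ((hM hz).resolve_left fun h => hx (h ▸ hz)).1
  have clique_insert : ∀ K L : Finset V, (K : Set V) ⊆ S → L ⊆ K → G.IsClique K →
      (∀ z ∈ L, z ∉ X) → (∃ a ∈ K, a ∈ X) →
      G.IsClique ((insert x₀ L : Finset V) : Set V) := by
    rintro K L hK hL hKc hLX ⟨a, haK, haX⟩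
    rw [Finset.coe_insert, isClique_insert]
    refine ⟨hKc.subset (by exact_mod_cast hL), fun b hb hne => ?_⟩
    rcases hX b (hK (hL hb)) (hLX b hb) with h | h
    · exact (h x₀ hx₀X).symm
    · exact absurd (hKc (hL hb) haK fun e => hLX b hb (e ▸ haX)) (h a haX)
  have hsplit : ∀ K : Finset V, ∑ x ∈ K, w x =
      ∑ x ∈ K with x ∈ X, w x + ∑ x ∈ K with x ∉ X, w x := fun K =>
    (Finset.sum_filter_add_sum_filter_not K _ _).symm
  have hcliqueX : ∀ K : Finset V, G.IsClique K →
      G.IsClique ((K.filter (· ∈ X) : Finset V) : Set V) := fun K hK =>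
    hK.subset (by exact_mod_cast Finset.filter_subset _ _)
  by_cases hxA : x₀ ∈ A'
  · refine ⟨(A' \ {x₀}) ∪ A₁, Set.union_subset ?_ (hA₁.trans hXS),
      hP'.substitute hP₁ hxA hx₀X hA₁ (fun y hy hyX => ?_) hA'X, fun K hK hKc => ?_⟩
    · exact fun z hz => ((hA' hz.1).resolve_left hz.2).1
    · exact hX y ((hA' hy).resolve_left fun h => hyX (h ▸ hx₀X)).1 hyX
    · have hKS : (K : Set V) ⊆ S := hK.trans Set.sdiff_subset
      have hL : ∀ z ∈ K.filter (· ∉ X), z ∈ S ∧ z ∉ X ∧ z ∉ A' := fun z hz => by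
        obtain ⟨hzK, hzX⟩ := Finset.mem_filter.1 hz
        exact ⟨hKS hzK, hzX, fun h => (hK hzK).2 (Or.inl ⟨h, fun e => hzX (e ▸ hx₀X)⟩)⟩
      by_cases he : ∃ a ∈ K, a ∈ X
      · have hx0L : x₀ ∉ K.filter (· ∉ X) := fun h => (hL _ h).2.1 hx₀X
        obtain ⟨M₁, hM₁X, hM₁c, hM₁lt⟩ := hM₁ (K.filter (· ∈ X)) (fun z hz => by
          obtain ⟨hzK, hzX⟩ := Finset.mem_filter.1 hz
          exact ⟨hzX, fun h => (hK hzK).2 (Or.inr h)⟩) (hcliqueX K hKc)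
        obtain ⟨M', h1, h2, h3⟩ := expand (insert x₀ (K.filter (· ∉ X)))
          (by
            rw [Finset.coe_insert]
            exact Set.insert_subset_insert fun z hz => ⟨(hL z hz).1, (hL z hz).2.1⟩)
          (clique_insert K _ hKS (Finset.filter_subset _ _) hKc (fun z hz => (hL z hz).2.1) he)
        rw [hsum' _ hx0L] at h3
        refine ⟨M', h1, h2, ?_⟩
        have := hQmax M₁ hM₁X hM₁c
        rw [hsplit K, ← h3]
        omega
      · push Not at he
        have hx0K : x₀ ∉ K := fun h => he _ h hx₀X
        obtain ⟨M, h1, h2, h3⟩ := hM' K (fun z hz => ⟨Or.inr ⟨hKS hz, he z hz⟩, fun h =>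
          (hK hz).2 (Or.inl ⟨h, fun e => he z hz (e ▸ hx₀X)⟩)⟩) hKc
        obtain ⟨M', h4, h5, h6⟩ := expand M h1 h2
        exact ⟨M', h4, h5, by rw [← h6, ← hsum K hx0K]; exact h3⟩
  · refine ⟨A', fun z hz => ((hA' hz).resolve_left fun h => hxA (h ▸ hz)).1, hP',
      fun K hK hKc => ?_⟩
    have hKS : (K : Set V) ⊆ S := hK.trans Set.sdiff_subset
    have hL : ∀ z ∈ K.filter (· ∉ X), z ∈ S ∧ z ∉ X ∧ z ∉ A' := fun z hz => by
      obtain ⟨hzK, hzX⟩ := Finset.mem_filter.1 hz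
      exact ⟨hKS hzK, hzX, (hK hzK).2⟩
    by_cases he : ∃ a ∈ K, a ∈ X
    · have hx0L : x₀ ∉ K.filter (· ∉ X) := fun h => (hL _ h).2.1 hx₀X
      obtain ⟨M, h1, h2, h3⟩ := hM' (insert x₀ (K.filter (· ∉ X))) (by
          rw [Finset.coe_insert]
          exact Set.insert_subset ⟨Or.inl rfl, hxA⟩ fun z hz =>
            ⟨Or.inr ⟨(hL z hz).1, (hL z hz).2.1⟩, (hL z hz).2.2⟩)
        (clique_insert K _ hKS (Finset.filter_subset _ _) hKc (fun z hz => (hL z hz).2.1) he)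
      obtain ⟨M', h4, h5, h6⟩ := expand M h1 h2
      refine ⟨M', h4, h5, ?_⟩
      rw [hsum' _ hx0L] at h3
      have := hQmax (K.filter (· ∈ X)) (fun z hz => (Finset.mem_filter.1 hz).2) (hcliqueX K hKc)
      rw [hsplit K, ← h6]
      omega
    · push Not at he
      have hx0K : x₀ ∉ K := fun h => he _ h hx₀X
      obtain ⟨M, h1, h2, h3⟩ := hM' K
        (fun z hz => ⟨Or.inr ⟨hKS hz, he z hz⟩, (hK hz).2⟩) hKc
      obtain ⟨M', h4, h5, h6⟩ := expand M h1 h2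
      exact ⟨M', h4, h5, by rw [← h6, ← hsum K hx0K]; exact h3⟩

theorem WeightedDivisible.of_perfectOn_nonneighbors [Finite V] {v : V} (hv : v ∈ S)
    (h : PerfectOn G {x ∈ S | x ≠ v ∧ ¬ G.Adj v x}) : WeightedDivisible G S := by
  classical
  intro w hw
  refine ⟨insert v {x ∈ S | x ≠ v ∧ ¬ G.Adj v x}, Set.insert_subset hv (Set.sep_subset _ _),
    perfectOn_insert_of_anticomplete h fun a ha => ha.2.2, fun K hK hKc => ?_⟩
  have hKv : ∀ z ∈ K, G.Adj v z := fun z hz => by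
    have h1 := (hK hz).2
    simp only [Set.mem_insert_iff, Set.mem_ofPred_eq, not_or, not_and, not_not] at h1
    exact h1.2 (hK hz).1 h1.1
  have hvK : v ∉ K := fun h => G.loopless.irrefl _ (hKv v h)
  refine ⟨insert v K, ?_, ?_, ?_⟩
  · rw [Finset.coe_insert]; exact Set.insert_subset hv (hK.trans Set.sdiff_subset)
  · rw [Finset.coe_insert, isClique_insert]; exact ⟨hKc, fun b hb _ => hKv b hb⟩
  · rw [Finset.sum_insert hvK]; have := hw v; omega

/-- A graph without isolated vertices that is covered by three stable sets is weighted
divisible. -/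
theorem WeightedDivisible.of_stable_cover [Finite V] (hne : S.Nonempty)
    (hnb : ∀ x ∈ S, ∃ y ∈ S, G.Adj x y) (C₀ C₁ C₂ : Set V) (h₀ : StableIn G C₀)
    (h₁ : StableIn G C₁) (h₂ : StableIn G C₂) (hcov : ∀ x ∈ S, x ∈ C₀ ∨ x ∈ C₁ ∨ x ∈ C₂) :
    WeightedDivisible G S := by
  classical
  intro w hw
  refine ⟨S ∩ (C₀ ∪ C₁), Set.inter_subset_left, ColorableOn.perfectOn_two
    (ColorableOn.union_stable (ColorableOn.of_stable fun x hx y hy => ?_) h₀),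
    fun K hK hKc => ?_⟩
  · exact h₁ x (hx.1.2.resolve_left hx.2) y (hy.1.2.resolve_left hy.2)
  · have hK2 : ∀ z ∈ K, z ∈ C₂ := fun z hz => by
      rcases hcov z (hK hz).1 with h | h | h
      · exact absurd ⟨(hK hz).1, Or.inl h⟩ (hK hz).2
      · exact absurd ⟨(hK hz).1, Or.inr h⟩ (hK hz).2
      · exact h
    by_cases hKe : K.Nonempty
    · obtain ⟨x, hx⟩ := hKe
      have hKx : K = {x} := Finset.eq_singleton_iff_unique_mem.2 ⟨hx, fun y hy => by
        by_contra hxy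
        exact h₂ y (hK2 y hy) x (hK2 x hx) (hKc hy hx hxy)⟩
      obtain ⟨y, hy, hxy⟩ := hnb x (hK hx).1
      refine ⟨{x, y}, ?_, ?_, ?_⟩
      · rw [Finset.coe_pair]
        exact Set.insert_subset (hK hx).1 (Set.singleton_subset_iff.2 hy)
      · simpa [isClique_insert] using fun _ => hxy
      · rw [hKx, Finset.sum_singleton, Finset.sum_pair hxy.ne]
        have := hw y
        omega
    · obtain ⟨x, hx⟩ := hne
      rw [Finset.not_nonempty_iff_eq_empty] at hKe
      exact ⟨{x}, by simpa using hx, by simp, by simpa [hKe] using hw x⟩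

end WeightedDivisibility

section InducedSubgraphs

variable {V : Type*} {G : SimpleGraph V}

theorem containsInduced_of_twinFree {α : Type*} {H : SimpleGraph α} (f : α → V)
    (hf : ∀ a b, G.Adj (f a) (f b) ↔ H.Adj a b)
    (hH : ∀ a b, (∀ c, H.Adj a c ↔ H.Adj b c) → a = b) : ContainsInduced H G :=
  ⟨⟨f, fun a b hab => hH a b fun c => by rw [← hf, ← hf, hab]⟩, hf⟩

theorem ContainsInduced.of_induce {α : Type*} {H : SimpleGraph α} {S : Set V}
    (h : ContainsInduced H (G.induce S)) : ContainsInduced H G := by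
  obtain ⟨f, hf⟩ := h
  exact ⟨f.trans (Function.Embedding.subtype _), hf⟩

instance : DecidableRel P2UnionP4.Adj := fun a b => by
  unfold P2UnionP4; simp only [fromEdgeSet_adj, Set.mem_insert_iff, Set.mem_singleton_iff]
  infer_instance

instance : DecidableRel BullGraph.Adj := fun a b => by
  unfold BullGraph; simp only [fromEdgeSet_adj, Set.mem_insert_iff, Set.mem_singleton_iff]
  infer_instance

instance : DecidableRel GrotzschGraph.Adj := fun a b => by
  unfold GrotzschGraph; simp only [fromEdgeSet_adj, Set.mem_insert_iff, Set.mem_singleton_iff]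
  infer_instance

theorem p2UnionP4_elim (hP : ¬ ContainsInduced P2UnionP4 G) (x y a b c d : V) (hxy : G.Adj x y)
    (hab : G.Adj a b) (hbc : G.Adj b c) (hcd : G.Adj c d) (hac : ¬ G.Adj a c)
    (hbd : ¬ G.Adj b d) (had : ¬ G.Adj a d) (hxa : ¬ G.Adj x a) (hxb : ¬ G.Adj x b)
    (hxc : ¬ G.Adj x c) (hxd : ¬ G.Adj x d) (hya : ¬ G.Adj y a) (hyb : ¬ G.Adj y b)
    (hyc : ¬ G.Adj y c) (hyd : ¬ G.Adj y d) : False := by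
  refine hP (containsInduced_of_twinFree ![x, y, a, b, c, d] (fun i j => ?_) (by decide))
  fin_cases i <;> fin_cases j <;>
    simp_all [P2UnionP4, G.adj_comm]

theorem bull_elim (hB : ¬ ContainsInduced BullGraph G) (a b c d e : V) (hab : G.Adj a b)
    (hac : G.Adj a c) (hbc : G.Adj b c) (had : G.Adj a d) (hbe : G.Adj b e) (hbd : ¬ G.Adj b d)
    (hcd : ¬ G.Adj c d) (hae : ¬ G.Adj a e) (hce : ¬ G.Adj c e) (hde : ¬ G.Adj d e) : False := by
  refine hB (containsInduced_of_twinFree ![a, b, c, d, e] (fun i j => ?_) (by decide))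
  fin_cases i <;> fin_cases j <;>
    simp_all [BullGraph, G.adj_comm]

end InducedSubgraphs

section Grotzsch

variable {V : Type*} {G : SimpleGraph V}

set_option maxHeartbeats 1000000 in
theorem grotzsch_elim_of_edges (hF : ¬ ContainsInduced GrotzschGraph G)
    (hT : ∀ a b c, G.Adj a b → G.Adj b c → G.Adj a c → False)
    (z c₀ c₁ c₂ c₃ c₄ w₀ w₁ w₂ w₃ w₄ : V)
    (e₀ : G.Adj c₀ c₁) (e₁ : G.Adj c₁ c₂) (e₂ : G.Adj c₂ c₃) (e₃ : G.Adj c₃ c₄) (e₄ : G.Adj c₄ c₀)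
    (z₀ : G.Adj z w₀) (z₁ : G.Adj z w₁) (z₂ : G.Adj z w₂) (z₃ : G.Adj z w₃) (z₄ : G.Adj z w₄)
    (l₀ : G.Adj w₀ c₄) (l₁ : G.Adj w₁ c₀) (l₂ : G.Adj w₂ c₁) (l₃ : G.Adj w₃ c₂) (l₄ : G.Adj w₄ c₃)
    (r₀ : G.Adj w₀ c₁) (r₁ : G.Adj w₁ c₂) (r₂ : G.Adj w₂ c₃) (r₃ : G.Adj w₃ c₄)
    (r₄ : G.Adj w₄ c₀) : False := by
  have hT' : ∀ m a b, G.Adj m a → G.Adj m b → ¬ G.Adj a b := fun m a b h1 h2 h3 =>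
    hT m a b h1 h3 h2
  refine hF (containsInduced_of_twinFree ![z, w₁, w₂, w₃, w₄, w₀, c₀, c₁, c₂, c₃, c₄]
    (fun i j => ?_) (by decide))
  have c02 := hT' _ _ _ e₀.symm e₁
  have c13 := hT' _ _ _ e₁.symm e₂
  have c24 := hT' _ _ _ e₂.symm e₃
  have c30 := hT' _ _ _ e₃.symm e₄
  have c41 := hT' _ _ _ e₄.symm e₀
  have zc0 := hT' _ _ _ z₁.symm l₁
  have zc1 := hT' _ _ _ z₂.symm l₂
  have zc2 := hT' _ _ _ z₃.symm l₃
  have zc3 := hT' _ _ _ z₄.symm l₄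
  have zc4 := hT' _ _ _ z₀.symm l₀
  have w01 := hT' _ _ _ z₀ z₁
  have w02 := hT' _ _ _ z₀ z₂
  have w03 := hT' _ _ _ z₀ z₃
  have w04 := hT' _ _ _ z₀ z₄
  have w12 := hT' _ _ _ z₁ z₂
  have w13 := hT' _ _ _ z₁ z₃
  have w14 := hT' _ _ _ z₁ z₄
  have w23 := hT' _ _ _ z₂ z₃
  have w24 := hT' _ _ _ z₂ z₄
  have w34 := hT' _ _ _ z₃ z₄
  have w0c0 := hT' _ _ _ r₀.symm e₀.symm
  have w0c2 := hT' _ _ _ r₀.symm e₁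
  have w0c3 := hT' _ _ _ l₀.symm e₃.symm
  have w1c1 := hT' _ _ _ r₁.symm e₁.symm
  have w1c3 := hT' _ _ _ r₁.symm e₂
  have w1c4 := hT' _ _ _ l₁.symm e₄.symm
  have w2c2 := hT' _ _ _ r₂.symm e₂.symm
  have w2c4 := hT' _ _ _ r₂.symm e₃
  have w2c0 := hT' _ _ _ l₂.symm e₀.symm
  have w3c3 := hT' _ _ _ r₃.symm e₃.symm
  have w3c0 := hT' _ _ _ r₃.symm e₄
  have w3c1 := hT' _ _ _ l₃.symm e₁.symm
  have w4c4 := hT' _ _ _ r₄.symm e₄.symm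
  have w4c1 := hT' _ _ _ r₄.symm e₀
  have w4c2 := hT' _ _ _ l₄.symm e₂.symm
  clear hT hT' hF
  simp only [GrotzschGraph, fromEdgeSet_adj, Set.mem_insert_iff, Set.mem_singleton_iff]
  fin_cases i <;> fin_cases j <;> dsimp <;> first
    | exact iff_of_false (G.loopless.irrefl _) (by decide)
    | exact iff_of_true (by assumption) (by decide)
    | exact iff_of_true (SimpleGraph.Adj.symm (by assumption)) (by decide)
    | exact iff_of_false (by assumption) (by decide)
    | exact iff_of_false (fun h => absurd h.symm ‹_›) (by decide)

theorem grotzsch_not_three_colorable (g : Fin 11 → Fin 3)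
    (hg : ∀ a b, GrotzschGraph.Adj a b → g a ≠ g b) : False := by
  have step : ∀ k x x' w w' : Fin 3, x ≠ x' → w ≠ x' → w' ≠ x →
      (if x = k then w else x) ≠ if x' = k then w' else x' := by decide
  have avoid : ∀ k x w : Fin 3, k ≠ w → (if x = k then w else x) ≠ k := by decide
  have cycle : ∀ k a b c d e : Fin 3, a ≠ k → b ≠ k → c ≠ k → d ≠ k → e ≠ k →
      a ≠ b → b ≠ c → c ≠ d → d ≠ e → e ≠ a → False := by
    intro k a b c d e h1 h2 h3 h4 h5 h6 h7 h8 h9 h10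
    have two : ∀ k x y z : Fin 3, x ≠ k → y ≠ k → z ≠ k → x ≠ y → y ≠ z → x = z := by
      intro k x y z; omega
    have hac := two k a b c h1 h2 h3 h6 h7
    have hce := two k c d e h3 h4 h5 h8 h9
    exact h10 (hac.trans hce).symm
  refine cycle (g 0) _ _ _ _ _ (avoid _ (g 6) (g 5) ?_) (avoid _ (g 7) (g 1) ?_)
    (avoid _ (g 8) (g 2) ?_) (avoid _ (g 9) (g 3) ?_) (avoid _ (g 10) (g 4) ?_)
    (step _ _ _ _ _ ?_ ?_ ?_) (step _ _ _ _ _ ?_ ?_ ?_) (step _ _ _ _ _ ?_ ?_ ?_)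
    (step _ _ _ _ _ ?_ ?_ ?_) (step _ _ _ _ _ ?_ ?_ ?_) <;> exact hg _ _ (by decide)

theorem grotzsch_triangleFree (a b c : Fin 11) (h1 : GrotzschGraph.Adj a b)
    (h2 : GrotzschGraph.Adj b c) (h3 : GrotzschGraph.Adj a c) : False := by
  revert a b c
  decide

theorem not_perfectlyDivisible_of_grotzsch [Finite V] (h : ContainsInduced GrotzschGraph G) :
    ¬ G.PerfectlyDivisible := by
  classical
  obtain ⟨f, hf⟩ := h
  intro hd
  obtain ⟨A, B, hAB, -, hA, hB⟩ := hd (Set.range f) ⟨f 0, 0, rfl⟩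
  have hcl : ∀ T ⊆ Set.range f, (G.induce T).cliqueNum ≤ 2 := by
    intro T hT
    obtain ⟨K, hK⟩ := (G.induce T).exists_isNClique_cliqueNum
    by_contra hlt
    rw [not_le, ← hK.card_eq] at hlt
    obtain ⟨x, y, z, hx, hy, hz, hxy, hxz, hyz⟩ := Finset.two_lt_card_iff.1 hlt
    obtain ⟨a, ha⟩ := hT x.2
    obtain ⟨b, hb⟩ := hT y.2
    obtain ⟨c, hc⟩ := hT z.2
    have h1 : G.Adj x y := hK.isClique hx hy hxy
    have h2 : G.Adj y z := hK.isClique hy hz hyz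
    have h3 : G.Adj x z := hK.isClique hx hz hxz
    rw [← ha, ← hb, hf] at h1
    rw [← hb, ← hc, hf] at h2
    rw [← ha, ← hc, hf] at h3
    exact grotzsch_triangleFree a b c h1 h2 h3
  have hAS : A ⊆ Set.range f := hAB ▸ Set.subset_union_left
  have hcol : ((G.induce A).induce Set.univ).Colorable 2 := by
    rw [← chromaticNumber_le_iff_colorable, hA Set.univ]
    obtain ⟨K, hK⟩ := ((G.induce A).induce Set.univ).exists_isNClique_cliqueNum
    have h1 : (G.induce A).IsClique
        ((K.map (Function.Embedding.subtype _) : Finset A) : Set A) := by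
      intro a ha b hb hxy
      obtain ⟨x, hx, rfl⟩ := Finset.mem_map.1 (Finset.mem_coe.1 ha)
      obtain ⟨y, hy, rfl⟩ := Finset.mem_map.1 (Finset.mem_coe.1 hb)
      exact hK.isClique hx hy fun e => hxy (by rw [e])
    have h2 := h1.card_le_cliqueNum.trans (hcl A hAS)
    rw [Finset.card_map, hK.card_eq] at h2
    exact_mod_cast h2
  have hstab : ∀ x ∈ B, ∀ y ∈ B, ¬ G.Adj x y := by
    intro x hx y hy hxy
    have h1 : (G.induce B).IsClique (({⟨x, hx⟩, ⟨y, hy⟩} : Finset B) : Set B) := by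
      simpa [isClique_insert] using fun _ => hxy
    have h2 := h1.card_le_cliqueNum
    rw [Finset.card_pair (fun e => hxy.ne (congrArg Subtype.val e))] at h2
    have := hcl _ (subset_refl (Set.range f))
    omega
  obtain ⟨C⟩ := hcol
  refine grotzsch_not_three_colorable
    (fun i => if h : f i ∈ A then (C ⟨⟨f i, h⟩, trivial⟩).castSucc else 2) fun a b hab => ?_
  have hadj : G.Adj (f a) (f b) := (hf a b).2 hab
  have hB' : ∀ i, f i ∉ A → f i ∈ B := fun i hi =>
    (hAB.ge ⟨i, rfl⟩ : f i ∈ A ∪ B).resolve_left hi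
  have hne : ∀ x : Fin 2, x.castSucc ≠ (2 : Fin 3) := by decide
  by_cases h : f a ∈ A <;> by_cases h' : f b ∈ A
  · simp only [h, h', dif_pos]
    intro e
    exact C.valid (show ((G.induce A).induce Set.univ).Adj ⟨⟨f a, h⟩, trivial⟩ ⟨⟨f b, h'⟩, trivial⟩
      from hadj) (Fin.castSucc_injective _ e)
  · simpa [h, h'] using hne _
  · simpa [h, h'] using (hne _).symm
  · exact absurd hadj (hstab _ (hB' a h) _ (hB' b h'))

end Grotzsch

/-- The properties of a smallest induced subgraph that is not weighted divisible. -/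
structure DivisionMinimal {V : Type*} (G : SimpleGraph V) : Prop where
  nonempty : Nonempty V
  eq_of_homogeneous : ∀ X : Set V, HomogeneousIn G X Set.univ → X ≠ Set.univ →
    ∀ a ∈ X, ∀ b ∈ X, a = b
  not_perfectOn : ∀ v, ¬ PerfectOn G {x | x ≠ v ∧ ¬ G.Adj v x}
  exists_not_mem : ∀ C₀ C₁ C₂ : Set V, StableIn G C₀ → StableIn G C₁ → StableIn G C₂ →
    ∃ x, x ∉ C₀ ∧ x ∉ C₁ ∧ x ∉ C₂

theorem PerfectOn.of_induce {V : Type*} {G : SimpleGraph V} {S : Set V} (s : S) {A : Set V}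
    (hA : A ⊆ S) (h : PerfectOn (G.induce S) {x | (x : V) ∈ A}) : PerfectOn G A := by
  classical
  intro T hT
  have hσ : ∀ x ∈ T, ((if h : x ∈ S then ⟨x, h⟩ else s : S) : V) = x := fun x hx => by
    rw [dif_pos (hA (hT hx))]
  refine CliqueColorable.of_map (H := G.induce S) (σ := fun x => if h : x ∈ S then ⟨x, h⟩ else s)
    (fun x hx y hy => ?_) (h _ ?_)
  · rw [comap_adj]
    change G.Adj ((if h : x ∈ S then ⟨x, h⟩ else s : S) : V)
      ((if h : y ∈ S then ⟨y, h⟩ else s : S) : V) ↔ _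
    rw [hσ x hx, hσ y hy]
  · rintro _ ⟨x, hx, rfl⟩
    change ((if h : x ∈ S then ⟨x, h⟩ else s : S) : V) ∈ A
    rw [hσ x hx]
    exact hT hx

theorem exists_divisionMinimal_of_not_weightedDivisible {V : Type*} [Finite V] {G : SimpleGraph V}
    (h : ¬ ∀ S : Set V, S.Nonempty → WeightedDivisible G S) :
    ∃ S : Set V, DivisionMinimal (G.induce S) := by
  push Not at h
  obtain ⟨S, ⟨hS, hnd⟩, hmin⟩ := Set.exists_min_image
    {S : Set V | S.Nonempty ∧ ¬ WeightedDivisible G S} Set.ncard (Set.toFinite _) h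
  have hlt : ∀ T : Set V, T.Nonempty → T ⊆ S → (∃ x ∈ S, x ∉ T) → WeightedDivisible G T := by
    rintro T hT hTS ⟨x, hx, hxT⟩
    by_contra hc
    have h1 := hmin T ⟨hT, hc⟩
    have h2 := Set.ncard_lt_ncard (hTS.ssubset_of_not_subset fun h => hxT (h hx)) (Set.toFinite _)
    omega
  have hhom : ∀ X ⊆ S, HomogeneousIn G X S → (∃ x ∈ S, x ∉ X) → ∀ a ∈ X, ∀ b ∈ X, a = b := by
    intro X hXS hX hx a ha b hb
    by_contra hab
    refine hnd (WeightedDivisible.of_homogeneous hXS hX (hlt X ⟨a, ha⟩ hXS hx) ⟨a, ha⟩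
      fun x₀ hx₀ => hlt _ ⟨x₀, Or.inl rfl⟩
        (Set.insert_subset (hXS hx₀) Set.sdiff_subset) ?_)
    by_cases h : x₀ = a
    · exact ⟨b, hXS hb, by rintro (rfl | h'); exacts [hab h.symm, h'.2 hb]⟩
    · exact ⟨a, hXS ha, by rintro (rfl | h'); exacts [h rfl, h'.2 ha]⟩
  have hper : ∀ v ∈ S, ¬ PerfectOn G {x ∈ S | x ≠ v ∧ ¬ G.Adj v x} := fun v hv h =>
    hnd (WeightedDivisible.of_perfectOn_nonneighbors hv h)
  have hnb : ∀ x ∈ S, ∃ y ∈ S, G.Adj x y := by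
    intro x hx
    by_contra hno
    push Not at hno
    refine hper x hx (ColorableOn.perfectOn_two ⟨fun _ => 0, fun _ _ => Nat.two_pos,
      fun a ha b hb hab => ?_⟩)
    have := hhom (S \ {x}) Set.sdiff_subset (fun y hy hyX => ?_) ⟨x, hx, fun h => h.2 rfl⟩
      a ⟨ha.1, ha.2.1⟩ b ⟨hb.1, hb.2.1⟩
    · exact absurd this hab.ne
    · have hyx : y = x := by by_contra h; exact hyX ⟨hy, h⟩
      exact Or.inr fun z hz => hyx ▸ hno z hz.1
  refine ⟨S, hS.to_subtype, fun X hX hne a ha b hb => ?_, fun v hv => ?_,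
    fun C₀ C₁ C₂ h₀ h₁ h₂ => ?_⟩
  · refine Subtype.ext (hhom (Subtype.val '' X) (by rintro _ ⟨x, -, rfl⟩; exact x.2) ?_ ?_
      a ⟨a, ha, rfl⟩ b ⟨b, hb, rfl⟩)
    · intro y hy hyX
      rcases hX ⟨y, hy⟩ trivial (fun h => hyX ⟨_, h, rfl⟩) with h | h
      · left; rintro _ ⟨x, hx, rfl⟩; exact h x hx
      · right; rintro _ ⟨x, hx, rfl⟩; exact h x hx
    · obtain ⟨x, hx⟩ := (Set.ne_univ_iff_exists_notMem X).1 hne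
      exact ⟨x, x.2, by rintro ⟨y, hy, e⟩; exact hx (Subtype.ext e ▸ hy)⟩
  · refine hper v v.2 (PerfectOn.of_induce v (Set.sep_subset _ _) (hv.mono ?_))
    rintro x ⟨-, h1, h2⟩
    exact ⟨fun e => h1 (congrArg Subtype.val e), h2⟩
  · by_contra hno
    push Not at hno
    refine hnd (WeightedDivisible.of_stable_cover hS hnb (Subtype.val '' C₀) (Subtype.val '' C₁)
      (Subtype.val '' C₂) ?_ ?_ ?_ ?_)
    · rintro _ ⟨x, hx, rfl⟩ _ ⟨y, hy, rfl⟩; exact h₀ x hx y hy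
    · rintro _ ⟨x, hx, rfl⟩ _ ⟨y, hy, rfl⟩; exact h₁ x hx y hy
    · rintro _ ⟨x, hx, rfl⟩ _ ⟨y, hy, rfl⟩; exact h₂ x hx y hy
    · intro x hx
      by_cases h : (⟨x, hx⟩ : S) ∈ C₀
      · exact Or.inl ⟨_, h, rfl⟩
      · by_cases h' : (⟨x, hx⟩ : S) ∈ C₁
        · exact Or.inr (Or.inl ⟨_, h', rfl⟩)
        · exact Or.inr (Or.inr ⟨_, hno _ h h', rfl⟩)

section MinimallyImperfectNonneighbors

variable {V : Type*} {G : SimpleGraph V} {D S R : Set V} {u v : V}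

/-- Five vertices in cyclic order that induce a 5-cycle. -/
def IsC5 (G : SimpleGraph V) (c : Fin 5 → V) : Prop :=
  ∀ i, G.Adj (c i) (c (i + 1)) ∧ ¬ G.Adj (c i) (c (i + 2))

theorem isC5_of {a b c d e : V} (hab : G.Adj a b) (hbc : G.Adj b c) (hcd : G.Adj c d)
    (hde : G.Adj d e) (hea : G.Adj e a) (hac : ¬ G.Adj a c) (hbd : ¬ G.Adj b d)
    (hce : ¬ G.Adj c e) (hda : ¬ G.Adj d a) (heb : ¬ G.Adj e b) : IsC5 G ![a, b, c, d, e] := by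
  intro i
  fin_cases i
  exacts [⟨hab, hac⟩, ⟨hbc, hbd⟩, ⟨hcd, hce⟩, ⟨hde, hda⟩, ⟨hea, heb⟩]

theorem relConn_pair {r : V → V → Prop} (hr : ∀ a b, r a b → r b a) {a b : V} (hab : r a b) :
    RelConn r {b, a} :=
  (relConn_singleton a).insert hr rfl hab

theorem exists_nonneighbor_of_connected [Finite V] (hB : ¬ ContainsInduced BullGraph G)
    (hG : DivisionMinimal G) {X : Set V} (hXv : ∀ x ∈ X, x ≠ v ∧ ¬ G.Adj v x)
    (hX : RelConn G.Adj X) {a b : V} (ha : a ∈ X) (hb : b ∈ X) (hab : a ≠ b) :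
    ∃ u, G.Adj v u ∧ ∃ x ∈ X, ¬ G.Adj u x := by
  by_contra hno
  push Not at hno
  obtain ⟨Y, hXY, ⟨hYc, hYv, hYu⟩, hYmax⟩ := exists_maximal_superset
    (fun Y => RelConn G.Adj Y ∧ (∀ x ∈ Y, x ≠ v ∧ ¬ G.Adj v x) ∧
      ∀ u, G.Adj v u → ∀ x ∈ Y, G.Adj u x) ⟨hX, hXv, hno⟩
  refine hab (hG.eq_of_homogeneous Y (fun y _ hy => ?_) ?_ a (hXY ha) b (hXY hb))
  · by_contra hmix
    push Not at hmix
    obtain ⟨⟨p, hp, hyp⟩, q, hq, hyq⟩ := hmix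
    have hyv : y ≠ v := fun e => (hYv q hq).2 (e ▸ hyq)
    have hvy : ¬ G.Adj v y := fun h => hyp (hYu y h p hp).symm.symm
    have hnot := hYmax y hy
    obtain ⟨w, hvw, hwy⟩ : ∃ w, G.Adj v w ∧ ¬ G.Adj w y := by
      by_contra hall
      push Not at hall
      refine hnot ⟨hYc.insert (fun _ _ h => h.symm) hq hyq.symm, ?_, ?_⟩
      · rintro x (rfl | hx)
        exacts [⟨hyv, hvy⟩, hYv x hx]
      · rintro w hw x (rfl | hx)
        exacts [hall w hw, hYu w hw x hx]
    obtain ⟨s, hs, t, ht, hys, hyt, hst⟩ := hYc (fun x => G.Adj y x) ⟨q, hq, hyq⟩ ⟨p, hp, hyp⟩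
    exact bull_elim hB w s t v y (hYu w hvw s hs) (hYu w hvw t ht) hst hvw.symm hys.symm
      (fun h => (hYv s hs).2 h.symm) (fun h => (hYv t ht).2 h.symm) hwy (fun h => hyt h.symm) hvy
  · rintro rfl
    exact (hYv v trivial).1 rfl

theorem false_of_connected_part [Finite V] (hB : ¬ ContainsInduced BullGraph G)
    (hD : MinImperfect G D) (hS : S ⊆ D) (hR : R ⊆ D) (hSR : ∀ x ∈ D, x ∈ S ∨ x ∈ R)
    (hSst : StableIn G S) (hRne : R.Nonempty)
    (hP4 : ∀ a ∈ R, ∀ b ∈ R, ∀ c ∈ R, ∀ d ∈ R, G.Adj a b → G.Adj b c → G.Adj c d →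
      ¬ G.Adj a c → ¬ G.Adj b d → ¬ G.Adj a d → False)
    (hpaw : ∀ s ∈ S, ∀ a ∈ R, ∀ b ∈ R, ∀ c ∈ R, G.Adj s a → G.Adj s b → G.Adj a b → G.Adj c a →
      ¬ G.Adj c b → ¬ G.Adj c s → False)
    (hRc : RelConn G.Adj R) : False := by
  classical
  have hSadj : ∀ s ∈ S, ∀ y ∈ D, G.Adj s y → y ∈ R := fun s hs y hy h =>
    (hSR y hy).resolve_left fun hyS => hSst s hs y hyS h
  have hnonuniv : ∀ x ∈ R, ∃ y ∈ R, y ≠ x ∧ ¬ G.Adj x y := by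
    intro x hx
    by_contra hno
    push Not at hno
    have hxD : ∀ y ∈ D, y ≠ x → G.Adj x y := by
      intro y hy hyx
      rcases hSR y hy with h | h
      · by_contra hxy
        refine hD.not_dominated hy (hR hx) hyx fun z hz hyz => ?_
        exact hno z (hSadj y h z hz hyz) fun e => hxy (e ▸ hyz.symm)
      · exact hno y h hyx
    obtain ⟨K, hK, hKc, hKmax⟩ := hD.exists_clique (I := {x}) ⟨x, hR hx, rfl⟩
      (by rintro _ rfl _ rfl; exact G.loopless.irrefl _)
    have hxK : x ∉ K := fun h => (hK h).2 rfl
    have := hKmax (insert x K) (by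
      rw [Finset.coe_insert]; exact Set.insert_subset (hR hx) (hK.trans Set.sdiff_subset)) (by
      rw [Finset.coe_insert, isClique_insert]
      exact ⟨hKc, fun b hb hne => hxD b (hK hb).1 hne.symm⟩)
    rw [Finset.card_insert_of_notMem hxK] at this
    omega
  have hcsymm : ∀ a b, Gᶜ.Adj a b → Gᶜ.Adj b a := fun _ _ h => h.symm
  choose! K hxK hKR hKc hKcl using fun x (hx : x ∈ R) =>
    exists_component (r := Gᶜ.Adj) hcsymm (Set.singleton_subset_iff.2 hx) (relConn_singleton x)
  have hself : ∀ x ∈ R, x ∈ K x := fun x hx => hxK x hx rfl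
  have hcomplete : ∀ x ∈ R, ∀ k ∈ K x, ∀ y ∈ R, y ∉ K x → G.Adj k y := by
    intro x hx k hk y hy hyK
    by_contra h
    exact hKcl x hx y hy hyK k hk (by
      rw [compl_adj]; exact ⟨fun e => hyK (e ▸ hk), h⟩)
  have hnotall : ∀ x ∈ R, ∃ y ∈ R, y ∉ K x := by
    intro x hx
    by_contra hall
    push Not at hall
    have hKeq : K x = R := (hKR x hx).antisymm hall
    obtain ⟨y, hy, hyx, -⟩ := hnonuniv x hx
    refine not_relConn_and_compl G _ (Set.toFinite R).toFinset rfl ?_ ?_ ?_ ?_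
    · exact Finset.one_lt_card.2 ⟨y, by simpa using hy, x, by simpa using hx, hyx⟩
    · simpa using hP4
    · simpa using hRc
    · simpa [hKeq] using hKc x hx
  have hmixed : ∀ x ∈ R, ∃ s ∈ S, ∃ a ∈ K x, ∃ b ∈ K x, G.Adj s a ∧ ¬ G.Adj s b := by
    intro x hx
    obtain ⟨y, hy, hyx, hxy⟩ := hnonuniv x hx
    obtain ⟨z, hz, hzK⟩ := hnotall x hx
    by_contra hno
    push Not at hno
    refine hD.not_homogeneous ((hKR x hx).trans hR) (fun w hw hwK => ?_) (hself x hx)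
      (b := y) ?_ hyx.symm fun h => hzK (h (hR hz))
    · rcases hSR w hw with h | h
      · by_cases h1 : ∃ a ∈ K x, G.Adj w a
        · obtain ⟨a, ha, hwa⟩ := h1
          exact Or.inl fun b hb => hno w h a ha b hb hwa
        · push Not at h1
          exact Or.inr h1
      · exact Or.inl fun k hk => (hcomplete x hx k hk w h hwK).symm
    · by_contra h
      exact hxy (hcomplete x hx x (hself x hx) y hy h)
  have hanti : ∀ x ∈ R, ∀ s ∈ S, ∀ a ∈ K x, ∀ b ∈ K x, G.Adj s a → ¬ G.Adj s b →
      ∀ c ∈ R, c ∉ K x → ¬ G.Adj s c := by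
    intro x hx s hs a ha b hb hsa hsb c hc hcK hsc
    obtain ⟨a, ha, b, hb, hsa, hsb, hab⟩ := hKc x hx (fun y => G.Adj s y) ⟨a, ha, hsa⟩ ⟨b, hb, hsb⟩
    rw [compl_adj] at hab
    exact hpaw s hs c hc a (hKR x hx ha) b (hKR x hx hb) hsc hsa
      (hcomplete x hx a ha c hc hcK).symm (hcomplete x hx b hb c hc hcK)
      (fun h => hab.2 h.symm) fun h => hsb h.symm
  have hdisj : ∀ x ∈ R, ∀ y ∈ R, y ∉ K x → ∀ z ∈ K x, z ∉ K y := by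
    intro x hx y hy hyK z hz hzy
    refine hyK ((hKc y hy).subset_of_closed (fun w hw hwK k hk => ?_) hzy hz (hself y hy))
    exact hKcl x hx w (hKR y hy hw) hwK k hk
  have hstable : ∀ x ∈ R, StableIn G (K x) := by
    intro x hx p hp q hq hpq
    obtain ⟨y, hy, hyK⟩ := hnotall x hx
    obtain ⟨s, hs, b, hb, b', hb', hsb, hsb'⟩ := hmixed y hy
    have hbx : b ∉ K x := fun h => hdisj x hx y hy hyK b h hb
    obtain ⟨T, hT, hTK, hTc, hTcl⟩ := exists_component (r := G.Adj) (fun _ _ h => h.symm)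
      (R := K x) (X₀ := {q, p}) (by rintro z (rfl | rfl) <;> assumption)
      (relConn_pair (fun _ _ h => h.symm) hpq)
    refine hD.not_homogeneous ((hTK.trans (hKR x hx)).trans hR) (fun w hw hwT => ?_)
      (hT (Or.inr rfl)) (hT (Or.inl rfl)) hpq.ne fun h => hyK (hTK (h (hR hy)))
    by_contra hmix
    push Not at hmix
    obtain ⟨⟨c, hc, hwc⟩, d, hd, hwd⟩ := hmix
    obtain ⟨e, he, f, hf, hwe, hwf, hef⟩ := hTc (fun z => G.Adj w z) ⟨d, hd, hwd⟩ ⟨c, hc, hwc⟩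
    by_cases hwK : w ∈ K x
    · exact hTcl w hwK hwT e he hwe.symm
    rcases hSR w hw with hwS | hwR
    · have hwb : ¬ G.Adj w b := hanti x hx w hwS e (hTK he) f (hTK hf) hwe hwf b (hKR y hy hb) hbx
      have hsK : ∀ z ∈ K x, ¬ G.Adj s z := fun z hz =>
        hanti y hy s hs b hb b' hb' hsb hsb' z (hKR x hx hz) (hdisj x hx y hy hyK z hz)
      exact bull_elim hB e b f w s (hcomplete x hx e (hTK he) b (hKR y hy hb) hbx) hef
        (hcomplete x hx f (hTK hf) b (hKR y hy hb) hbx).symm hwe.symm hsb.symm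
        (fun h => hwb h.symm) (fun h => hwf h.symm) (fun h => hsK e (hTK he) h.symm)
        (fun h => hsK f (hTK hf) h.symm) (hSst w hwS s hs)
    · exact hwf (hcomplete x hx f (hTK hf) w hwR hwK).symm
  obtain ⟨x, hx⟩ := hRne
  obtain ⟨y, hy, hyK⟩ := hnotall x hx
  have hcover : ∀ z ∈ R, z ∈ K x ∨ z ∈ K y := by
    intro c hc
    by_contra hno
    push Not at hno
    obtain ⟨s, hs, a, ha, a', ha', hsa, hsa'⟩ := hmixed x hx
    obtain ⟨t, ht, b, hb, b', hb', htb, htb'⟩ := hmixed y hy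
    have hbx : b ∉ K x := fun h => hdisj x hx y hy hyK b h hb
    have hs' := hanti x hx s hs a ha a' ha' hsa hsa'
    have ht' := hanti y hy t ht b hb b' hb' htb htb'
    exact bull_elim hB a b c s t (hcomplete x hx a ha b (hKR y hy hb) hbx)
      (hcomplete x hx a ha c hc hno.1) (hcomplete y hy b hb c hc hno.2) hsa.symm htb.symm
      (fun h => hs' b (hKR y hy hb) hbx h.symm) (fun h => hs' c hc hno.1 h.symm)
      (fun h => ht' a (hKR x hx ha) (hdisj x hx y hy hyK a ha) h.symm)
      (fun h => ht' c hc hno.2 h.symm) (hSst s hs t ht)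
  have hxy : G.Adj x y := hcomplete x hx x (hself x hx) y hy hyK
  have hcov : ∀ z ∈ D, z ∉ K x → z ∉ K y → z ∈ S := fun z hz h1 h2 => by
    rcases hSR z hz with h | h
    · exact h
    · exact absurd (hcover z h) (by tauto)
  by_cases htri : ∃ s ∈ S, ∃ a ∈ K x, ∃ b ∈ K y, G.Adj s a ∧ G.Adj s b
  · obtain ⟨s, hs, a, ha, b, hb, hsa, hsb⟩ := htri
    have hab : G.Adj a b := hcomplete x hx a ha b (hKR y hy hb)
      fun h => hdisj x hx y hy hyK b h hb
    refine hD.1 ⟨{s, a, b}, ?_, ?_, ?_⟩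
    · intro z hz
      simp only [Finset.coe_insert, Finset.coe_singleton, Set.mem_insert_iff,
        Set.mem_singleton_iff] at hz
      rcases hz with rfl | rfl | rfl
      exacts [hS hs, hR (hKR x hx ha), hR (hKR y hy hb)]
    · simp [isClique_insert, hsa, hsb, hab]
    · rw [Finset.card_eq_three.2 ⟨s, a, b, hsa.ne, hsb.ne, hab.ne, rfl⟩]
      refine ColorableOn.union_stable (ColorableOn.union_stable (ColorableOn.of_stable
        fun z hz w hw => ?_) (hstable y hy)) (hstable x hx)
      exact hSst z (hcov z hz.1.1 hz.1.2 hz.2) w (hcov w hw.1.1 hw.1.2 hw.2)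
  · push Not at htri
    refine hD.1 ⟨{x, y}, ?_, ?_, ?_⟩
    · intro z hz
      simp only [Finset.coe_insert, Finset.coe_singleton, Set.mem_insert_iff,
        Set.mem_singleton_iff] at hz
      rcases hz with rfl | rfl
      exacts [hR hx, hR hy]
    · simpa [isClique_insert] using fun _ => hxy
    · rw [Finset.card_pair hxy.ne]
      have h0 : ∀ z ∈ K x, z ∉ K y := hdisj x hx y hy hyK
      have key : ∀ z ∈ D, ∀ w ∈ D, G.Adj z w → (z ∈ K x ∨ (z ∉ K y ∧ ∀ a ∈ K x, ¬ G.Adj z a)) →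
          (w ∈ K x ∨ (w ∉ K y ∧ ∀ a ∈ K x, ¬ G.Adj w a)) → False := by
        rintro z hz w hw hzw (h1 | ⟨h1, h2⟩) (h3 | ⟨h3, h4⟩)
        · exact hstable x hx z h1 w h3 hzw
        · exact h4 z h1 hzw.symm
        · exact h2 w h3 hzw
        · by_cases h5 : z ∈ K x
          · exact h4 z h5 hzw.symm
          by_cases h6 : w ∈ K x
          · exact h2 w h6 hzw
          exact hSst z (hcov z hz h5 h1) w (hcov w hw h6 h3) hzw
      have key' : ∀ z ∈ D, ∀ w ∈ D, G.Adj z w → ¬ (z ∈ K x ∨ (z ∉ K y ∧ ∀ a ∈ K x, ¬ G.Adj z a)) →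
          ¬ (w ∈ K x ∨ (w ∉ K y ∧ ∀ a ∈ K x, ¬ G.Adj w a)) → False := by
        intro z hz w hw hzw h1 h2
        push Not at h1 h2
        have key2 : ∀ z ∈ D, z ∉ K x → (z ∉ K y → ∃ a ∈ K x, G.Adj z a) → ∀ w ∈ K y, G.Adj z w →
            z ∈ K y := by
          intro z hz hzx hzy w hw hzw
          by_contra h
          obtain ⟨a, ha, hza⟩ := hzy h
          exact htri z (hcov z hz hzx h) a ha w hw hza hzw
        by_cases h3 : z ∈ K y
        · exact hstable y hy z h3 w (key2 w hw h2.1 h2.2 z h3 hzw.symm) hzw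
        · by_cases h4 : w ∈ K y
          · exact h3 (key2 z hz h1.1 h1.2 w h4 hzw)
          · exact hSst z (hcov z hz h1.1 h3) w (hcov w hw h2.1 h4) hzw
      refine ColorableOn.union_stable (I := {z ∈ D | z ∈ K x ∨ (z ∉ K y ∧ ∀ a ∈ K x, ¬ G.Adj z a)})
        (ColorableOn.of_stable fun z hz w hw hzw => ?_) fun z hz w hw hzw =>
          key z hz.1 w hw.1 hzw hz.2 hw.2
      exact key' z hz.1 w hw.1 hzw (fun h => hz.2 ⟨hz.1, h⟩) fun h => hw.2 ⟨hw.1, h⟩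

end MinimallyImperfectNonneighbors

section DisconnectedPart

variable {V : Type*} {G : SimpleGraph V} {D S R : Set V} {u v : V}

theorem exists_isC5_of_disconnected_part [Finite V] (hD : MinImperfect G D) (hS : S ⊆ D)
    (hR : R ⊆ D) (hSR : ∀ x ∈ D, x ∈ S ∨ x ∈ R) (hSst : StableIn G S)
    (hdisj : ∀ x ∈ S, x ∉ R)
    (hP4 : ∀ a ∈ R, ∀ b ∈ R, ∀ c ∈ R, ∀ d ∈ R, G.Adj a b → G.Adj b c → G.Adj c d →
      ¬ G.Adj a c → ¬ G.Adj b d → ¬ G.Adj a d → False)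
    (hfar : ∀ s ∈ S, ∀ r ∈ R, ∀ a ∈ R, ∀ b ∈ R, G.Adj s r → G.Adj a b → ¬ G.Adj s a →
      ¬ G.Adj s b → ¬ G.Adj r a → ¬ G.Adj r b → False)
    (hpaw : ∀ s ∈ S, ∀ a ∈ R, ∀ b ∈ R, ∀ c ∈ R, G.Adj s a → G.Adj s b → G.Adj a b → G.Adj c a →
      ¬ G.Adj c b → ¬ G.Adj c s → False)
    (hRc : ¬ RelConn G.Adj R) : ∃ c, IsC5 G c ∧ ∀ i, c i ∈ D := by
  classical
  have hcons : ∀ a ∈ D, ∀ b ∈ D, ∀ c ∈ D, ∀ d ∈ D, ∀ e ∈ D, IsC5 G ![a, b, c, d, e] →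
      ∃ c, IsC5 G c ∧ ∀ i, c i ∈ D := by
    intro a ha b hb c hc d hd e he h
    refine ⟨_, h, fun i => ?_⟩
    fin_cases i
    exacts [ha, hb, hc, hd, he]
  choose! K hxK hKR hKc hKcl using fun x (hx : x ∈ R) =>
    exists_component (r := G.Adj) (fun _ _ h => h.symm) (Set.singleton_subset_iff.2 hx)
      (relConn_singleton x)
  have hself : ∀ x ∈ R, x ∈ K x := fun x hx => hxK x hx rfl
  have hsub : ∀ x ∈ R, ∀ y ∈ R, ∀ z ∈ K x, z ∈ K y → K x ⊆ K y := fun x hx y hy z hz hzy =>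
    (hKc x hx).subset_of_closed (fun w hw hwK k hk => hKcl y hy w (hKR x hx hw) hwK k hk) hz hzy
  have heq : ∀ x ∈ R, ∀ y ∈ K x, K y = K x := fun x hx y hy =>
    (hsub y (hKR x hx hy) x hx y (hself y (hKR x hx hy)) hy).antisymm
      (hsub x hx y (hKR x hx hy) y hy (hself y (hKR x hx hy)))
  have hadjK : ∀ x ∈ R, ∀ y ∈ R, G.Adj x y → K y = K x := fun x hx y hy hxy => by
    refine heq x hx y ?_
    by_contra h
    exact hKcl x hx y hy h x (hself x hx) hxy
  -- a vertex of `S` with a neighbour in a component sees every edge of the other components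
  have hedge : ∀ s ∈ S, ∀ r ∈ R, ∀ a ∈ R, ∀ b ∈ R, G.Adj s r → G.Adj a b → K r ≠ K a →
      G.Adj s a ∨ G.Adj s b := by
    intro s hs r hr a ha b hb hsr hab hK
    by_contra hno
    push Not at hno
    exact hfar s hs r hr a ha b hb hsr hab hno.1 hno.2
      (fun h => hK (hadjK r hr a ha h).symm)
      fun h => hK ((hadjK r hr b hb h).symm.trans (hadjK a ha b hb hab))
  have hedge2 : ∀ s ∈ S, ∀ r ∈ R, ∀ r' ∈ R, G.Adj s r → G.Adj s r' → K r ≠ K r' →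
      ∀ a ∈ R, ∀ b ∈ R, G.Adj a b → G.Adj s a ∨ G.Adj s b := by
    intro s hs r hr r' hr' hsr hsr' hne a ha b hb hab
    by_cases h : K r = K a
    · exact hedge s hs r' hr' a ha b hb hsr' hab (fun h' => hne (h.trans h'.symm))
    · exact hedge s hs r hr a ha b hb hsr hab h
  have hcompl : ∀ s ∈ S, ∀ r ∈ R, ∀ r' ∈ R, G.Adj s r → G.Adj s r' → K r ≠ K r' →
      ∀ p ∈ R, ∀ q ∈ R, K p = K q → ¬ G.Adj s p → G.Adj s q → G.Adj p q := by
    intro s hs r hr r' hr' hsr hsr' hne p hp q hq hpq hsp hsq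
    by_contra hnpq
    have hqK : q ∈ K p := hpq ▸ hself q hq
    obtain ⟨m, hm, hpm, hmq⟩ : ∃ m ∈ K p, G.Adj p m ∧ G.Adj m q := by
      by_contra hno
      push Not at hno
      obtain ⟨x, hx, y, hy, hpx, hpy, hxy⟩ := hKc p hp
        (fun x => x = p ∨ G.Adj p x ∨ ∃ m ∈ K p, G.Adj p m ∧ G.Adj m x)
        ⟨p, hself p hp, Or.inl rfl⟩ ⟨q, hqK, by
          rintro (h | h | ⟨m, hm, h1, h2⟩)
          · exact hsp (h ▸ hsq)
          · exact hnpq h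
          · exact hno m hm h1 h2⟩
      push Not at hpy
      rcases hpx with rfl | hpx | ⟨m, hm, h1, h2⟩
      · exact hpy.2.1 hxy
      · exact hpy.2.2 x hx hpx hxy
      · by_cases hpx : G.Adj p x
        · exact hpy.2.2 x hx hpx hxy
        · exact hP4 p hp m (hKR p hp hm) x (hKR p hp hx) y (hKR p hp hy) h1 h2 hxy hpx
            (hpy.2.2 m hm h1) hpy.2.1
    have hmR := hKR p hp hm
    have hsm : G.Adj s m :=
      (hedge2 s hs r hr r' hr' hsr hsr' hne p hp m hmR hpm).resolve_left hsp
    exact hpaw s hs m hmR q hq p hp hsm hsq hmq hpm hnpq fun h => hsp h.symm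
  obtain ⟨s₀, hs₀, p₀, hp₀, q₀, hq₀, hsp₀, hsq₀, hpq₀⟩ : ∃ s₀ ∈ S, ∃ p ∈ R, ∃ q ∈ R,
      G.Adj s₀ p ∧ G.Adj s₀ q ∧ K p ≠ K q := by
    unfold RelConn at hRc
    push Not at hRc
    obtain ⟨p, ⟨a, ha, hpa⟩, ⟨b, hb, hpb⟩, hno⟩ := hRc
    have hconst : ∀ x ∈ R, ∀ y ∈ K x, p x → p y := by
      intro x hx y hy hpx
      by_contra hpy
      obtain ⟨c, hc, d, hd, h1, h2, h3⟩ := hKc x hx p ⟨x, hself x hx, hpx⟩ ⟨y, hy, hpy⟩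
      exact hno c (hKR x hx hc) d (hKR x hx hd) h1 h2 h3
    obtain ⟨x, hx, y, hy, hqx, hqy, hxy⟩ := hD.relConn
      (fun x => (x ∈ R ∧ p x) ∨ (x ∈ S ∧ ∃ z ∈ R, p z ∧ G.Adj x z))
      ⟨a, hR ha, Or.inl ⟨ha, hpa⟩⟩ ⟨b, hR hb, by
        rintro (h | h)
        exacts [hpb h.2, hdisj b h.1 hb]⟩
    push Not at hqy
    rcases hSR y hy with hyS | hyR
    · rcases hqx with ⟨hxR, hpx⟩ | ⟨hxS, -⟩
      · exact absurd hxy.symm (hqy.2 hyS x hxR hpx)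
      · exact absurd hxy (hSst x hxS y hyS)
    · rcases hqx with ⟨hxR, hpx⟩ | ⟨hxS, z, hz, hpz, hxz⟩
      · exact absurd hxy (hno x hxR y hyR hpx (hqy.1 hyR))
      · exact ⟨x, hxS, z, hz, y, hyR, hxz, hxy, fun h =>
          hqy.1 hyR (hconst z hz y (h ▸ hself y hyR) hpz)⟩
  have hE0 := hedge2 s₀ hs₀ p₀ hp₀ q₀ hq₀ hsp₀ hsq₀ hpq₀
  have hC0 := hcompl s₀ hs₀ p₀ hp₀ q₀ hq₀ hsp₀ hsq₀ hpq₀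
  obtain ⟨M, hMD', hMc, hMmax⟩ := hD.exists_clique (I := {s₀}) ⟨s₀, hS hs₀, rfl⟩
    (by rintro _ rfl _ rfl; exact G.loopless.irrefl _)
  have hMD : (M : Set V) ⊆ D := hMD'.trans Set.sdiff_subset
  set IR : Set V := {r ∈ R | ¬ G.Adj s₀ r ∧
    ∃ L : Finset V, (L : Set V) ⊆ K r ∧ G.IsClique L ∧ M.card ≤ L.card} with hIR
  set Sp : Set V := {s ∈ S | ∀ r ∈ IR, ¬ G.Adj s r} with hSp
  set I0 : Set V := {q ∈ R | (∀ r ∈ R, ¬ G.Adj q r) ∧ ∀ s ∈ Sp, ¬ G.Adj q s} with hI0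
  have hIst : StableIn G (IR ∪ Sp ∪ I0) := by
    have h1 : ∀ x ∈ I0, ∀ y ∈ IR ∪ Sp ∪ I0, ¬ G.Adj x y := by
      rintro x hx y ((hy | hy) | hy)
      exacts [hx.2.1 y hy.1, hx.2.2 y hy, hx.2.1 y hy.1]
    rintro x ((hx | hx) | hx) y ((hy | hy) | hy)
    · exact fun h => (hE0 x hx.1 y hy.1 h).elim hx.2.1 hy.2.1
    · exact fun h => hy.2 x hx h.symm
    · exact fun h => h1 y hy x (Or.inl (Or.inl hx)) h.symm
    · exact hx.2 y hy
    · exact hSst x hx.1 y hy.1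
    · exact fun h => h1 y hy x (Or.inl (Or.inr hx)) h.symm
    · exact h1 x hx y (Or.inl (Or.inl hy))
    · exact h1 x hx y (Or.inl (Or.inr hy))
    · exact h1 x hx y (Or.inr hy)
  have hs₀I : s₀ ∈ IR ∪ Sp ∪ I0 := Or.inl (Or.inr ⟨hs₀, fun r hr => hr.2.1⟩)
  obtain ⟨Q, hQ, hQc, hQmax⟩ := hD.exists_clique ⟨s₀, hS hs₀, hs₀I⟩ hIst
  have hQD : (Q : Set V) ⊆ D := hQ.trans Set.sdiff_subset
  have hnotbig : ∀ L : Finset V, (L : Set V) ⊆ D → G.IsClique L → M.card ≤ L.card →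
      ∀ x ∈ D, x ∉ L → (∀ y ∈ L, G.Adj x y) → False := by
    intro L hLD hLc hLM x hx hxL hall
    have := hMmax (insert x L) (by
      rw [Finset.coe_insert]; exact Set.insert_subset hx hLD) (by
      rw [Finset.coe_insert, isClique_insert]; exact ⟨hLc, fun b hb _ => hall b hb⟩)
    rw [Finset.card_insert_of_notMem hxL] at this
    omega
  have hMQ : M.card ≤ Q.card := hQmax M hMD hMc
  have hM2 : 2 ≤ M.card := by
    have := hMmax {s₀, p₀} (by
      rw [Finset.coe_pair]; exact Set.insert_subset (hS hs₀) (Set.singleton_subset_iff.2 (hR hp₀)))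
      (by simpa [isClique_insert] using fun _ => hsp₀)
    rwa [Finset.card_pair hsp₀.ne] at this
  have hcliqueK : ∀ L : Finset V, (L : Set V) ⊆ R → G.IsClique L → ∀ q ∈ L, (L : Set V) ⊆ K q := by
    intro L hL hLc q hq y hy
    by_cases h : q = y
    · exact h ▸ hself q (hL hq)
    · exact hadjK q (hL hq) y (hL hy) (hLc hq hy h) ▸ hself y (hL hy)
  obtain ⟨s', hs'Q, hs'⟩ : ∃ s' ∈ Q, s' ∈ S := by
    by_contra hno
    push Not at hno
    have hQR : (Q : Set V) ⊆ R := fun x hx => (hSR x (hQD hx)).resolve_left (hno x hx)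
    obtain ⟨r, hr, hsr⟩ : ∃ r ∈ Q, ¬ G.Adj s₀ r := by
      by_contra hall
      push Not at hall
      exact hnotbig Q hQD hQc hMQ s₀ (hS hs₀) (fun h => hno s₀ h hs₀) hall
    exact (hQ hr).2 (Or.inl (Or.inl ⟨hQR hr, hsr, Q, hcliqueK Q hQR hQc r hr, hQc, hMQ⟩))
  have hs'I := (hQ hs'Q).2
  obtain ⟨r, hrI, hs'r⟩ : ∃ r ∈ IR, G.Adj s' r := by
    by_contra hno
    push Not at hno
    exact hs'I (Or.inl (Or.inr ⟨hs', hno⟩))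
  obtain ⟨hrR, hs₀r, L, hLK, hLc, hLM⟩ := id hrI
  have hQe : ∀ q ∈ Q, q ≠ s' → q ∈ R ∧ G.Adj s' q := fun q hq hne =>
    ⟨(hSR q (hQD hq)).resolve_left fun h => hSst s' hs' q h (hQc hs'Q hq hne.symm),
      hQc hs'Q hq hne.symm⟩
  obtain ⟨q, hq, hqs'⟩ : ∃ q ∈ Q, q ≠ s' := by
    by_contra hno
    push Not at hno
    have : Q.card ≤ 1 := Finset.card_le_one.2 fun a ha b hb => (hno a ha).trans (hno b hb).symm
    omega
  have hQK : ∀ q' ∈ Q, q' ≠ s' → K q' = K q := by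
    intro q' hq' hne
    by_cases h : q = q'
    · rw [h]
    · exact hadjK q (hQe q hq hqs').1 q' (hQe q' hq' hne).1 (hQc hq hq' h)
  obtain ⟨hqR, hs'q⟩ := hQe q hq hqs'
  by_cases hKqr : K q = K r
  · exfalso
    refine hnotbig Q hQD hQc hMQ r (hR hrR) (fun h => (hQ h).2 (Or.inl (Or.inl hrI)))
      fun y hy => ?_
    by_cases hys : y = s'
    · exact hys ▸ hs'r.symm
    · obtain ⟨hyR, hs'y⟩ := hQe y hy hys
      have hyK : K y = K r := (hQK y hy hys).trans hKqr
      refine hC0 r hrR y hyR hyK.symm hs₀r ?_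
      by_contra hs₀y
      exact (hQ hy).2 (Or.inl (Or.inl ⟨hyR, hs₀y, L, hyK.symm ▸ hLK, hLc, hLM⟩))
  have hE' := hedge2 s' hs' q hqR r hrR hs'q hs'r hKqr
  have hC' := hcompl s' hs' q hqR r hrR hs'q hs'r hKqr
  obtain ⟨r', hr'L, hs'r'⟩ : ∃ r' ∈ L, ¬ G.Adj s' r' := by
    by_contra hall
    push Not at hall
    exact hnotbig L ((hLK.trans (hKR r hrR)).trans hR) hLc hLM s' (hS hs')
      (fun h => hdisj s' hs' (hKR r hrR (hLK h))) hall
  have hr'R := hKR r hrR (hLK hr'L)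
  have hr'K : K r' = K r := heq r hrR r' (hLK hr'L)
  have hrr' : G.Adj r' r := hC' r' hr'R r hrR hr'K hs'r' hs'r
  have hs₀r' : G.Adj s₀ r' := (hE0 r' hr'R r hrR hrr').resolve_right hs₀r
  have hfin : ∀ s ∈ S, ∀ y ∈ Q, y ≠ s' → G.Adj s r' → ¬ G.Adj s r → G.Adj s y →
      ∃ c, IsC5 G c ∧ ∀ i, c i ∈ D := by
    intro s hs y hy hys hsr' hsr hsy
    obtain ⟨hyR, hs'y⟩ := hQe y hy hys
    have hyK : K y ≠ K r := fun h => hKqr ((hQK y hy hys).symm.trans h)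
    refine hcons s (hS hs) r' (hR hr'R) r (hR hrR) s' (hS hs') y (hR hyR)
      (isC5_of hsr' hrr' hs'r.symm hs'y hsy.symm hsr (fun h => hs'r' h.symm) (fun h => ?_)
        (hSst s' hs' s hs) (fun h => ?_))
    · exact hyK (hadjK r hrR y hyR h)
    · exact hyK (hr'K ▸ (hadjK y hyR r' hr'R h).symm)
  by_cases hex : ∃ y ∈ Q, y ≠ s' ∧ G.Adj s₀ y
  · obtain ⟨y, hy, hys, hs₀y⟩ := hex
    exact hfin s₀ hs₀ y hy hys hs₀r' hs₀r hs₀y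
  push Not at hex
  have hQ2 : Q ⊆ {s', q} := by
    intro y hy
    by_contra hyn
    simp only [Finset.mem_insert, Finset.mem_singleton, not_or] at hyn
    exact (hE0 y (hQe y hy hyn.1).1 q hqR (hQc hy hq hyn.2)).elim (hex y hy hyn.1) (hex q hq hqs')
  have hM2' : M.card ≤ 2 := hMQ.trans ((Finset.card_le_card hQ2).trans Finset.card_le_two)
  have hqiso : ∀ y ∈ R, ¬ G.Adj q y := by
    intro y hy hqy
    refine (hQ hq).2 (Or.inl (Or.inl ⟨hqR, hex q hq hqs', {q, y}, ?_, ?_, ?_⟩))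
    · rw [Finset.coe_pair]
      exact Set.insert_subset (hself q hqR)
        (Set.singleton_subset_iff.2 (hadjK q hqR y hy hqy ▸ hself y hy))
    · simpa [isClique_insert] using fun _ => hqy
    · rwa [Finset.card_pair hqy.ne]
  obtain ⟨t, ht, hqt⟩ : ∃ t ∈ Sp, G.Adj q t := by
    by_contra hno
    push Not at hno
    exact (hQ hq).2 (Or.inr ⟨hqR, hqiso, hno⟩)
  have htr : ¬ G.Adj t r := ht.2 r hrI
  exact hfin t ht.1 q hq hqs'
    ((hedge t ht.1 q hqR r hrR r' hr'R hqt.symm hrr'.symm hKqr).resolve_left htr) htr hqt.symm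

theorem exists_isC5_nonneighbors [Finite V] (hP : ¬ ContainsInduced P2UnionP4 G)
    (hB : ¬ ContainsInduced BullGraph G) (hG : DivisionMinimal G) (v : V) :
    ∃ c, IsC5 G c ∧ ∀ i, ¬ G.Adj v (c i) := by
  obtain ⟨D, hDv, hD⟩ := exists_minImperfect (hG.not_perfectOn v)
  obtain ⟨a, ha, b, hb, hab⟩ : ∃ a ∈ D, ∃ b ∈ D, a ≠ b := by
    by_contra hno
    push Not at hno
    exact hD.1 ((ColorableOn.of_stable fun x hx y hy hxy =>
      hxy.ne (hno x hx y hy)).mono subset_rfl one_le_two |>.perfectOn_two D subset_rfl)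
  obtain ⟨u, hvu, x, hx, hux⟩ := exists_nonneighbor_of_connected hB hG hDv hD.relConn ha hb hab
  have hv : ∀ y ∈ D, ¬ G.Adj v y := fun y hy => (hDv hy).2
  set S : Set V := {y ∈ D | G.Adj u y} with hS
  set R : Set V := {y ∈ D | ¬ G.Adj u y} with hR
  have hSst : StableIn G S := by
    intro p hp q hq hpq
    obtain ⟨T, hT, hTS, hTc, hTcl⟩ := exists_component (r := G.Adj) (fun _ _ h => h.symm)
      (R := S) (X₀ := {q, p}) (by rintro z (rfl | rfl) <;> assumption)
      (relConn_pair (fun _ _ h => h.symm) hpq)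
    refine hD.not_homogeneous (hTS.trans (Set.sep_subset _ _)) (fun w hw hwT => ?_)
      (hT (Or.inr rfl)) (hT (Or.inl rfl)) hpq.ne fun h => hux (hTS (h hx)).2
    by_contra hmix
    push Not at hmix
    obtain ⟨⟨c, hc, hwc⟩, d, hd, hwd⟩ := hmix
    obtain ⟨e, he, f, hf, hwe, hwf, hef⟩ := hTc (fun z => G.Adj w z) ⟨d, hd, hwd⟩ ⟨c, hc, hwc⟩
    by_cases huw : G.Adj u w
    · exact hTcl w ⟨hw, huw⟩ hwT e he hwe.symm
    · exact bull_elim hB u e f v w (hTS he).2 (hTS hf).2 hef hvu.symm hwe.symm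
        (fun h => hv e (hTS he).1 h.symm) (fun h => hv f (hTS hf).1 h.symm) huw
        (fun h => hwf h.symm) (hv w hw)
  have hP4 : ∀ a ∈ R, ∀ b ∈ R, ∀ c ∈ R, ∀ d ∈ R, G.Adj a b → G.Adj b c → G.Adj c d →
      ¬ G.Adj a c → ¬ G.Adj b d → ¬ G.Adj a d → False := by
    intro a ha b hb c hc d hd h1 h2 h3 h4 h5 h6
    exact p2UnionP4_elim hP v u a b c d hvu h1 h2 h3 h4 h5 h6 (hv a ha.1) (hv b hb.1) (hv c hc.1)
      (hv d hd.1) ha.2 hb.2 hc.2 hd.2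
  have hpaw : ∀ s ∈ S, ∀ a ∈ R, ∀ b ∈ R, ∀ c ∈ R, G.Adj s a → G.Adj s b → G.Adj a b →
      G.Adj c a → ¬ G.Adj c b → ¬ G.Adj c s → False := by
    intro s hs a ha b hb c hc h1 h2 h3 h4 h5 h6
    exact bull_elim hB s a b u c h1 h2 h3 hs.2.symm h4.symm (fun h => ha.2 h.symm)
      (fun h => hb.2 h.symm) (fun h => h6 h.symm) (fun h => h5 h.symm) hc.2
  have hSR : ∀ x ∈ D, x ∈ S ∨ x ∈ R := fun x hx => by
    by_cases h : G.Adj u x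
    exacts [Or.inl ⟨hx, h⟩, Or.inr ⟨hx, h⟩]
  by_cases hRc : RelConn G.Adj R
  · exact (false_of_connected_part hB hD (Set.sep_subset _ _) (Set.sep_subset _ _) hSR hSst
      ⟨x, hx, hux⟩ hP4 hpaw hRc).elim
  · obtain ⟨c, hc, hcD⟩ := exists_isC5_of_disconnected_part hD (Set.sep_subset _ _)
      (Set.sep_subset _ _) hSR hSst (fun x h h' => h'.2 h.2) hP4
      (fun s hs r hr a ha b hb h1 h2 h3 h4 h5 h6 => p2UnionP4_elim hP a b v u s r h2 hvu hs.2 h1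
        (hv s hs.1) hr.2 (hv r hr.1) (fun h => hv a ha.1 h.symm) (fun h => ha.2 h.symm)
        (fun h => h3 h.symm) (fun h => h5 h.symm) (fun h => hv b hb.1 h.symm)
        (fun h => hb.2 h.symm) (fun h => h4 h.symm) (fun h => h6 h.symm)) hpaw hRc
    exact ⟨c, hc, fun i => hv _ (hcD i)⟩

end DisconnectedPart

section FiveCycle

variable {V : Type*} {G : SimpleGraph V} {c : Fin 5 → V} {u v : V}

theorem IsC5.rotate (hc : IsC5 G c) (k : Fin 5) : IsC5 G fun i => c (i + k) := by
  intro i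
  have h1 : i + 1 + k = i + k + 1 := add_right_comm i 1 k
  have h2 : i + 2 + k = i + k + 2 := add_right_comm i 2 k
  simpa only [h1, h2] using hc (i + k)

theorem IsC5.reflect (hc : IsC5 G c) : IsC5 G fun i => c (-i) := by
  intro i
  have h1 : ∀ i : Fin 5, -i = -(i + 1) + 1 := by decide
  have h2 : ∀ i : Fin 5, -i = -(i + 2) + 2 := by decide
  constructor
  · have := (hc (-(i + 1))).1
    rw [← h1] at this
    exact this.symm
  · have := (hc (-(i + 2))).2
    rw [← h2] at this
    exact fun h => this h.symm

theorem IsC5.adj_iff (hc : IsC5 G c) (i j : Fin 5) : G.Adj (c i) (c j) ↔ j = i + 1 ∨ i = j + 1 := by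
  have key : ∀ i j : Fin 5, j = i ∨ j = i + 1 ∨ i = j + 1 ∨ j = i + 2 ∨ i = j + 2 := by decide
  have hne : ∀ i : Fin 5, ¬ (i = i + 1) ∧ i + 2 ≠ i + 1 ∧ i ≠ i + 2 + 1 := by decide
  rcases key i j with rfl | rfl | rfl | rfl | rfl
  · simp
  · simp [(hc i).1]
  · simp [(hc j).1.symm]
  · have h := hne i
    simp [(hc i).2, h.2.2]
  · have h := hne j
    have h' : ¬ G.Adj (c (j + 2)) (c j) := fun h => (hc j).2 h.symm
    simp [h', h.2.2]

/-- A neighbour of a vertex anticomplete to an induced 5-cycle is complete to the cycle, or sees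
exactly the two neighbours of one of its vertices. -/
theorem IsC5.complete_or_exists (hc : IsC5 G c) (hP : ¬ ContainsInduced P2UnionP4 G)
    (hB : ¬ ContainsInduced BullGraph G) (huv : G.Adj v u) (hv : ∀ i, ¬ G.Adj v (c i)) :
    (∀ i, G.Adj u (c i)) ∨ ∃ i, ∀ j, G.Adj u (c j) ↔ j = i + 1 ∨ j = i + 4 := by
  classical
  have h1 : ∀ i, G.Adj u (c i) → G.Adj u (c (i + 1)) → G.Adj u (c (i + 2)) := by
    intro i hi hi1
    by_contra h
    refine bull_elim hB u (c (i + 1)) (c i) v (c (i + 2)) hi1 hi (hc i).1.symm huv.symm ?_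
      (fun h => hv _ h.symm) (fun h => hv _ h.symm) h (hc i).2 (hv _)
    have := (hc (i + 1)).1
    rwa [add_assoc] at this
  have h2 : ∀ i, G.Adj u (c (i + 1)) ∨ G.Adj u (c (i + 2)) ∨ G.Adj u (c (i + 3)) ∨
      G.Adj u (c (i + 4)) := by
    intro i
    by_contra h
    push Not at h
    obtain ⟨n1, n2, n3, n4⟩ := h
    have hij : ∀ i : Fin 5, (i + 2 = i + 1 + 1) ∧ (i + 3 = i + 2 + 1) ∧ (i + 4 = i + 3 + 1) ∧
      ¬ (i + 3 = i + 1 + 1 ∨ i + 1 = i + 3 + 1) ∧ ¬ (i + 4 = i + 2 + 1 ∨ i + 2 = i + 4 + 1) ∧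
      ¬ (i + 4 = i + 1 + 1 ∨ i + 1 = i + 4 + 1) := by decide
    obtain ⟨a1, a2, a3, b1, b2, b3⟩ := hij i
    refine p2UnionP4_elim hP v u (c (i + 1)) (c (i + 2)) (c (i + 3)) (c (i + 4)) huv
      ?_ ?_ ?_ ?_ ?_ ?_ (hv _) (hv _) (hv _) (hv _) n1 n2 n3 n4 <;> rw [hc.adj_iff]
    exacts [Or.inl a1, Or.inl a2, Or.inl a3, b1, b2, b3]
  have key : ∀ f : Fin 5 → Bool, (∀ i, f i → f (i + 1) → f (i + 2)) →
      (∀ i, f (i + 1) ∨ f (i + 2) ∨ f (i + 3) ∨ f (i + 4)) →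
      (∀ i, f i) ∨ ∃ i, ∀ j, f j ↔ j = i + 1 ∨ j = i + 4 := by decide
  simpa using key (fun i => decide (G.Adj u (c i))) (by simpa using h1) (by simpa using h2)

end FiveCycle

section Centre

variable {V : Type*} {G : SimpleGraph V} {c : Fin 5 → V} {u v x y : V} {W : Set V}

theorem IsC5.relConn_range (hc : IsC5 G c) : RelConn G.Adj (Set.range c) := by
  classical
  rintro p ⟨_, ⟨i, rfl⟩, hi⟩ ⟨_, ⟨j, rfl⟩, hj⟩
  have key : ∀ f : Fin 5 → Bool, ∀ i j, f i → ¬ f j → ∃ k, f k ∧ ¬ f (k + 1) := by decide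
  obtain ⟨k, h1, h2⟩ := key (fun k => decide (p (c k))) i j (by simpa using hi) (by simpa using hj)
  exact ⟨_, ⟨k, rfl⟩, _, ⟨k + 1, rfl⟩, by simpa using h1, by simpa using h2, (hc k).1⟩

theorem IsC5.ne (hc : IsC5 G c) {i j : Fin 5} (h : i ≠ j) : c i ≠ c j := by
  intro e
  have key : ∀ i j : Fin 5, i ≠ j → ∃ k, (k = i + 1 ∨ i = k + 1) ∧ ¬ (k = j + 1 ∨ j = k + 1) := by
    decide
  obtain ⟨k, h1, h2⟩ := key i j h
  rw [← hc.adj_iff] at h1 h2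
  exact h2 (e ▸ h1)

theorem IsC5.relConn_compl_range (hc : IsC5 G c) : RelConn Gᶜ.Adj (Set.range c) := by
  classical
  rintro p ⟨_, ⟨i, rfl⟩, hi⟩ ⟨_, ⟨j, rfl⟩, hj⟩
  have key : ∀ f : Fin 5 → Bool, ∀ i j, f i → ¬ f j → ∃ k, f k ∧ ¬ f (k + 2) := by decide
  obtain ⟨k, h1, h2⟩ := key (fun k => decide (p (c k))) i j (by simpa using hi) (by simpa using hj)
  refine ⟨_, ⟨k, rfl⟩, _, ⟨k + 2, rfl⟩, by simpa using h1, by simpa using h2, ?_⟩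
  rw [compl_adj]
  exact ⟨hc.ne (by simp), (hc k).2⟩

/-- A vertex complete to an induced 5-cycle sees every vertex that has exactly two
neighbours on the cycle, these being at distance two. -/
theorem IsC5.adj_of_complete (hc : IsC5 G c) (hB : ¬ ContainsInduced BullGraph G)
    (hy : ∀ i, G.Adj y (c i)) {i : Fin 5} (hu : ∀ j, G.Adj u (c j) ↔ j = i + 1 ∨ j = i + 4) :
    G.Adj u y := by
  by_contra h
  have key : ∀ i : Fin 5, (i = i + 1 + 1 ∨ i + 1 = i + 1) ∧
      ¬ (i + 3 = i + 1 + 1 ∨ i + 1 = i + 3 + 1) ∧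
    ¬ (i + 3 = i + 1 ∨ i = i + 3 + 1) ∧ ¬ (i + 3 = i + 1 ∨ i + 3 = i + 4) ∧
    ¬ (i = i + 1 ∨ i = i + 4) := by decide
  obtain ⟨k1, k2, k3, k4, k5⟩ := key i
  exact bull_elim hB y (c (i + 1)) (c i) (c (i + 3)) u (hy _) (hy _) ((hc.adj_iff _ _).2 k1) (hy _)
    ((hu _).2 (Or.inl rfl)).symm (fun h => k2 ((hc.adj_iff _ _).1 h))
    (fun h => k3 ((hc.adj_iff _ _).1 h)) (fun h' => h h'.symm)
    (fun h => k5 ((hu _).1 h.symm)) (fun h => k4 ((hu _).1 h.symm))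

theorem anticomplete_of_centre [Finite V] (hP : ¬ ContainsInduced P2UnionP4 G)
    (hB : ¬ ContainsInduced BullGraph G) (hc : IsC5 G c) (huv : G.Adj v u)
    (hv : ∀ i, ¬ G.Adj v (c i)) (hu : ∀ j, G.Adj u (c j) ↔ j = 1 ∨ j = 4)
    (hxy : ¬ G.Adj x y) (hx : ∃ i, ¬ G.Adj x (c i)) (hWy : ∀ w ∈ W, G.Adj y w)
    (hWc : RelConn Gᶜ.Adj W) (hcW : ∀ i, c i ∈ W) (huW : u ∈ W) (hvW : v ∈ W) :
    ∀ w ∈ W, ¬ G.Adj x w := by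
  have hsymm : ∀ a b, Gᶜ.Adj a b → Gᶜ.Adj b a := fun _ _ h => h.symm
  have trick : ∀ a b e, a ∈ W → b ∈ W → e ∈ W → ¬ G.Adj a b → ¬ G.Adj x a → ¬ G.Adj x b →
      ¬ G.Adj e a → G.Adj e b → ¬ G.Adj x e := fun a b e ha hb he hab hxa hxb hea heb hxe =>
    bull_elim hB y e b a x (hWy e he) (hWy b hb) heb (hWy a ha) hxe.symm hea
      (fun h => hab h.symm) (fun h => hxy h.symm) (fun h => hxb h.symm) fun h => hxa h.symm
  have hyc : ∀ i, G.Adj y (c i) := fun i => hWy _ (hcW i)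
  have hxc : ∀ i, ¬ G.Adj x (c i) := by
    by_contra hno
    push Not at hno
    obtain ⟨i, hi⟩ := hno
    obtain ⟨j, hj⟩ := hx
    by_cases hxv : G.Adj v x
    · obtain h | ⟨i, h⟩ := hc.complete_or_exists hP hB hxv hv
      · exact hj (h j)
      · exact hxy (hc.adj_of_complete hB hyc h)
    · obtain ⟨_, ⟨k, rfl⟩, _, ⟨l, rfl⟩, hk, hl, hkl⟩ := hc.relConn_range (fun z => G.Adj x z)
        ⟨_, ⟨i, rfl⟩, hi⟩ ⟨_, ⟨j, rfl⟩, hj⟩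
      exact trick v (c l) (c k) hvW (hcW l) (hcW k) (hv l) (fun h => hxv h.symm) hl
        (fun h => hv k h.symm) hkl hk
  have n31 : ¬ G.Adj (c 3) (c 1) := fun h => (hc 1).2 h.symm
  have hu3 : ¬ G.Adj u (c 3) := by rw [hu]; decide
  have hu2 : ¬ G.Adj u (c 2) := by rw [hu]; decide
  have hu0 : ¬ G.Adj u (c 0) := by rw [hu]; decide
  have hu1 : G.Adj u (c 1) := by rw [hu]; decide
  have hxu : ¬ G.Adj x u :=
    trick (c 3) (c 1) u (hcW 3) (hcW 1) huW n31 (hxc 3) (hxc 1) hu3 hu1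
  have hxv : ¬ G.Adj x v :=
    trick (c 3) u v (hcW 3) huW hvW (fun h => hu3 h.symm) (hxc 3) hxu (hv 3) huv
  have hJ0 : RelConn Gᶜ.Adj (insert u (insert v (Set.range c))) := by
    refine RelConn.insert (a := c 0) (.insert (a := c 0) hc.relConn_compl_range hsymm ⟨0, rfl⟩ ?_)
      hsymm (Or.inr ⟨0, rfl⟩) ?_
    · rw [compl_adj]
      exact ⟨fun e => hv 1 (e ▸ (hc 0).1), fun h => hv 0 h.symm⟩
    · rw [compl_adj]
      exact ⟨fun e => hv 0 (e ▸ huv), fun h => hu0 h.symm⟩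
  obtain ⟨J, hJ, ⟨hJc, hJW⟩, hJmax⟩ := exists_maximal_superset
    (fun J => RelConn Gᶜ.Adj J ∧ ∀ z ∈ J, z ∈ W ∧ ¬ G.Adj x z) ⟨hJ0, by
      rintro z (rfl | rfl | ⟨i, rfl⟩)
      exacts [⟨huW, hxu⟩, ⟨hvW, hxv⟩, ⟨hcW i, hxc i⟩]⟩
  have hcJ : ∀ i, c i ∈ J := fun i => hJ (Or.inr (Or.inr ⟨i, rfl⟩))
  intro w₀ hw₀ hxw₀
  obtain ⟨j, -, w, hw, hjJ, hwJ, hjw⟩ := hWc (· ∈ J) ⟨_, hcW 0, hcJ 0⟩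
    ⟨w₀, hw₀, fun h => (hJW _ h).2 hxw₀⟩
  have hxw : G.Adj x w := by
    by_contra h
    refine hJmax w hwJ ⟨hJc.insert hsymm hjJ hjw, ?_⟩
    rintro z (rfl | hz)
    exacts [⟨hw, h⟩, hJW z hz]
  have hwJ' : ∀ z ∈ J, ¬ G.Adj w z := by
    intro z hz hwz
    obtain ⟨b, hb, a, ha, hwb, hwa, hba⟩ := hJc (fun z => G.Adj w z) ⟨z, hz, hwz⟩
      ⟨j, hjJ, fun h => ((compl_adj _ _ _).1 hjw).2 h.symm⟩
    exact trick a b w (hJW a ha).1 (hJW b hb).1 hw (fun h => ((compl_adj _ _ _).1 hba).2 h.symm)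
      (hJW a ha).2 (hJW b hb).2 hwa hwb hxw
  exact p2UnionP4_elim hP x w v u (c 1) (c 2) hxw huv hu1 (hc 1).1 (hv 1) hu2 (hv 2) hxv hxu
    (hxc 1) (hxc 2) (hwJ' v (hJ (Or.inr (Or.inl rfl)))) (hwJ' u (hJ (Or.inl rfl)))
    (hwJ' _ (hcJ 1)) (hwJ' _ (hcJ 2))

theorem exists_not_adj_of_isC5 [Finite V] (hP : ¬ ContainsInduced P2UnionP4 G)
    (hB : ¬ ContainsInduced BullGraph G) (hG : DivisionMinimal G) (hc : IsC5 G c)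
    (hv : ∀ i, ¬ G.Adj v (c i)) (y : V) : ∃ i, ¬ G.Adj y (c i) := by
  by_contra hy
  push Not at hy
  have hsymm : ∀ a b, Gᶜ.Adj a b → Gᶜ.Adj b a := fun _ _ h => h.symm
  obtain ⟨u, huv, _, ⟨k, rfl⟩, huk⟩ := exists_nonneighbor_of_connected (v := v) hB hG
    (X := Set.range c) (by
      rintro _ ⟨i, rfl⟩
      exact ⟨fun e => hv (i + 1) (e ▸ (hc i).1), hv i⟩) hc.relConn_range ⟨0, rfl⟩ ⟨1, rfl⟩
    (hc 0).1.ne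
  obtain h | ⟨i, hui⟩ := hc.complete_or_exists hP hB huv hv
  · exact huk (h k)
  have key : ∀ i j : Fin 5, (j + i = i + 1 ∨ j + i = i + 4) ↔ j = 1 ∨ j = 4 := by decide
  have hsur : ∀ j : Fin 5, ∃ k, k + i = j := fun j => ⟨j - i, sub_add_cancel j i⟩
  have hc' := hc.rotate i
  have hu : ∀ j, G.Adj u (c (j + i)) ↔ j = 1 ∨ j = 4 := fun j => by rw [hui, key]
  have hv' : ∀ j, ¬ G.Adj v (c (j + i)) := fun j => hv _
  have hy' : ∀ j, G.Adj y (c (j + i)) := fun j => hy _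
  generalize hd : (fun j => c (j + i)) = d at hc'
  have hdd : ∀ j, c (j + i) = d j := fun j => congrFun hd j
  simp only [hdd] at hu hv' hy'
  clear hui hv hy huk hdd hd hsur key hc
  have huy : ∀ z, (∀ i, G.Adj z (d i)) → G.Adj z u := fun z hz =>
    (hc'.adj_of_complete (i := 0) hB hz (by simpa using hu)).symm
  have hvy : ∀ z, (∀ i, G.Adj z (d i)) → G.Adj z v := by
    intro z hz
    by_contra h
    have hu1 : G.Adj u (d 1) := by rw [hu]; decide
    have hu3 : ¬ G.Adj u (d 3) := by rw [hu]; decide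
    exact bull_elim hB z u (d 1) (d 3) v (huy z hz) (hz 1) hu1 (hz 3) huv.symm hu3 (hc' 1).2 h
      (fun h => hv' 1 h.symm) (fun h => hv' 3 h.symm)
  have hJ0 : RelConn Gᶜ.Adj (insert u (insert v (Set.range d))) := by
    refine RelConn.insert (a := d 0) (.insert (a := d 0) hc'.relConn_compl_range hsymm ⟨0, rfl⟩ ?_)
      hsymm (Or.inr ⟨0, rfl⟩) ?_
    · rw [compl_adj]
      exact ⟨fun e => hv' 1 (e ▸ (hc' 0).1), fun h => hv' 0 h.symm⟩
    · rw [compl_adj]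
      refine ⟨fun e => hv' 0 (e ▸ huv), fun h => ?_⟩
      have := (hu 0).1 h.symm
      revert this
      decide
  obtain ⟨Y, hyY, ⟨hYc, hYy⟩, hYmax⟩ := exists_maximal_superset
    (fun Y => RelConn Gᶜ.Adj Y ∧ ∀ z ∈ Y, ∀ i, G.Adj z (d i)) (X₀ := {y})
    ⟨relConn_singleton y, by rintro _ rfl; exact hy'⟩
  have hyY : y ∈ Y := hyY rfl
  obtain ⟨X, hX, ⟨hXc, hXY⟩, hXmax⟩ := exists_maximal_superset
    (fun X => RelConn Gᶜ.Adj X ∧ ∀ z ∈ Y, ∀ x ∈ X, G.Adj z x) ⟨hJ0, by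
      rintro z hz x (rfl | rfl | ⟨i, rfl⟩)
      exacts [huy z (hYy z hz), hvy z (hYy z hz), hYy z hz i]⟩
  have hdX : ∀ i, d i ∈ X := fun i => hX (Or.inr (Or.inr ⟨i, rfl⟩))
  refine (hc' 0).1.ne (hG.eq_of_homogeneous X (fun w _ hwX => ?_) ?_ _ (hdX 0) _ (hdX 1))
  · by_contra hmix
    push Not at hmix
    obtain ⟨⟨p, hp, hwp⟩, q, hq, hwq⟩ := hmix
    obtain ⟨z, hz, hzw⟩ : ∃ z ∈ Y, ¬ G.Adj z w := by
      by_contra hall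
      push Not at hall
      refine hXmax w hwX ⟨hXc.insert hsymm hp ?_, ?_⟩
      · rw [compl_adj]
        exact ⟨fun e => hwX (e ▸ hp), fun h => hwp h.symm⟩
      · rintro z hz x (rfl | hx)
        exacts [hall z hz, hXY z hz x hx]
    by_cases hwY : ∀ i, G.Adj w (d i)
    · by_cases hw : w ∈ Y
      · exact hwp (hXY w hw p hp)
      refine hYmax w hw ⟨hYc.insert hsymm hz ?_, ?_⟩
      · rw [compl_adj]
        exact ⟨fun e => hw (e ▸ hz), hzw⟩
      · rintro x (rfl | hx)
        exacts [hwY, hYy x hx]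
    · push Not at hwY
      exact anticomplete_of_centre hP hB hc' huv hv' hu (fun h => hzw h.symm) hwY (hXY z hz) hXc hdX
        (hX (Or.inl rfl)) (hX (Or.inr (Or.inl rfl))) q hq hwq
  · intro e
    exact G.loopless.irrefl y (hXY y hyY y (e ▸ trivial))

end Centre

section TriangleFree

variable {V : Type*} {G : SimpleGraph V} {c : Fin 5 → V} {u u' v a b y : V} {i j : Fin 5}

theorem false_of_types (hB : ¬ ContainsInduced BullGraph G) (hc : IsC5 G c)
    (hv : ∀ i, ¬ G.Adj v (c i)) (hvu : G.Adj v u) (hvu' : G.Adj v u') (huu' : G.Adj u u')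
    (hu : ∀ k, G.Adj u (c k) ↔ k = i + 1 ∨ k = i + 4)
    (hu' : ∀ k, G.Adj u' (c k) ↔ k = j + 1 ∨ k = j + 4) (hij : j = i + 1 ∨ j = i + 2) : False := by
  rcases hij with rfl | rfl
  · refine bull_elim hB u u' v (c (i + 4)) (c (i + 2)) huu' hvu.symm hvu'.symm ?_ ?_ ?_ (hv _) ?_
      (hv _) ?_
    all_goals first | rw [hu] | rw [hu'] | rw [hc.adj_iff]
    all_goals clear hu hu'; revert i; decide
  · refine bull_elim hB u (c (i + 1)) u' (c (i + 4)) (c (i + 2)) ?_ huu' ?_ ?_ ?_ ?_ ?_ ?_ ?_ ?_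
    all_goals first | rw [hu] | rw [hu'] | rw [adj_comm, hu'] | rw [hc.adj_iff]
    all_goals clear hu hu'; revert i; decide

theorem type_eq_of_adj (hB : ¬ ContainsInduced BullGraph G) (hc : IsC5 G c)
    (hv : ∀ i, ¬ G.Adj v (c i)) (hvu : G.Adj v u) (hvu' : G.Adj v u') (huu' : G.Adj u u')
    (hu : ∀ k, G.Adj u (c k) ↔ k = i + 1 ∨ k = i + 4)
    (hu' : ∀ k, G.Adj u' (c k) ↔ k = j + 1 ∨ k = j + 4) : i = j := by
  have key : ∀ i j : Fin 5, i = j ∨ (j = i + 1 ∨ j = i + 2) ∨ i = j + 1 ∨ i = j + 2 := by decide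
  rcases key i j with h | h | h
  · exact h
  · exact (false_of_types hB hc hv hvu hvu' huu' hu hu' h).elim
  · exact (false_of_types hB hc hv hvu' hvu huu'.symm hu' hu h).elim

theorem not_adj_of_adj_nonneighbor (hP : ¬ ContainsInduced P2UnionP4 G)
    (hB : ¬ ContainsInduced BullGraph G) (hc : IsC5 G c)
    (hv : ∀ i, ¬ G.Adj v (c i)) (ha : G.Adj v a) (hb : G.Adj v b)
    (ha' : ∀ k, G.Adj a (c k) ↔ k = 1 ∨ k = 4) (hb' : ∀ k, G.Adj b (c k) ↔ k = 1 ∨ k = 4)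
    (hvy : ¬ G.Adj v y) (hya : G.Adj y a) (hyb : ¬ G.Adj y b) : ¬ G.Adj y (c 4) := by
  intro h4
  have trick : ∀ p q r, G.Adj a p → G.Adj a q → G.Adj p q → ¬ G.Adj v p → ¬ G.Adj v q →
      ¬ G.Adj a r → ¬ G.Adj v r → G.Adj r p → G.Adj r q := by
    intro p q r hap haq hpq hvp hvq har hvr hrp
    by_contra hrq
    exact bull_elim hB a p q v r hap haq hpq ha.symm hrp.symm (fun h => hvp h.symm)
      (fun h => hvq h.symm) har (fun h => hrq h.symm) hvr
  have h := fun k => (ha' k).2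
  have h' : ∀ k, ¬ (k = 1 ∨ k = 4) → ¬ G.Adj a (c k) := fun k hk e => hk ((ha' k).1 e)
  have h'' : ∀ k, ¬ (k = 1 ∨ k = 4) → ¬ G.Adj b (c k) := fun k hk e => hk ((hb' k).1 e)
  have a1 : G.Adj a (c 1) := h 1 (by decide)
  have a4 : G.Adj a (c 4) := h 4 (by decide)
  have a0 : ¬ G.Adj a (c 0) := h' 0 (by decide)
  have a2 : ¬ G.Adj a (c 2) := h' 2 (by decide)
  have a3 : ¬ G.Adj a (c 3) := h' 3 (by decide)
  have h3 : G.Adj y (c 3) :=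
    (trick (c 4) y (c 3) a4 hya.symm h4.symm (hv 4) hvy a3 (hv 3) (hc 3).1).symm
  have h0 : G.Adj y (c 0) :=
    (trick (c 4) y (c 0) a4 hya.symm h4.symm (hv 4) hvy a0 (hv 0) (hc 4).1.symm).symm
  have h2 : ¬ G.Adj y (c 2) := fun h2 =>
    (hc 2).2 (trick y (c 4) (c 2) hya.symm a4 h4 hvy (hv 4) a2 (hv 2) h2.symm)
  exact p2UnionP4_elim hP v b (c 2) (c 3) y (c 0) hb (hc 2).1 h3.symm h0 (fun h => h2 h.symm)
    (hc 3).2 (fun h => (hc 0).2 h.symm) (hv 2) (hv 3) hvy (hv 0) (h'' 2 (by decide))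
    (h'' 3 (by decide)) (fun h => hyb h.symm) (h'' 0 (by decide))

theorem not_adj_of_isC5_nonneighbors [Finite V] (hP : ¬ ContainsInduced P2UnionP4 G)
    (hB : ¬ ContainsInduced BullGraph G) (hG : DivisionMinimal G) (hc : IsC5 G c)
    (hv : ∀ i, ¬ G.Adj v (c i)) (ha : G.Adj v a) (hb : G.Adj v b) : ¬ G.Adj a b := by
  intro hab
  have htype : ∀ d, IsC5 G d → (∀ i, ¬ G.Adj v (d i)) → ∀ u, G.Adj v u →
      ∃ i, ∀ j, G.Adj u (d j) ↔ j = i + 1 ∨ j = i + 4 := by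
    intro d hd hvd u hu
    obtain ⟨k, hk⟩ := exists_not_adj_of_isC5 hP hB hG hd hvd u
    exact (hd.complete_or_exists hP hB hu hvd).resolve_left fun h => hk (h k)
  obtain ⟨i, hi⟩ := htype c hc hv a ha
  obtain ⟨d, hd, hvd, had⟩ : ∃ d, IsC5 G d ∧ (∀ i, ¬ G.Adj v (d i)) ∧
      ∀ j, G.Adj a (d j) ↔ j = 1 ∨ j = 4 := by
    refine ⟨_, hc.rotate i, fun j => hv _, fun j => ?_⟩
    have key : ∀ i j : Fin 5, (j + i = i + 1 ∨ j + i = i + 4) ↔ j = 1 ∨ j = 4 := by decide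
    rw [hi, key]
  obtain ⟨T, hT, ⟨hTc, hTv⟩, hTmax⟩ := exists_maximal_superset
    (fun T => RelConn G.Adj T ∧ ∀ x ∈ T, G.Adj v x) ⟨relConn_pair (fun _ _ h => h.symm) hab, by
      rintro x (rfl | rfl)
      exacts [hb, ha]⟩
  have hT0 : ∀ x ∈ T, ∀ j, G.Adj x (d j) ↔ j = 1 ∨ j = 4 := by
    by_contra hno
    push Not at hno
    obtain ⟨x, hx, hx'⟩ := hno
    obtain ⟨p, hp, q, hq, hpd, hqd, hpq⟩ := hTc
      (fun x => ∀ j, G.Adj x (d j) ↔ j = 1 ∨ j = 4) ⟨a, hT (Or.inr rfl), had⟩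
      ⟨x, hx, fun h => by obtain ⟨j, hj⟩ := hx'; have := h j; tauto⟩
    obtain ⟨k, hk⟩ := htype d hd hvd q (hTv q hq)
    obtain rfl : 0 = k := type_eq_of_adj hB hd hvd (hTv p hp) (hTv q hq) hpq (by simpa using hpd) hk
    exact hqd (by simpa using hk)
  refine hab.ne (hG.eq_of_homogeneous T (fun y _ hy => ?_) ?_
    _ (hT (Or.inr rfl)) _ (hT (Or.inl rfl)))
  · by_contra hmix
    push Not at hmix
    obtain ⟨⟨p, hp, hyp⟩, q, hq, hyq⟩ := hmix
    have hvy : ¬ G.Adj v y := by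
      intro hvy
      refine hTmax y hy ⟨hTc.insert (fun _ _ h => h.symm) hq hyq.symm, ?_⟩
      rintro x (rfl | hx)
      exacts [hvy, hTv x hx]
    obtain ⟨s, hs, t, ht, hys, hyt, hst⟩ := hTc (fun x => G.Adj y x) ⟨q, hq, hyq⟩ ⟨p, hp, hyp⟩
    have hy4 := not_adj_of_adj_nonneighbor hP hB hd hvd (hTv s hs) (hTv t ht) (hT0 s hs) (hT0 t ht)
      hvy hys hyt
    have hneg : ∀ x ∈ T, ∀ j, G.Adj x (d (-j)) ↔ j = 1 ∨ j = 4 := by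
      intro x hx j
      rw [hT0 x hx]
      revert j
      decide
    have hy1 : ¬ G.Adj y (d 1) := not_adj_of_adj_nonneighbor hP hB hd.reflect (fun _ => hvd _)
      (hTv s hs) (hTv t ht) (hneg s hs) (hneg t ht) hvy hys hyt
    have step : ∀ k l, (k = 1 ∨ k = 4) → ¬ (l = 1 ∨ l = 4) → G.Adj (d k) (d l) → G.Adj y (d l) := by
      intro k l hk hl hkl
      by_contra hyl
      refine bull_elim hB s (d k) t y (d l) ((hT0 s hs k).2 hk) hst
        ((hT0 t ht k).2 hk).symm hys.symm
        hkl ?_ (fun h => hyt h.symm) (fun h => hl ((hT0 s hs l).1 h))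
        (fun h => hl ((hT0 t ht l).1 h)) hyl
      rcases hk with rfl | rfl
      exacts [fun h => hy1 h.symm, fun h => hy4 h.symm]
    have hy2 := step 1 2 (by decide) (by decide) (hd 1).1
    have hy3 := step 4 3 (by decide) (by decide) (hd 3).1.symm
    exact bull_elim hB (d 2) (d 3) y (d 1) (d 4) (hd 2).1 hy2.symm hy3.symm (hd 1).1.symm (hd 3).1
      (fun h => (hd 1).2 h.symm) hy1 (hd 2).2 hy4 fun h => (hd 4).2 h.symm
  · intro e
    exact G.loopless.irrefl v (hTv v (e ▸ trivial))

theorem triangle_free_of_divisionMinimal [Finite V] (hP : ¬ ContainsInduced P2UnionP4 G)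
    (hB : ¬ ContainsInduced BullGraph G) (hG : DivisionMinimal G) (x y z : V)
    (hxy : G.Adj x y) (hyz : G.Adj y z) (hxz : G.Adj x z) : False := by
  obtain ⟨c, hc, hv⟩ := exists_isC5_nonneighbors hP hB hG x
  exact not_adj_of_isC5_nonneighbors hP hB hG hc hv hxy hxz hyz

end TriangleFree

section Labels

variable {V : Type*} {G : SimpleGraph V} {c : Fin 5 → V} {x x' y z z' p p' q : V}

/-- The ways in which a vertex of a triangle-free graph can attach to an induced 5-cycle: to no
vertex, to the `i`-th vertex, or to the two neighbours of the `i`-th vertex. -/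
inductive CycleLabel
  | zero
  | one (i : Fin 5)
  | two (i : Fin 5)
deriving DecidableEq, Fintype

namespace CycleLabel

/-- The positions on the 5-cycle seen by a vertex with the given label. -/
def sees : CycleLabel → Fin 5 → Bool
  | zero, _ => false
  | one i, j => j = i
  | two i, j => j = i + 1 || j = i + 4

/-- Labels whose vertices are never adjacent in a triangle-free `P2 ∪ P4`-free graph. -/
def apart : CycleLabel → CycleLabel → Bool
  | zero, zero => true
  | zero, one _ => true
  | one _, zero => true
  | a, b => decide (∃ j, a.sees j ∧ b.sees j)

/-- The label with respect to the 5-cycle traversed backwards from position `k`. -/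
def mirror (k : Fin 5) : CycleLabel → CycleLabel
  | zero => zero
  | one i => one (k - i)
  | two i => two (k - i)

end CycleLabel

open CycleLabel

/-- `x` attaches to the 5-cycle `c` in the way prescribed by the label. -/
abbrev HasLabel (G : SimpleGraph V) (c : Fin 5 → V) (l : CycleLabel) (x : V) : Prop :=
  ∀ j, G.Adj x (c j) ↔ l.sees j = true

/-- `z` has a neighbour that sees the two neighbours of the `i`-th vertex of the 5-cycle `c`. -/
def Reaches (G : SimpleGraph V) (c : Fin 5 → V) (z : V) (i : Fin 5) : Prop :=
  ∃ p, HasLabel G c (two i) p ∧ G.Adj z p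

theorem IsC5.mirror (hc : IsC5 G c) (k : Fin 5) : IsC5 G fun j => c (k - j) := by
  have := hc.reflect.rotate (-k)
  simpa only [neg_add, neg_neg, neg_add_eq_sub] using this

theorem HasLabel.mirror {l : CycleLabel} (h : HasLabel G c l x) (k : Fin 5) :
    HasLabel G (fun j => c (k - j)) (l.mirror k) x := by
  intro j
  rw [h]
  cases l <;> clear h <;> decide +revert

theorem Reaches.rotate {i k : Fin 5} :
    Reaches G (fun j => c (j + k)) z i ↔ Reaches G c z (i + k) := by
  have key : ∀ i k j : Fin 5, (two (i + k)).sees (j + k) = (two i).sees j := by decide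
  refine exists_congr fun p => and_congr_left fun _ => ⟨fun h j => ?_, fun h j => ?_⟩
  · rw [← sub_add_cancel j k, h, key]
  · rw [h, key]

/-- The consequences of minimality and of the forbidden induced subgraphs that make all vertices
attach to induced 5-cycles in a controlled way. -/
structure TriangleFreeMinimal (G : SimpleGraph V) : Prop where
  p2UnionP4 : ¬ ContainsInduced P2UnionP4 G
  bull : ¬ ContainsInduced BullGraph G
  grotzsch : ¬ ContainsInduced GrotzschGraph G
  triangle : ∀ a b c, G.Adj a b → G.Adj b c → G.Adj a c → False
  minimal : DivisionMinimal G

namespace TriangleFreeMinimal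

variable (H : TriangleFreeMinimal G) (hc : IsC5 G c)
include H

theorem isC5 {a b c d e : V} (hab : G.Adj a b) (hbc : G.Adj b c) (hcd : G.Adj c d)
    (hde : G.Adj d e) (hea : G.Adj e a) : IsC5 G ![a, b, c, d, e] :=
  isC5_of hab hbc hcd hde hea (H.triangle _ _ _ hab hbc) (H.triangle _ _ _ hbc hcd)
    (H.triangle _ _ _ hcd hde) (H.triangle _ _ _ hde hea) (H.triangle _ _ _ hea hab)

theorem not_adj_of_common (m : V) (hx : G.Adj m x) (hy : G.Adj m y) : ¬ G.Adj x y := fun h =>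
  H.triangle m x y hx h hy

include hc

theorem exists_label (x : V) : ∃ l, HasLabel G c l x := by
  classical
  have key : ∀ f : Fin 5 → Bool, (∀ i, ¬ (f i ∧ f (i + 1))) → (∀ j, f j = false) ∨
      (∃ i, ∀ j, f j = (one i).sees j) ∨ ∃ i, ∀ j, f j = (two i).sees j := by decide
  have hf : ∀ i, ¬ (decide (G.Adj x (c i)) = true ∧ decide (G.Adj x (c (i + 1))) = true) := by
    simpa using fun i h1 h2 => H.not_adj_of_common x h1 h2 (hc i).1
  rcases key (fun i => decide (G.Adj x (c i))) hf with h | ⟨i, h⟩ | ⟨i, h⟩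
  · exact ⟨zero, fun j => by simpa [sees] using h j⟩
  · exact ⟨one i, fun j => by rw [← h j, decide_eq_true_iff]⟩
  · exact ⟨two i, fun j => by rw [← h j, decide_eq_true_iff]⟩

theorem hasLabel_two {i : Fin 5} (h₁ : G.Adj x (c (i + 1))) (h₄ : G.Adj x (c (i + 4))) :
    HasLabel G c (two i) x := by
  obtain ⟨l, hl⟩ := H.exists_label hc x
  rw [hl] at h₁ h₄
  have : l = two i := by
    cases l with
    | zero => simp [sees] at h₁
    | one k =>
      clear hl
      revert i k
      decide
    | two k =>
      congr
      clear hl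
      revert i k
      decide
  exact this ▸ hl

theorem not_adj {l m : CycleLabel} (hx : HasLabel G c l x) (hy : HasLabel G c m y)
    (h : l.apart m = true) : ¬ G.Adj x y := by
  have path : ∀ k, (∀ s, s = k ∨ s = k + 1 ∨ s = k + 2 ∨ s = k + 3 → ¬ G.Adj x (c s)) →
      (∀ s, s = k ∨ s = k + 1 ∨ s = k + 2 ∨ s = k + 3 → ¬ G.Adj y (c s)) → ¬ G.Adj x y := by
    intro k hxk hyk hxy
    refine p2UnionP4_elim H.p2UnionP4 x y (c k) (c (k + 1)) (c (k + 2)) (c (k + 3)) hxy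
      ?_ ?_ ?_ ?_ ?_ ?_ (hxk _ ?_) (hxk _ ?_) (hxk _ ?_) (hxk _ ?_)
      (hyk _ ?_) (hyk _ ?_) (hyk _ ?_) (hyk _ ?_)
    any_goals rw [hc.adj_iff]
    all_goals clear * -; decide +revert
  have common : (∃ j, l.sees j ∧ m.sees j) → ¬ G.Adj x y := by
    rintro ⟨j, h1, h2⟩ hxy
    exact H.triangle x y (c j) hxy ((hy j).2 h2) ((hx j).2 h1)
  have hz : ∀ {u}, HasLabel G c zero u → ∀ s, ¬ G.Adj u (c s) := fun hu s h => by
    have := (hu s).1 h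
    simp [sees] at this
  have ho : ∀ {u i}, HasLabel G c (one i) u → ∀ s, s = i + 1 ∨ s = i + 1 + 1 ∨ s = i + 1 + 2 ∨
      s = i + 1 + 3 → ¬ G.Adj u (c s) := fun {u i} hu s hs h => by
    have := (hu s).1 h
    clear * - this hs
    revert i s
    decide
  match l, m, h with
  | zero, zero, _ => exact path 0 (fun s _ => hz hx s) fun s _ => hz hy s
  | zero, one i, _ => exact path (i + 1) (fun s _ => hz hx s) (ho hy)
  | one i, zero, _ => exact path (i + 1) (ho hx) fun s _ => hz hy s
  | zero, two i, h => exact common (by simpa [apart] using h)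
  | one i, one j, h => exact common (by simpa [apart] using h)
  | one i, two j, h => exact common (by simpa [apart] using h)
  | two i, zero, h => exact common (by simpa [apart] using h)
  | two i, one j, h => exact common (by simpa [apart] using h)
  | two i, two j, h => exact common (by simpa [apart] using h)

end TriangleFreeMinimal

end Labels

section LabelAdjacencies

variable {V : Type*} {G : SimpleGraph V} {c : Fin 5 → V} {x x' y z z' p p' q : V} {i s : Fin 5}

open CycleLabel

namespace TriangleFreeMinimal

variable (H : TriangleFreeMinimal G) (hc : IsC5 G c) (i s : Fin 5) (hs : s = 1 ∨ s = 4)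
include H hc hs

theorem adj_of_two_two (hz : HasLabel G c zero z) (hp : HasLabel G c (two i) p)
    (hq : HasLabel G c (two (i + s)) q) (hzp : G.Adj z p) (hzq : ¬ G.Adj z q) : G.Adj p q := by
  by_contra hpq
  refine p2UnionP4_elim H.p2UnionP4 z p (c i) q (c (i + 2 * s)) (c (i + 3 * s)) hzp
    ?_ ?_ ?_ ?_ ?_ ?_ ?_ hzq ?_ ?_ ?_ hpq ?_ ?_
  all_goals first
    | rw [hc.adj_iff] | rw [hz _] | rw [hp _] | rw [hq _] | rw [adj_comm, hq _]
  all_goals clear * - hs; revert i s; decide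

theorem adj_of_one_two (hz : HasLabel G c zero z) (hx : HasLabel G c (one i) x)
    (hp : HasLabel G c (two (i + 2 * s)) p) (hzp : G.Adj z p) : G.Adj x p := by
  by_contra hxp
  have hxz : ¬ G.Adj x z := H.not_adj hc hx hz rfl
  refine p2UnionP4_elim H.p2UnionP4 x (c i) z p (c (i + 3 * s)) (c (i + 2 * s)) ?_
    hzp ?_ ?_ ?_ ?_ ?_ hxz hxp ?_ ?_ ?_ ?_ ?_ ?_
  all_goals first
    | rw [hc.adj_iff] | rw [hz _] | rw [hp _] | rw [hx _] | rw [adj_comm, hz _]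
    | rw [adj_comm, hp _]
  all_goals clear * - hs; revert i s; decide

omit hs in
theorem not_adj_of_one_two (hz : HasLabel G c zero z) (hx : HasLabel G c (one i) x)
    (hp : HasLabel G c (two i) p) (hzp : G.Adj z p) : ¬ G.Adj x p := by
  intro hxp
  have hzx : ¬ G.Adj z x := H.not_adj hc hz hx rfl
  refine p2UnionP4_elim H.p2UnionP4 (c (i + 2)) (c (i + 3)) z p x (c i) ?_
    hzp hxp.symm ?_ hzx ?_ ?_ ?_ ?_ ?_ ?_ ?_ ?_ ?_ ?_
  all_goals first
    | rw [hc.adj_iff] | rw [hz _] | rw [hp _] | rw [hx _] | rw [adj_comm, hz _] |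
      rw [adj_comm, hp _] | rw [adj_comm, hx _]
  all_goals clear * -; revert i; decide

theorem not_adj_of_one_two_of_two (hz : HasLabel G c zero z) (hx : HasLabel G c (one i) x)
    (hp : HasLabel G c (two i) p) (hq : HasLabel G c (two (i + 2 * s)) q) (hzp : G.Adj z p)
    (hzq : ¬ G.Adj z q) : ¬ G.Adj x q := by
  intro hxq
  have hpx : ¬ G.Adj p x := fun h => H.not_adj_of_one_two hc i hz hx hp hzp h.symm
  have hpq : ¬ G.Adj p q := H.not_adj hc hp hq (by clear * - hs; revert i s; decide)
  have hzx : ¬ G.Adj z x := H.not_adj hc hz hx rfl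
  refine p2UnionP4_elim H.p2UnionP4 z p (c i) x q (c (i + 3 * s)) hzp
    ?_ hxq ?_ ?_ ?_ ?_ ?_ hzx hzq ?_ ?_ hpx hpq ?_
  all_goals first
    | rw [hc.adj_iff] | rw [hz _] | rw [hp _] | rw [hx _] | rw [hq _] | rw [adj_comm, hx _] |
      rw [adj_comm, hq _]
  all_goals clear * - hs; revert i s; decide

theorem not_adj_of_one_two_of_two' (hz : HasLabel G c zero z) (hx : HasLabel G c (one i) x)
    (hp : HasLabel G c (two (i + s)) p) (hq : HasLabel G c (two (i + 3 * s)) q) (hzp : G.Adj z p)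
    (hzq : ¬ G.Adj z q) : ¬ G.Adj x q := by
  intro hxq
  have hpx : ¬ G.Adj p x := H.not_adj hc hp hx (by clear * - hs; revert i s; decide)
  have hpq : ¬ G.Adj p q := H.not_adj hc hp hq (by clear * - hs; revert i s; decide)
  have hzx : ¬ G.Adj z x := H.not_adj hc hz hx rfl
  refine p2UnionP4_elim H.p2UnionP4 z p x q (c (i + 4 * s)) (c (i + 3 * s)) hzp
    hxq ?_ ?_ ?_ ?_ ?_ hzx hzq ?_ ?_ hpx hpq ?_ ?_
  all_goals first
    | rw [hc.adj_iff] | rw [hz _] | rw [hp _] | rw [hx _] | rw [hq _]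
  all_goals clear * - hs; revert i s; decide

theorem not_adj_of_one_one (hz : HasLabel G c zero z) (hx : HasLabel G c (one i) x)
    (hx' : HasLabel G c (one (i + s)) x') (hp : HasLabel G c (two i) p) (hzp : G.Adj z p) :
    ¬ G.Adj x x' := by
  intro hxx
  have hxp : ¬ G.Adj x p := H.not_adj_of_one_two hc i hz hx hp hzp
  have hxp' : ¬ G.Adj x' p := H.not_adj hc hx' hp (by clear * - hs; revert i s; decide)
  have hxz : ¬ G.Adj x z := H.not_adj hc hx hz rfl
  have hxz' : ¬ G.Adj x' z := H.not_adj hc hx' hz rfl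
  refine p2UnionP4_elim H.p2UnionP4 x x' z p (c (i + 4 * s)) (c (i + 3 * s)) hxx
    hzp ?_ ?_ ?_ ?_ ?_ hxz hxp ?_ ?_ hxz' hxp' ?_ ?_
  all_goals first
    | rw [hc.adj_iff] | rw [hz _] | rw [hp _] | rw [hx _] | rw [hx' _]
  all_goals clear * - hs; revert i s; decide

theorem adj_of_two_of_two (hz : HasLabel G c zero z) (hz' : HasLabel G c zero z')
    (hp : HasLabel G c (two i) p) (hp' : HasLabel G c (two (i + 2 * s)) p') (hzp : G.Adj z p)
    (hzp' : ¬ G.Adj z p') (h : G.Adj z' p') : G.Adj z' p := by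
  by_contra hn
  have hpp : ¬ G.Adj p p' := H.not_adj hc hp hp' (by clear * - hs; revert i s; decide)
  have hzz : ¬ G.Adj z z' := H.not_adj hc hz hz' rfl
  refine p2UnionP4_elim H.p2UnionP4 z p z' p' (c (i + 3 * s)) (c (i + 2 * s)) hzp
    h ?_ ?_ ?_ ?_ ?_ hzz hzp' ?_ ?_ (fun h => hn h.symm) hpp ?_ ?_
  all_goals first
    | rw [hc.adj_iff] | rw [hz _] | rw [hp _] | rw [hz' _] | rw [hp' _]
  all_goals clear * - hs; revert i s; decide

theorem not_reaches (hz : HasLabel G c zero z) (h₁ : Reaches G c z i)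
    (h₂ : Reaches G c z (i + s)) (h₄ : ¬ Reaches G c z (i + 4 * s)) (hz' : HasLabel G c zero z') :
    ¬ Reaches G c z' (i + 4 * s) := by
  have hs' : 4 * s = 1 ∨ 4 * s = 4 := by rcases hs with rfl | rfl <;> decide
  have e1 : i = i + s + 4 * s := by clear * -; revert i s; decide
  have e2 : i + 4 * s = i + s + 2 * (4 * s) := by clear * -; revert i s; decide
  obtain ⟨p, hp, hzp⟩ := h₁
  obtain ⟨p', hp', hzp'⟩ := h₂
  rintro ⟨q, hq, hzq⟩
  have hzq' : ¬ G.Adj z q := fun h => h₄ ⟨q, hq, h⟩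
  have hpq := H.adj_of_two_two hc i (4 * s) hs' hz hp hq hzp hzq'
  have hp1 : ¬ G.Adj z' p := fun h => H.triangle _ _ _ h hpq hzq
  have hp2 : G.Adj z' p' :=
    H.adj_of_two_of_two hc (i + s) (4 * s) hs' hz hz' hp' (e2 ▸ hq) hzp' hzq' hzq
  exact H.triangle _ _ _ hzp'
    (H.adj_of_two_two hc (i + s) (4 * s) hs' hz' hp' (e1 ▸ hp) hp2 hp1) hzp

end TriangleFreeMinimal

end LabelAdjacencies

section Colourings

variable {V : Type*} {G : SimpleGraph V} {c : Fin 5 → V} {x z : V}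

open CycleLabel

namespace TriangleFreeMinimal

variable (H : TriangleFreeMinimal G) (hc : IsC5 G c)
include H hc

/-- Three stable sets cannot cover a minimal graph. Here the first one is `N`, which contains
all vertices with a label in `ks`, and the others consist of the vertices outside `N` with a label
in `ls` or `ms`; the list `es` holds the pairs of labels whose nonadjacency is not automatic. -/
theorem false_of_cover {N : Set V} (hN : StableIn G N) (ks ls ms : List CycleLabel)
    (es : List (CycleLabel × CycleLabel)) (hks : ∀ l ∈ ks, ∀ x, HasLabel G c l x → x ∈ N)
    (h : ∀ e ∈ es, ∀ x y, HasLabel G c e.1 x → HasLabel G c e.2 y → x ∉ N → y ∉ N → ¬ G.Adj x y)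
    (hls : ∀ l ∈ ls, ∀ m ∈ ls, l.apart m = true ∨ (l, m) ∈ es ∨ (m, l) ∈ es)
    (hms : ∀ l ∈ ms, ∀ m ∈ ms, l.apart m = true ∨ (l, m) ∈ es ∨ (m, l) ∈ es)
    (hcov : ∀ l, l ∈ ks ∨ l ∈ ls ∨ l ∈ ms) : False := by
  have stable : ∀ ls : List CycleLabel,
      (∀ l ∈ ls, ∀ m ∈ ls, l.apart m = true ∨ (l, m) ∈ es ∨ (m, l) ∈ es) →
      StableIn G {x | x ∉ N ∧ ∃ l ∈ ls, HasLabel G c l x} := by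
    rintro ls hls x ⟨hxN, l, hl, hx⟩ y ⟨hyN, m, hm, hy⟩
    rcases hls l hl m hm with h' | h' | h'
    · exact H.not_adj hc hx hy h'
    · exact h _ h' x y hx hy hxN hyN
    · exact fun e => h _ h' y x hy hx hyN hxN e.symm
  obtain ⟨x, h0, h1, h2⟩ := H.minimal.exists_not_mem N _ _ hN (stable ls hls) (stable ms hms)
  obtain ⟨l, hl⟩ := H.exists_label hc x
  rcases hcov l with h' | h' | h'
  · exact h0 (hks l h' x hl)
  · exact h1 ⟨h0, l, h', hl⟩
  · exact h2 ⟨h0, l, h', hl⟩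

/-- Labels in `os` do not occur, and the remaining ones are divided into three stable classes. -/
theorem false_of_labels (os ks ls ms : List CycleLabel) (es : List (CycleLabel × CycleLabel))
    (hos : ∀ l ∈ os, ∀ x, ¬ HasLabel G c l x)
    (h : ∀ e ∈ es, ∀ x y, HasLabel G c e.1 x → HasLabel G c e.2 y → ¬ G.Adj x y)
    (hks : ∀ l ∈ ks, ∀ m ∈ ks, l.apart m = true ∨ (l, m) ∈ es ∨ (m, l) ∈ es)
    (hls : ∀ l ∈ ls, ∀ m ∈ ls, l.apart m = true ∨ (l, m) ∈ es ∨ (m, l) ∈ es)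
    (hms : ∀ l ∈ ms, ∀ m ∈ ms, l.apart m = true ∨ (l, m) ∈ es ∨ (m, l) ∈ es)
    (hcov : ∀ l, l ∈ os ++ ks ∨ l ∈ ls ∨ l ∈ ms) : False := by
  refine H.false_of_cover hc (N := {x | ∃ l ∈ ks, HasLabel G c l x}) ?_ (os ++ ks) ls ms es ?_
    (fun e he x y hx hy _ _ => h e he x y hx hy) hls hms hcov
  · rintro x ⟨l, hl, hx⟩ y ⟨m, hm, hy⟩
    rcases hks l hl m hm with h' | h' | h'
    · exact H.not_adj hc hx hy h'
    · exact h _ h' x y hx hy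
    · exact fun e => h _ h' y x hy hx e.symm
  · intro l hl x hx
    rcases List.mem_append.1 hl with hl | hl
    · exact (hos l hl x hx).elim
    · exact ⟨l, hl, hx⟩

/-- A neighbour of an anticentre of an induced 5-cycle that sees one vertex of the cycle but sees
at most one of the two vertices at distance two from it. -/
theorem adj_of_adj_of_not_adj (hz : HasLabel G c zero z) (hzx : G.Adj z x) {i s : Fin 5}
    (hs : s = 1 ∨ s = 4) (hi : G.Adj x (c i)) (h : ¬ G.Adj x (c (i + 2 * s))) :
    G.Adj x (c (i + 3 * s)) := by
  have hv : ∀ j, ¬ G.Adj z (c j) := fun j e => by simpa [sees] using (hz j).1 e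
  obtain hx | ⟨k, hx⟩ := hc.complete_or_exists H.p2UnionP4 H.bull hzx hv
  · exact hx _
  · rw [hx] at hi h ⊢
    clear * - hi h hs
    revert i s k
    decide

theorem false_of_reaches_all (h : ∀ i, Reaches G c z i) : False := by
  choose p hp hzp using h
  refine grotzsch_elim_of_edges H.grotzsch H.triangle z (c 0) (c 1) (c 2) (c 3) (c 4)
    (p 0) (p 1) (p 2) (p 3) (p 4) (hc 0).1 (hc 1).1 (hc 2).1 (hc 3).1 (hc 4).1
    (hzp 0) (hzp 1) (hzp 2) (hzp 3) (hzp 4) ?_ ?_ ?_ ?_ ?_ ?_ ?_ ?_ ?_ ?_ <;> rw [hp] <;> decide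

end TriangleFreeMinimal

end Colourings

section ReachedPositions

variable {V : Type*} {G : SimpleGraph V} {c : Fin 5 → V} {z x x₀ x₁ x₂ x₄ : V}

open CycleLabel

theorem Reaches.mirror {i : Fin 5} (h : Reaches G c z i) (k : Fin 5) :
    Reaches G (fun j => c (k - j)) z (k - i) := by
  obtain ⟨p, hp, hzp⟩ := h
  exact ⟨p, hp.mirror k, hzp⟩

theorem hasLabel_zero {a₀ a₁ a₂ a₃ a₄ : V} (h₀ : ¬ G.Adj z a₀) (h₁ : ¬ G.Adj z a₁)
    (h₂ : ¬ G.Adj z a₂) (h₃ : ¬ G.Adj z a₃) (h₄ : ¬ G.Adj z a₄) :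
    HasLabel G ![a₀, a₁, a₂, a₃, a₄] zero z := by
  intro j
  fin_cases j <;> simpa [sees]

namespace TriangleFreeMinimal

variable (H : TriangleFreeMinimal G) (hc : IsC5 G c)
include H hc

theorem not_hasLabel_one_zero_of_reaches (hz : HasLabel G c zero z) (h₁ : Reaches G c z 1)
    (h₂ : Reaches G c z 2) (h₃ : Reaches G c z 3) (h₄ : Reaches G c z 4) :
    ¬ HasLabel G c (one 0) x := by
  intro hx
  obtain ⟨p₁, hp₁, hzp₁⟩ := h₁
  obtain ⟨p₂, hp₂, hzp₂⟩ := h₂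
  obtain ⟨p₃, hp₃, hzp₃⟩ := h₃
  obtain ⟨p₄, hp₄, hzp₄⟩ := h₄
  have hxp₂ := H.adj_of_one_two hc 0 1 (.inl rfl) hz hx hp₂ hzp₂
  have hxp₃ := H.adj_of_one_two hc 0 4 (.inr rfl) hz hx hp₃ hzp₃
  refine grotzsch_elim_of_edges H.grotzsch H.triangle (c 0) z p₂ (c 3) (c 2) p₃
    x p₄ (c 1) (c 4) p₁ ?_ ?_ ?_ ?_ ?_ ?_ ?_ ?_ ?_ ?_ ?_ ?_ ?_ ?_ ?_ ?_ ?_ ?_ ?_ ?_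
  all_goals first
    | assumption | exact Adj.symm ‹_›
    | (first
        | rw [hc.adj_iff] | rw [hx] | rw [hp₁] | rw [hp₂] | rw [hp₃] | rw [hp₄]
        | rw [adj_comm, hx] | rw [adj_comm, hp₁] | rw [adj_comm, hp₂] | rw [adj_comm, hp₃]
        | rw [adj_comm, hp₄]); decide

theorem not_hasLabel_one_two_of_adj (hz : HasLabel G c zero z) (h₁ : Reaches G c z 1)
    (h₃ : Reaches G c z 3) (h₄ : Reaches G c z 4) (hx₁ : HasLabel G c (one 1) x₁)
    (hx₄ : HasLabel G c (one 4) x₄) (hxx : G.Adj x₁ x₄) : ¬ HasLabel G c (one 2) x := by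
  intro hx
  obtain ⟨p₁, hp₁, hzp₁⟩ := h₁
  obtain ⟨p₃, hp₃, hzp₃⟩ := h₃
  obtain ⟨p₄, hp₄, hzp₄⟩ := h₄
  have h₁₃ := H.adj_of_one_two hc 1 1 (.inl rfl) hz hx₁ hp₃ hzp₃
  have h₁₄ := H.adj_of_one_two hc 1 4 (.inr rfl) hz hx₁ hp₄ hzp₄
  have h₄₁ := H.adj_of_one_two hc 4 1 (.inl rfl) hz hx₄ hp₁ hzp₁
  have hx₂₄ := H.adj_of_one_two hc 2 1 (.inl rfl) hz hx hp₄ hzp₄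
  have h0 : G.Adj p₄ (c 0) := (hp₄ 0).2 rfl
  have h4 : G.Adj (c 4) x₄ := ((hx₄ 4).2 rfl).symm
  have hd := H.isC5 h0 (hc 4).1.symm h4 hxx.symm h₁₄
  have hcz : HasLabel G ![p₄, c 0, c 4, x₄, x₁] zero (c 2) := by
    apply hasLabel_zero
    all_goals first
      | rw [hc.adj_iff] | rw [adj_comm, hp₄] | rw [adj_comm, hx₄] | rw [adj_comm, hx₁]
    all_goals decide
  have hxx₄ : G.Adj x x₄ := H.adj_of_adj_of_not_adj hd hcz ((hx 2).2 rfl).symm (i := 0)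
    (.inl rfl) hx₂₄ fun h => by simpa [sees] using (hx 4).1 h
  refine grotzsch_elim_of_edges H.grotzsch H.triangle (c 2) p₄ (c 0) (c 4) x₄ x₁
    (c 1) (c 3) p₁ p₃ x ?_ ?_ ?_ ?_ ?_ ?_ ?_ ?_ ?_ ?_ ?_ ?_ ?_ ?_ ?_ ?_ ?_ ?_ ?_ ?_
  all_goals first
    | assumption | exact Adj.symm ‹_›
    | (first
        | rw [hc.adj_iff] | rw [hx] | rw [hp₁] | rw [hx₁] | rw [hp₃] | rw [hp₄] | rw [hx₄]
        | rw [adj_comm, hx] | rw [adj_comm, hp₁] | rw [adj_comm, hp₃]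
        | rw [adj_comm, hx₁] | rw [adj_comm, hx₄] | rw [adj_comm, hp₄]); decide

theorem false_of_reaches_four (hz : HasLabel G c zero z) (h₁ : Reaches G c z 1)
    (h₂ : Reaches G c z 2) (h₃ : Reaches G c z 3) (h₄ : Reaches G c z 4) : False := by
  have h₀ : ¬ Reaches G c z 0 := fun h₀ =>
    H.false_of_reaches_all hc (z := z) fun i => by fin_cases i <;> assumption
  have h₀' : ∀ x y, HasLabel G c zero x → HasLabel G c (two 0) y → ¬ G.Adj x y :=
    fun x y hx hy h => H.not_reaches hc 1 1 (.inl rfl) hz h₁ h₂ h₀ hx ⟨y, hy, h⟩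
  have f₀ := fun x => H.not_hasLabel_one_zero_of_reaches hc hz h₁ h₂ h₃ h₄ (x := x)
  obtain ⟨x₁, hx₁, x₄, hx₄, hxx⟩ : ∃ x₁, HasLabel G c (one 1) x₁ ∧
      ∃ x₄, HasLabel G c (one 4) x₄ ∧ G.Adj x₁ x₄ := by
    by_contra! h
    refine H.false_of_labels hc [one 0] [two 2, two 4, one 3] [two 1, two 3, one 2]
      [zero, two 0, one 1, one 4] [(zero, two 0), (one 1, one 4)] ?_ ?_
      (by decide) (by decide) (by decide) (by decide)
    · simpa using f₀
    · simp only [List.forall_mem_cons]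
      exact ⟨h₀', fun x y hx hy => h x hx y hy, by simp⟩
  have f₂ := fun x => H.not_hasLabel_one_two_of_adj hc hz h₁ h₃ h₄ hx₁ hx₄ hxx (x := x)
  have f₃ : ∀ x, ¬ HasLabel G c (one 3) x := fun x hx =>
    H.not_hasLabel_one_two_of_adj (hc.mirror 0) (hz.mirror 0) (h₄.mirror 0) (h₂.mirror 0)
      (h₁.mirror 0) (hx₄.mirror 0) (hx₁.mirror 0) hxx.symm (hx.mirror 0)
  obtain ⟨p₁, hp₁, hzp₁⟩ := h₁
  refine H.false_of_cover hc (N := {x | HasLabel G c (two 1) x ∨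
      G.Adj z x ∧ (HasLabel G c (two 3) x ∨ HasLabel G c (two 4) x)}) ?_
    [one 0, one 2, one 3, two 1] [zero, one 4, two 0, two 3] [two 2, two 4, one 1]
    [(zero, two 0), (zero, two 3), (one 1, two 4)] ?_ ?_ (by decide) (by decide) (by decide)
  · rintro x (hx | ⟨hzx, hx | hx⟩) y (hy | ⟨hzy, hy | hy⟩)
    all_goals first
      | exact H.not_adj_of_common z hzx hzy
      | exact H.not_adj hc hx hy rfl
  · simp only [List.forall_mem_cons]
    exact ⟨fun x hx => (f₀ x hx).elim, fun x hx => (f₂ x hx).elim, fun x hx => (f₃ x hx).elim,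
      fun x hx => Or.inl hx, by simp⟩
  · simp only [List.forall_mem_cons]
    refine ⟨fun x y hx hy _ _ => h₀' x y hx hy, fun x y hx hy _ hyN h => ?_,
      fun x y hx hy _ hyN => ?_, by simp⟩
    · have hzy : ¬ G.Adj z y := fun h => hyN (.inr ⟨h, .inl hy⟩)
      exact H.not_adj_of_one_two_of_two hc 1 1 (.inl rfl) hz hx₁ hp₁ hy hzp₁ hzy
        (H.adj_of_one_two hc 1 1 (.inl rfl) hx hx₁ hy h)
    · have hzy : ¬ G.Adj z y := fun h => hyN (.inr ⟨h, .inr hy⟩)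
      exact H.not_adj_of_one_two_of_two hc 1 4 (.inr rfl) hz hx hp₁ hy hzp₁ hzy

theorem not_hasLabel_one_four_of_reaches (hz : HasLabel G c zero z) (h₁ : Reaches G c z 1)
    (h₂ : Reaches G c z 2) (h₃ : Reaches G c z 3) : ¬ HasLabel G c (one 4) x := by
  intro hx
  obtain ⟨p₁, hp₁, hzp₁⟩ := h₁
  obtain ⟨p₂, hp₂, hzp₂⟩ := h₂
  obtain ⟨p₃, hp₃, hzp₃⟩ := h₃
  have hxp₁ := H.adj_of_one_two hc 4 1 (.inl rfl) hz hx hp₁ hzp₁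
  have hxp₂ := H.adj_of_one_two hc 4 4 (.inr rfl) hz hx hp₂ hzp₂
  have h12 : G.Adj p₁ (c 2) := (hp₁ 2).2 rfl
  have h21 : G.Adj (c 1) p₂ := ((hp₂ 1).2 rfl).symm
  have hd := H.isC5 hzp₂.symm hzp₁ h12 (hc 1).1.symm h21
  have hcz : HasLabel G ![p₂, z, p₁, c 2, c 1] zero (c 4) := by
    apply hasLabel_zero
    all_goals first
      | rw [hc.adj_iff] | rw [adj_comm, hp₁] | rw [adj_comm, hp₂] | rw [adj_comm, hz]
    all_goals decide
  exact H.false_of_reaches_four hd hcz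
    ⟨x, H.hasLabel_two hd hxp₁ hxp₂, ((hx 4).2 rfl).symm⟩
    ⟨p₃, H.hasLabel_two hd ((hp₃ 2).2 rfl) hzp₃.symm, ((hp₃ 4).2 rfl).symm⟩
    ⟨c 0, H.hasLabel_two hd (hc 0).1 ((hp₁ 0).2 rfl).symm, (hc 4).1⟩
    ⟨c 3, H.hasLabel_two hd ((hp₂ 3).2 rfl).symm (hc 2).1.symm, (hc 3).1.symm⟩

theorem false_of_reaches_consecutive_three (hz : HasLabel G c zero z) (h₁ : Reaches G c z 1)
    (h₂ : Reaches G c z 2) (h₃ : Reaches G c z 3) (h₄ : ¬ Reaches G c z 4)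
    (h₀ : ¬ Reaches G c z 0) : False := by
  have f₄ := fun x => H.not_hasLabel_one_four_of_reaches hc hz h₁ h₂ h₃ (x := x)
  have f₀ : ∀ x, ¬ HasLabel G c (one 0) x := fun x hx =>
    H.not_hasLabel_one_four_of_reaches (hc.mirror 4) (hz.mirror 4) (h₃.mirror 4) (h₂.mirror 4)
      (h₁.mirror 4) (hx.mirror 4)
  have hz₀ : ∀ x y, HasLabel G c zero x → HasLabel G c (two 0) y → ¬ G.Adj x y :=
    fun x y hx hy h => H.not_reaches hc 1 1 (.inl rfl) hz h₁ h₂ h₀ hx ⟨y, hy, h⟩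
  obtain ⟨p₁, hp₁, hzp₁⟩ := h₁
  obtain ⟨p₃, hp₃, hzp₃⟩ := h₃
  refine H.false_of_labels hc [one 4, one 0] [two 1, two 3, one 2] [two 4, two 2, one 1]
    [two 0, zero, one 3] [(zero, two 0), (one 1, two 4), (one 3, two 0)] ?_ ?_
    (by decide) (by decide) (by decide) (by decide)
  · simp only [List.forall_mem_cons]
    exact ⟨f₄, f₀, by simp⟩
  · simp only [List.forall_mem_cons]
    exact ⟨hz₀,
      fun x y hx hy => H.not_adj_of_one_two_of_two hc 1 4 (.inr rfl) hz hx hp₁ hy hzp₁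
        fun h => h₄ ⟨y, hy, h⟩,
      fun x y hx hy => H.not_adj_of_one_two_of_two hc 3 1 (.inl rfl) hz hx hp₃ hy hzp₃
        fun h => h₀ ⟨y, hy, h⟩, by simp⟩

end TriangleFreeMinimal

end ReachedPositions

section ReachedPatterns

variable {V : Type*} {G : SimpleGraph V} {c : Fin 5 → V} {z x₀ x₁ x₂ x₄ : V}

open CycleLabel

namespace TriangleFreeMinimal

variable (H : TriangleFreeMinimal G) (hc : IsC5 G c)
include H hc

theorem false_of_one_one_of_one_two_of_one_four (hz : HasLabel G c zero z)
    (h₁ : Reaches G c z 1) (h₂ : Reaches G c z 2) (h₄ : Reaches G c z 4)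
    (hx₁ : HasLabel G c (one 1) x₁) (hx₂ : HasLabel G c (one 2) x₂)
    (hx₄ : HasLabel G c (one 4) x₄) : False := by
  obtain ⟨p₁, hp₁, hzp₁⟩ := h₁
  obtain ⟨p₂, hp₂, hzp₂⟩ := h₂
  obtain ⟨p₄, hp₄, hzp₄⟩ := h₄
  have h₁₄ := H.adj_of_one_two hc 1 4 (.inr rfl) hz hx₁ hp₄ hzp₄
  have h₂₄ := H.adj_of_one_two hc 2 1 (.inl rfl) hz hx₂ hp₄ hzp₄
  have h₄₁ := H.adj_of_one_two hc 4 1 (.inl rfl) hz hx₄ hp₁ hzp₁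
  have h₄₂ := H.adj_of_one_two hc 4 4 (.inr rfl) hz hx₄ hp₂ hzp₂
  have h₁₁ := H.not_adj_of_one_two hc 1 hz hx₁ hp₁ hzp₁
  have h₂₂ := H.not_adj_of_one_two hc 2 hz hx₂ hp₂ hzp₂
  have h₄₄ := H.not_adj_of_one_two hc 4 hz hx₄ hp₄ hzp₄
  have h2 : G.Adj p₂ (c 1) := (hp₂ 1).2 rfl
  have h1 : G.Adj (c 2) p₁ := ((hp₁ 2).2 rfl).symm
  have hd := H.isC5 h₄₁.symm h₄₂ h2 (hc 1).1 h1
  have hpz : HasLabel G ![p₁, x₄, p₂, c 1, c 2] zero p₄ :=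
    hasLabel_zero (H.not_adj hc hp₄ hp₁ rfl) (fun h => h₄₄ h.symm)
      (H.not_adj hc hp₄ hp₂ rfl) (by rw [hp₄]; decide) (by rw [hp₄]; decide)
  have hx₁₄ : G.Adj x₁ x₄ := H.adj_of_adj_of_not_adj hd hpz h₁₄.symm (i := 3)
    (.inl rfl) ((hx₁ 1).2 rfl) h₁₁
  have hx₂₄ : G.Adj x₂ x₄ := H.adj_of_adj_of_not_adj hd hpz h₂₄.symm (i := 4)
    (.inr rfl) ((hx₂ 2).2 rfl) h₂₂
  refine grotzsch_elim_of_edges H.grotzsch H.triangle p₄ p₁ x₄ p₂ (c 1) (c 2)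
    x₂ z x₁ (c 3) (c 0) ?_ ?_ ?_ ?_ ?_ ?_ ?_ ?_ ?_ ?_ ?_ ?_ ?_ ?_ ?_ ?_ ?_ ?_ ?_ ?_
  all_goals first
    | assumption | exact Adj.symm ‹_›
    | (first
        | rw [hc.adj_iff] | rw [hp₁] | rw [hp₂] | rw [hp₄] | rw [hx₁] | rw [hx₂]
        | rw [adj_comm, hp₁] | rw [adj_comm, hp₂]); decide

theorem false_of_one_zero_of_one_two_of_one_four (hz : HasLabel G c zero z)
    (h₁ : Reaches G c z 1) (h₂ : Reaches G c z 2) (h₄ : Reaches G c z 4)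
    (hx₀ : HasLabel G c (one 0) x₀) (hx₂ : HasLabel G c (one 2) x₂)
    (hx₄ : HasLabel G c (one 4) x₄) : False := by
  obtain ⟨p₁, hp₁, hzp₁⟩ := h₁
  obtain ⟨p₂, hp₂, hzp₂⟩ := h₂
  obtain ⟨p₄, hp₄, hzp₄⟩ := h₄
  have h₀₂ := H.adj_of_one_two hc 0 1 (.inl rfl) hz hx₀ hp₂ hzp₂
  have h₂₄ := H.adj_of_one_two hc 2 1 (.inl rfl) hz hx₂ hp₄ hzp₄
  have h₄₁ := H.adj_of_one_two hc 4 1 (.inl rfl) hz hx₄ hp₁ hzp₁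
  have h₄₂ := H.adj_of_one_two hc 4 4 (.inr rfl) hz hx₄ hp₂ hzp₂
  have h₂₂ := H.not_adj_of_one_two hc 2 hz hx₂ hp₂ hzp₂
  have h₄₄ := H.not_adj_of_one_two hc 4 hz hx₄ hp₄ hzp₄
  have h1 : G.Adj p₁ (c 2) := (hp₁ 2).2 rfl
  have h2 : G.Adj (c 2) x₂ := ((hx₂ 2).2 rfl).symm
  have h4 : G.Adj p₄ (c 0) := (hp₄ 0).2 rfl
  have h0 : G.Adj (c 0) p₁ := ((hp₁ 0).2 rfl).symm
  have hd := H.isC5 h1 h2 h₂₄ h4 h0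
  have hpz : HasLabel G ![p₁, c 2, x₂, p₄, c 0] zero p₂ :=
    hasLabel_zero (H.not_adj_of_common z hzp₂ hzp₁) (by rw [hp₂]; decide) (fun h => h₂₂ h.symm)
      (H.not_adj hc hp₂ hp₄ rfl) (by rw [hp₂]; decide)
  have hx₄₂ : G.Adj x₄ x₂ := H.adj_of_adj_of_not_adj hd hpz h₄₂.symm (i := 0)
    (.inr rfl) h₄₁ h₄₄
  have hx₀₂ : G.Adj x₀ x₂ := H.adj_of_adj_of_not_adj hd hpz h₀₂.symm (i := 4)
    (.inl rfl) ((hx₀ 0).2 rfl) (fun h => by simpa [sees] using (hx₀ 2).1 h)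
  refine grotzsch_elim_of_edges H.grotzsch H.triangle p₂ p₁ (c 2) x₂ p₄ (c 0)
    (c 1) x₄ (c 3) x₀ z ?_ ?_ ?_ ?_ ?_ ?_ ?_ ?_ ?_ ?_ ?_ ?_ ?_ ?_ ?_ ?_ ?_ ?_ ?_ ?_
  all_goals first
    | assumption | exact Adj.symm ‹_›
    | (first
        | rw [hc.adj_iff] | rw [hp₁] | rw [hp₂] | rw [hp₄] | rw [hx₀]
        | rw [adj_comm, hp₁] | rw [adj_comm, hp₂] | rw [adj_comm, hp₄]); decide

theorem false_of_reaches_one_two_four (hz : HasLabel G c zero z) (h₁ : Reaches G c z 1)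
    (h₂ : Reaches G c z 2) (h₄ : Reaches G c z 4) (h₃ : ¬ Reaches G c z 3)
    (h₀ : ¬ Reaches G c z 0) : False := by
  have hz₀ : ∀ x y, HasLabel G c zero x → HasLabel G c (two 0) y → ¬ G.Adj x y :=
    fun x y hx hy h => H.not_reaches hc 1 1 (.inl rfl) hz h₁ h₂ h₀ hx ⟨y, hy, h⟩
  have hz₃ : ∀ x y, HasLabel G c zero x → HasLabel G c (two 3) y → ¬ G.Adj x y :=
    fun x y hx hy h => H.not_reaches hc 2 4 (.inr rfl) hz h₂ h₁ h₃ hx ⟨y, hy, h⟩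
  have g124 := fun x₁ x₂ x₄ => H.false_of_one_one_of_one_two_of_one_four hc hz h₁ h₂ h₄
    (x₁ := x₁) (x₂ := x₂) (x₄ := x₄)
  have g024 := fun x₀ x₂ x₄ => H.false_of_one_zero_of_one_two_of_one_four hc hz h₁ h₂ h₄
    (x₀ := x₀) (x₂ := x₂) (x₄ := x₄)
  have g134 : ∀ x₁ x₃ x₄, HasLabel G c (one 1) x₁ → HasLabel G c (one 3) x₃ →
      HasLabel G c (one 4) x₄ → False := fun x₁ x₃ x₄ hx₁ hx₃ hx₄ =>
    H.false_of_one_zero_of_one_two_of_one_four (hc.mirror 3) (hz.mirror 3) (h₂.mirror 3)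
      (h₁.mirror 3) (h₄.mirror 3) (hx₃.mirror 3) (hx₁.mirror 3) (hx₄.mirror 3)
  obtain ⟨p₁, hp₁, hzp₁⟩ := h₁
  obtain ⟨p₂, hp₂, hzp₂⟩ := h₂
  obtain ⟨x₄, hx₄⟩ : ∃ x, HasLabel G c (one 4) x := by
    by_contra hx
    rw [not_exists] at hx
    refine H.false_of_labels hc [one 4] [two 4, two 1, one 0] [two 2, one 3, two 0]
      [zero, two 3, one 2, one 1]
      [(one 3, two 0), (zero, two 3), (one 1, two 3), (one 1, one 2)] ?_ ?_
      (by decide) (by decide) (by decide) (by decide)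
    · simp only [List.forall_mem_cons]
      exact ⟨hx, by simp⟩
    · simp only [List.forall_mem_cons]
      exact ⟨fun x y hx hy => H.not_adj_of_one_two_of_two' hc 3 4 (.inr rfl) hz hx hp₂ hy hzp₂
          fun h => h₀ ⟨y, hy, h⟩,
        hz₃, fun x y hx hy => H.not_adj_of_one_two_of_two hc 1 1 (.inl rfl) hz hx hp₁ hy hzp₁
          fun h => h₃ ⟨y, hy, h⟩,
        fun x y hx hy => H.not_adj_of_one_one hc 1 1 (.inl rfl) hz hx hy hp₁ hzp₁, by simp⟩
  by_cases hx₂ : ∃ x, HasLabel G c (one 2) x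
  · obtain ⟨x₂, hx₂⟩ := hx₂
    refine H.false_of_labels hc [one 1, one 0] [two 4, two 2, one 3] [two 1, one 2, two 3]
      [zero, two 0, one 4] [(zero, two 0)] ?_ ?_ (by decide) (by decide) (by decide) (by decide)
    · simp only [List.forall_mem_cons]
      exact ⟨fun x hx => g124 x x₂ x₄ hx hx₂ hx₄, fun x hx => g024 x x₂ x₄ hx hx₂ hx₄, by simp⟩
    · simp only [List.forall_mem_cons]
      exact ⟨hz₀, by simp⟩
  rw [not_exists] at hx₂
  by_cases hx₁ : ∃ x, HasLabel G c (one 1) x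
  · obtain ⟨x₁, hx₁⟩ := hx₁
    refine H.false_of_labels hc [one 2, one 3] [two 4, two 1, one 0] [two 2, one 1, two 0]
      [zero, two 3, one 4] [(zero, two 3)] ?_ ?_ (by decide) (by decide) (by decide) (by decide)
    · simp only [List.forall_mem_cons]
      exact ⟨hx₂, fun x hx => g134 x₁ x x₄ hx₁ hx hx₄, by simp⟩
    · simp only [List.forall_mem_cons]
      exact ⟨hz₃, by simp⟩
  rw [not_exists] at hx₁
  refine H.false_of_cover hc (N := {x | G.Adj p₁ x})
    (fun x hx y hy => H.not_adj_of_common p₁ hx hy) [one 1, one 2, one 3, one 4, two 0]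
    [two 2, two 4] [two 1, two 3, one 0, zero] [(one 0, two 3), (zero, two 3), (zero, two 1)]
    ?_ ?_ (by decide) (by decide) (by decide)
  · simp only [List.forall_mem_cons]
    exact ⟨fun x hx => (hx₁ x hx).elim, fun x hx => (hx₂ x hx).elim,
      fun x hx => (H.adj_of_one_two hc 3 4 (.inr rfl) hz hx hp₁ hzp₁).symm,
      fun x hx => (H.adj_of_one_two hc 4 1 (.inl rfl) hz hx hp₁ hzp₁).symm,
      fun x hx => H.adj_of_two_two hc 1 4 (.inr rfl) hz hp₁ hx hzp₁ fun h => h₀ ⟨x, hx, h⟩,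
      by simp⟩
  · simp only [List.forall_mem_cons]
    refine ⟨fun x y hx hy _ _ => H.not_adj_of_one_two_of_two' hc 0 1 (.inl rfl) hz hx hp₁ hy hzp₁
        fun h => h₃ ⟨y, hy, h⟩,
      fun x y hx hy _ _ => hz₃ x y hx hy, fun x y hx hy hxN _ h => ?_, by simp⟩
    have h₄₂ := H.adj_of_one_two hc 4 4 (.inr rfl) hz hx₄ hp₂ hzp₂
    have h₄y := H.adj_of_one_two hc 4 1 (.inl rfl) hx hx₄ hy h
    have hxp₂ : G.Adj x p₂ := by
      by_contra hn
      exact H.not_adj_of_common x₄ h₄y h₄₂ (H.adj_of_two_two hc 1 1 (.inl rfl) hx hy hp₂ h hn)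
    exact H.not_adj_of_common z hzp₂ hzp₁
      (H.adj_of_two_two hc 2 4 (.inr rfl) hx hp₂ hp₁ hxp₂ fun h => hxN h.symm)

theorem false_of_reaches_one_two (hz : HasLabel G c zero z) (h₁ : Reaches G c z 1)
    (h₂ : Reaches G c z 2) (h₃ : ¬ Reaches G c z 3) (h₄ : ¬ Reaches G c z 4)
    (h₀ : ¬ Reaches G c z 0) : False := by
  obtain ⟨p₁, hp₁, hzp₁⟩ := h₁
  obtain ⟨p₂, hp₂, hzp₂⟩ := h₂
  have n₃ : ∀ y, HasLabel G c (two 3) y → ¬ G.Adj z y := fun y hy h => h₃ ⟨y, hy, h⟩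
  have n₄ : ∀ y, HasLabel G c (two 4) y → ¬ G.Adj z y := fun y hy h => h₄ ⟨y, hy, h⟩
  have n₀ : ∀ y, HasLabel G c (two 0) y → ¬ G.Adj z y := fun y hy h => h₀ ⟨y, hy, h⟩
  refine H.false_of_cover hc (N := {x | G.Adj p₁ x})
    (fun x hx y hy => H.not_adj_of_common p₁ hx hy) [one 3, one 4, two 0]
    [two 2, one 1, two 4, one 2, zero] [two 1, two 3, one 0]
    [(two 2, one 2), (zero, two 2), (one 1, two 4), (one 1, one 2), (one 2, two 4),
      (zero, two 4), (one 0, two 3)]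
    ?_ ?_ (by decide) (by decide) (by decide)
  · simp only [List.forall_mem_cons]
    exact ⟨fun x hx => (H.adj_of_one_two hc 3 4 (.inr rfl) hz hx hp₁ hzp₁).symm,
      fun x hx => (H.adj_of_one_two hc 4 1 (.inl rfl) hz hx hp₁ hzp₁).symm,
      fun x hx => H.adj_of_two_two hc 1 4 (.inr rfl) hz hp₁ hx hzp₁ (n₀ x hx),
      by simp⟩
  · simp only [List.forall_mem_cons]
    refine ⟨fun x y hx hy hxN _ h => ?_, fun x y hx hy hxN hyN h => ?_,
      fun x y hx hy _ _ => H.not_adj_of_one_two_of_two hc 1 4 (.inr rfl) hz hx hp₁ hy hzp₁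
        (n₄ y hy),
      fun x y hx hy _ _ => H.not_adj_of_one_one hc 1 1 (.inl rfl) hz hx hy hp₁ hzp₁,
      fun x y hx hy _ _ => H.not_adj_of_one_two_of_two hc 2 1 (.inl rfl) hz hx hp₂ hy hzp₂
        (n₄ y hy),
      fun x y hx hy hxN _ h => hxN ?_,
      fun x y hx hy _ _ => H.not_adj_of_one_two_of_two' hc 0 1 (.inl rfl) hz hx hp₁ hy hzp₁
        (n₃ y hy),
      by simp⟩
    · have hzx : G.Adj z x := by
        by_contra hn
        exact hxN (H.adj_of_two_two hc 1 1 (.inl rfl) hz hp₁ hx hzp₁ hn)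
      exact H.not_adj_of_one_two hc 2 hz hy hx hzx h.symm
    · exact hyN (H.adj_of_two_two hc 2 4 (.inr rfl) hx hy hp₁ h fun h => hxN h.symm).symm
    · exact (H.adj_of_two_of_two hc 1 4 (.inr rfl) hz hx hp₁ hy hzp₁ (n₄ y hy) h).symm

theorem false_of_reaches_one (hz : HasLabel G c zero z) (h₁ : Reaches G c z 1)
    (h₂ : ¬ Reaches G c z 2) (h₄ : ¬ Reaches G c z 4) (h₀ : ¬ Reaches G c z 0) : False := by
  obtain ⟨p₁, hp₁, hzp₁⟩ := h₁
  refine H.false_of_cover hc (N := {x | G.Adj p₁ x})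
    (fun x hx y hy => H.not_adj_of_common p₁ hx hy) [one 3, one 4, two 2, two 0]
    [two 1, two 3, one 2] [one 1, two 4, one 0, zero]
    [(one 1, two 4), (one 1, one 0), (zero, two 4)]
    ?_ ?_ (by decide) (by decide) (by decide)
  · simp only [List.forall_mem_cons]
    exact ⟨fun x hx => (H.adj_of_one_two hc 3 4 (.inr rfl) hz hx hp₁ hzp₁).symm,
      fun x hx => (H.adj_of_one_two hc 4 1 (.inl rfl) hz hx hp₁ hzp₁).symm,
      fun x hx => H.adj_of_two_two hc 1 1 (.inl rfl) hz hp₁ hx hzp₁ fun h => h₂ ⟨x, hx, h⟩,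
      fun x hx => H.adj_of_two_two hc 1 4 (.inr rfl) hz hp₁ hx hzp₁ fun h => h₀ ⟨x, hx, h⟩,
      by simp⟩
  · simp only [List.forall_mem_cons]
    exact ⟨fun x y hx hy _ _ => H.not_adj_of_one_two_of_two hc 1 4 (.inr rfl) hz hx hp₁ hy hzp₁
        fun h => h₄ ⟨y, hy, h⟩,
      fun x y hx hy _ _ => H.not_adj_of_one_one hc 1 4 (.inr rfl) hz hx hy hp₁ hzp₁,
      fun x y hx hy hxN _ h => hxN (H.adj_of_two_of_two hc 1 4 (.inr rfl) hz hx hp₁ hy hzp₁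
        (fun h => h₄ ⟨y, hy, h⟩) h).symm, by simp⟩

theorem exists_reaches (hz : HasLabel G c zero z) : ∃ i, Reaches G c z i := by
  by_contra! h
  have hn : ∀ x, ¬ G.Adj z x := fun x hx => by
    obtain ⟨l | i | i, hl⟩ := H.exists_label hc x
    · exact H.not_adj hc hz hl rfl hx
    · exact H.not_adj hc hz hl rfl hx
    · exact h i ⟨x, hl, hx⟩
  have hne : ∀ i, c i ≠ z := fun i e => hn (c (i + 1)) (e ▸ (hc i).1)
  refine (hc 0).1.ne (H.minimal.eq_of_homogeneous {x | x ≠ z} (fun y _ hy => .inr fun x _ => ?_)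
    (fun e => ?_) _ (hne 0) _ (hne 1))
  · rw [show y = z from not_not.1 hy]
    exact hn x
  · exact (e.symm ▸ Set.mem_univ z : z ∈ {x | x ≠ z}) rfl

theorem false_of_hasLabel_zero (hz : HasLabel G c zero z) : False := by
  classical
  have key : ∀ f : Fin 5 → Bool, (∃ i, f i) → ∃ k,
      (f (1 + k) ∧ f (2 + k) ∧ f (3 + k) ∧ f (4 + k)) ∨
      (f (1 + k) ∧ f (2 + k) ∧ f (3 + k) ∧ ¬ f (4 + k) ∧ ¬ f (0 + k)) ∨
      (f (1 + k) ∧ f (2 + k) ∧ f (4 + k) ∧ ¬ f (3 + k) ∧ ¬ f (0 + k)) ∨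
      (f (1 + k) ∧ f (2 + k) ∧ ¬ f (3 + k) ∧ ¬ f (4 + k) ∧ ¬ f (0 + k)) ∨
      (f (1 + k) ∧ ¬ f (2 + k) ∧ ¬ f (4 + k) ∧ ¬ f (0 + k)) := by decide
  obtain ⟨k, hk⟩ := key (fun i => decide (Reaches G c z i))
    (by simpa using H.exists_reaches hc hz)
  simp only [decide_eq_true_iff, ← Reaches.rotate] at hk
  have hc' := hc.rotate k
  have hz' : HasLabel G (fun j => c (j + k)) zero z := fun j => hz (j + k)
  obtain ⟨h₁, h₂, h₃, h₄⟩ | ⟨h₁, h₂, h₃, h₄, h₀⟩ | ⟨h₁, h₂, h₄, h₃, h₀⟩ | ⟨h₁, h₂, h₃, h₄, h₀⟩ |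
    ⟨h₁, h₂, h₄, h₀⟩ := hk
  · exact H.false_of_reaches_four hc' hz' h₁ h₂ h₃ h₄
  · exact H.false_of_reaches_consecutive_three hc' hz' h₁ h₂ h₃ h₄ h₀
  · exact H.false_of_reaches_one_two_four hc' hz' h₁ h₂ h₄ h₃ h₀
  · exact H.false_of_reaches_one_two hc' hz' h₁ h₂ h₃ h₄ h₀
  · exact H.false_of_reaches_one hc' hz' h₁ h₂ h₄ h₀

end TriangleFreeMinimal

end ReachedPatterns

theorem not_divisionMinimal {V : Type*} [Finite V] {G : SimpleGraph V}
    (hP : ¬ ContainsInduced P2UnionP4 G) (hB : ¬ ContainsInduced BullGraph G)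
    (hF : ¬ ContainsInduced GrotzschGraph G) : ¬ DivisionMinimal G := by
  intro hG
  obtain ⟨z, -⟩ : ∃ z : V, True := ⟨hG.nonempty.some, trivial⟩
  obtain ⟨c, hc, hz⟩ := exists_isC5_nonneighbors hP hB hG z
  have H : TriangleFreeMinimal G :=
    ⟨hP, hB, hF, fun x y z => triangle_free_of_divisionMinimal hP hB hG x y z, hG⟩
  exact H.false_of_hasLabel_zero hc fun i => by simpa [CycleLabel.sees] using hz i

theorem statement_9 {V : Type*} [Fintype V] (G : SimpleGraph V)
    (hP : ¬ ContainsInduced P2UnionP4 G)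
    (hbull : ¬ ContainsInduced BullGraph G) :
    G.PerfectlyDivisible ↔ ¬ ContainsInduced GrotzschGraph G := by
  refine ⟨fun h hF => not_perfectlyDivisible_of_grotzsch hF h, fun hF => ?_⟩
  refine perfectlyDivisible_of_weightedDivisible ?_
  by_contra h
  obtain ⟨S, hS⟩ := exists_divisionMinimal_of_not_weightedDivisible h
  exact not_divisionMinimal (fun h => hP h.of_induce) (fun h => hbull h.of_induce)
    (fun h => hF h.of_induce) hS
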